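/- arXiv:math/0102168 — 2 statements merged into one kernel-verified Lean document; each statement's English description precedes it below -/
import Mathlib

section
/- For every w ∈ S_n, the set of maximal elements, with respect to the Bruhat order, of the set {z ∈ S_n : z ≤ w and #R(z,w) > l(w) − l(z)} (the singular T-fixed points of the Schubert variety X_w) coincides with the set of maximal elements, with respect to the Bruhat order, of the set E_w. -/
open scoped Classical

namespace BSW

/-- The number of inversions (the length) of a permutation of `Fin n`. -/
def invLen {n : ℕ} (w : Equiv.Perm (Fin n)) : ℕ :=
  (Finset.univ.filter (fun p : Fin n × Fin n => p.1 < p.2 ∧ w p.2 < w p.1)).card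

/-- The rank function `r_w(p,q) = #{i : 1 ≤ i ≤ p and w(i) ≥ q}`, where the
permutation of `Fin n` is regarded as a permutation of `{1,…,n}` (so position
`i : Fin n` corresponds to `i+1` and value `w i` to `(w i)+1`). -/
def rank {n : ℕ} (w : Equiv.Perm (Fin n)) (p q : ℤ) : ℕ :=
  (Finset.univ.filter (fun i : Fin n =>
    ((i : ℕ) : ℤ) + 1 ≤ p ∧ q ≤ ((w i : ℕ) : ℤ) + 1)).card

/-- The difference function `d_{x,w}(p,q) = r_w(p,q) − r_x(p,q)`. -/
def dxw {n : ℕ} (x w : Equiv.Perm (Fin n)) (p q : ℤ) : ℤ :=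
  (rank w p q : ℤ) - (rank x p q : ℤ)

/-- The Bruhat order: `x ≤ w` iff `d_{x,w}` is everywhere non-negative. -/
def bruhatLE {n : ℕ} (x w : Equiv.Perm (Fin n)) : Prop :=
  ∀ p q : ℤ, 0 ≤ dxw x w p q

/-- The set of transpositions in `S_n`. -/
def transpositions (n : ℕ) : Set (Equiv.Perm (Fin n)) :=
  {t | ∃ a b : Fin n, a ≠ b ∧ t = Equiv.swap a b}

/-- `R(x,w) = {t ∈ T : l(xt) > l(x) and xt ≤ w}`. -/
def R {n : ℕ} (x w : Equiv.Perm (Fin n)) : Set (Equiv.Perm (Fin n)) :=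
  {t | t ∈ transpositions n ∧ invLen x < invLen (x * t) ∧ bruhatLE (x * t) w}

/-- `x` is a maximal singular point (MSP) for `w`. -/
def MSP {n : ℕ} (x w : Equiv.Perm (Fin n)) : Prop :=
  bruhatLE x w ∧ ((invLen w : ℤ) - (invLen x : ℤ) < ((R x w).ncard : ℤ)) ∧
    ∀ t ∈ R x w, ((R (x * t) w).ncard : ℤ) = (invLen w : ℤ) - (invLen (x * t) : ℤ)

/-- `Δ(x,w) = {i : t_{{i,j}} ∈ R(x,w) for some j}`. -/
def Delta {n : ℕ} (x w : Equiv.Perm (Fin n)) : Set (Fin n) :=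
  {i | ∃ j : Fin n, Equiv.swap i j ∈ R x w}

/-- `Δ(x,w)` as a finset. -/
noncomputable def DeltaFinset {n : ℕ} (x w : Equiv.Perm (Fin n)) : Finset (Fin n) :=
  (Set.toFinite (Delta x w)).toFinset

/-- `σ ∈ S_k` is the flattening of `x` along the increasing enumeration `d_1 < … < d_k`
of a set `D` of positions with `#D = k`: the unique permutation of `{1,…,k}` with
`σ(a) < σ(b)` iff `x(d_a) < x(d_b)`. -/
def IsFlatteningOn {n k : ℕ} (x : Equiv.Perm (Fin n)) (D : Finset (Fin n))
    (hD : D.card = k) (σ : Equiv.Perm (Fin k)) : Prop :=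
  ∀ a b : Fin k, σ a < σ b ↔ x ((D.orderIsoOfFin hD a : Fin n)) < x ((D.orderIsoOfFin hD b : Fin n))

/-- Values (0-indexed) of the permutation `x_{k,m} = [k,…,1, k+m,…,k+1]`. -/
def xkmVal (k m i : ℕ) : ℕ :=
  if i < k then k - 1 - i else 2 * k + m - 1 - i

/-- Values (0-indexed) of the permutation `w_{k,m} = [k+m, k,…,2, k+m−1,…,k+1, 1]`. -/
def wkmVal (k m i : ℕ) : ℕ :=
  if i = 0 then k + m - 1
  else if i < k then k - i
  else if i < k + m - 1 then 2 * k + m - 2 - i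
  else 0

/-- Values (0-indexed) of the permutation `x_{k,l,m} = [k,…,1, k+l,…,k+1, k+l+m,…,k+l+1]`. -/
def xklmVal (k l m i : ℕ) : ℕ :=
  if i < k then k - 1 - i
  else if i < k + l then 2 * k + l - 1 - i
  else 2 * (k + l) + m - 1 - i

/-- Values (0-indexed) of the permutation
`w_{k,l,m} = [k+l, k,…,2, k+l+m, k+l−1,…,k+2, 1, k+l+m−1,…,k+l+1, k+1]`. -/
def wklmVal (k l m i : ℕ) : ℕ :=
  if i = 0 then k + l - 1
  else if i < k then k - i
  else if i = k then k + l + m - 1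
  else if i < k + l - 1 then 2 * k + l - 1 - i
  else if i = k + l - 1 then 0
  else if i < k + l + m - 1 then 2 * (k + l) + m - 2 - i
  else k


/-- The pattern `3412` as a permutation of `Fin 4` (0-indexed: `[2,3,0,1]`). -/
def pat3412 : Equiv.Perm (Fin 4) := Equiv.swap 0 2 * Equiv.swap 1 3

/-- The pattern `1324` as a permutation of `Fin 4` (0-indexed: `[0,2,1,3]`). -/
def pat1324 : Equiv.Perm (Fin 4) := Equiv.swap 1 2

/-- The pattern `4231` as a permutation of `Fin 4` (0-indexed: `[3,1,2,0]`). -/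
def pat4231 : Equiv.Perm (Fin 4) := Equiv.swap 0 3

/-- The pattern `2143` as a permutation of `Fin 4` (0-indexed: `[1,0,3,2]`). -/
def pat2143 : Equiv.Perm (Fin 4) := Equiv.swap 0 1 * Equiv.swap 2 3

/-- The values of `u` at the four positions `p 0, p 1, p 2, p 3` have the relative
order of the pattern `v ∈ S_4`. -/
def HasPatternAt {n : ℕ} (u : Equiv.Perm (Fin n)) (p : Fin 4 → Fin n)
    (v : Equiv.Perm (Fin 4)) : Prop :=
  ∀ a b : Fin 4, u (p a) < u (p b) ↔ v a < v b

/-- `u'` is `u` rearranged at the positions `p 0 < p 1 < p 2 < p 3` into the pattern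
`v`: it agrees with `u` outside these positions, its values there are the same four
values of `u`, and their relative order is that of `v`. -/
def IsRearrangedAs {n : ℕ} (u u' : Equiv.Perm (Fin n)) (p : Fin 4 → Fin n)
    (v : Equiv.Perm (Fin 4)) : Prop :=
  (∀ i : Fin n, (∀ a : Fin 4, i ≠ p a) → u' i = u i) ∧
    (∀ a : Fin 4, ∃ b : Fin 4, u' (p a) = u (p b)) ∧
    HasPatternAt u' p v

/-- The set `E_w` of Lakshmibai–Sandhya. -/
def Ew {n : ℕ} (w : Equiv.Perm (Fin n)) : Set (Equiv.Perm (Fin n)) :=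
  {x | ∃ i j k l i' j' k' l' : Fin n,
    i < j ∧ j < k ∧ k < l ∧ i' < j' ∧ j' < k' ∧ k' < l' ∧
    ({w i, w j, w k, w l} : Set (Fin n)) = {x i', x j', x k', x l'} ∧
    ((HasPatternAt w ![i, j, k, l] pat3412 ∧
        HasPatternAt x ![i', j', k', l'] pat1324 ∧
        ∃ wlow xhigh : Equiv.Perm (Fin n),
          IsRearrangedAs w wlow ![i, j, k, l] pat1324 ∧
          IsRearrangedAs x xhigh ![i', j', k', l'] pat3412 ∧
          bruhatLE wlow x ∧ bruhatLE x xhigh ∧ bruhatLE xhigh w) ∨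
      (HasPatternAt w ![i, j, k, l] pat4231 ∧
        HasPatternAt x ![i', j', k', l'] pat2143 ∧
        ∃ wlow xhigh : Equiv.Perm (Fin n),
          IsRearrangedAs w wlow ![i, j, k, l] pat2143 ∧
          IsRearrangedAs x xhigh ![i', j', k', l'] pat4231 ∧
          bruhatLE wlow x ∧ bruhatLE x xhigh ∧ bruhatLE xhigh w))}

/-- The set of singular `T`-fixed points of `X_w`. -/
def SingSet {n : ℕ} (w : Equiv.Perm (Fin n)) : Set (Equiv.Perm (Fin n)) :=
  {z | bruhatLE z w ∧ (invLen w : ℤ) - (invLen z : ℤ) < ((R z w).ncard : ℤ)}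

open Equiv

/-- The number of points `(i, u i)` with `i ≤ p` and `u i ≥ q`, with zero-based coordinates. -/
def rk {n : ℕ} (u : Perm (Fin n)) (p q : ℤ) : ℤ :=
  ∑ i : Fin n, if (i : ℕ) ≤ p ∧ q ≤ (u i : ℕ) then 1 else 0

/-- The difference function of `x` and `w`, with zero-based coordinates. -/
def gap {n : ℕ} (x w : Perm (Fin n)) (p q : ℤ) : ℤ := rk w p q - rk x p q

/-- The number of points `(i, u i)` in the box `(p, p'] × [q, q')`. -/
def boxCount {n : ℕ} (u : Perm (Fin n)) (p p' q q' : ℤ) : ℤ :=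
  ∑ i : Fin n, if p < (i : ℕ) ∧ (i : ℕ) ≤ p' ∧ q ≤ (u i : ℕ) ∧ (u i : ℕ) < q' then 1 else 0

variable {n : ℕ} {u x w y z : Perm (Fin n)} {p p' q q' : ℤ}

lemma rank_eq_rk (u : Perm (Fin n)) (p q : ℤ) : (rank u p q : ℤ) = rk u (p - 1) (q - 1) := by
  simp only [rank, rk, Finset.card_filter]
  push_cast
  refine Finset.sum_congr rfl fun i _ => ?_
  split_ifs <;> omega

lemma bruhatLE_iff : bruhatLE x w ↔ ∀ p q : ℤ, 0 ≤ gap x w p q := by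
  simp only [bruhatLE, dxw, gap, rank_eq_rk]
  refine ⟨fun h p q => ?_, fun h p q => h _ _⟩
  simpa using h (p + 1) (q + 1)

lemma bruhatLE.gap_nonneg (h : bruhatLE x w) (p q : ℤ) : 0 ≤ gap x w p q :=
  bruhatLE_iff.1 h p q

lemma gap_add_gap (x y w : Perm (Fin n)) (p q : ℤ) :
    gap x y p q + gap y w p q = gap x w p q := by
  simp only [gap]; ring

lemma bruhatLE.trans (h : bruhatLE x y) (h' : bruhatLE y w) : bruhatLE x w :=
  bruhatLE_iff.2 fun p q => by
    have := h.gap_nonneg p q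
    have := h'.gap_nonneg p q
    have := gap_add_gap x y w p q
    omega

lemma bruhatLE_refl (x : Perm (Fin n)) : bruhatLE x x :=
  bruhatLE_iff.2 fun p q => by simp [gap]

lemma rk_box (u : Perm (Fin n)) (hp : p ≤ p') (hq : q ≤ q') :
    rk u p' q + rk u p q' = rk u p q + rk u p' q' + boxCount u p p' q q' := by
  simp only [rk, boxCount, ← Finset.sum_add_distrib]
  refine Finset.sum_congr rfl fun i _ => ?_
  split_ifs <;> omega

lemma gap_box (x w : Perm (Fin n)) (hp : p ≤ p') (hq : q ≤ q') :
    gap x w p' q + gap x w p q' + boxCount x p p' q q' =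
      gap x w p q + gap x w p' q' + boxCount w p p' q q' := by
  have := rk_box x hp hq
  have := rk_box w hp hq
  simp only [gap]
  omega

lemma boxCount_nonneg (u : Perm (Fin n)) (p p' q q' : ℤ) : 0 ≤ boxCount u p p' q q' :=
  Finset.sum_nonneg fun i _ => by split_ifs <;> omega

lemma boxCount_eq_zero
    (h : ∀ s : Fin n, p < (s : ℕ) → (s : ℕ) ≤ p' → q ≤ (u s : ℕ) → (u s : ℕ) < q' → False) :
    boxCount u p p' q q' = 0 :=
  Finset.sum_eq_zero fun i _ => if_neg fun hi => h i hi.1 hi.2.1 hi.2.2.1 hi.2.2.2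

lemma exists_of_boxCount_pos (h : 0 < boxCount u p p' q q') :
    ∃ s : Fin n, p < (s : ℕ) ∧ (s : ℕ) ≤ p' ∧ q ≤ (u s : ℕ) ∧ (u s : ℕ) < q' := by
  by_contra! hn
  have := boxCount_eq_zero (u := u) (p := p) (p' := p') (q := q) (q' := q')
    fun s h1 h2 h3 h4 => by have := hn s h1 h2 h3; omega
  omega

lemma one_le_boxCount (s : Fin n) (h1 : p < (s : ℕ)) (h2 : (s : ℕ) ≤ p') (h3 : q ≤ (u s : ℕ))
    (h4 : (u s : ℕ) < q') : 1 ≤ boxCount u p p' q q' := by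
  have := Finset.single_le_sum (f := fun i : Fin n =>
    if p < (i : ℕ) ∧ (i : ℕ) ≤ p' ∧ q ≤ (u i : ℕ) ∧ (u i : ℕ) < q' then (1 : ℤ) else 0)
    (fun i _ => by split_ifs <;> omega) (Finset.mem_univ s)
  rwa [if_pos ⟨h1, h2, h3, h4⟩] at this

lemma two_le_boxCount {s t : Fin n} (hst : s ≠ t)
    (hs : p < (s : ℕ) ∧ (s : ℕ) ≤ p' ∧ q ≤ (u s : ℕ) ∧ (u s : ℕ) < q')
    (ht : p < (t : ℕ) ∧ (t : ℕ) ≤ p' ∧ q ≤ (u t : ℕ) ∧ (u t : ℕ) < q') :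
    2 ≤ boxCount u p p' q q' := by
  have := Finset.sum_le_univ_sum_of_nonneg (s := {s, t}) (f := fun i : Fin n =>
    if p < (i : ℕ) ∧ (i : ℕ) ≤ p' ∧ q ≤ (u i : ℕ) ∧ (u i : ℕ) < q' then (1 : ℤ) else 0)
    (fun i => by split_ifs <;> omega)
  rw [Finset.sum_pair hst, if_pos hs, if_pos ht] at this
  exact this

lemma rk_of_neg (u : Perm (Fin n)) (hp : p < 0) (q : ℤ) : rk u p q = 0 :=
  Finset.sum_eq_zero fun i _ => if_neg (by omega)

lemma rk_of_le (u : Perm (Fin n)) (p : ℤ) (hq : n ≤ q) : rk u p q = 0 :=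
  Finset.sum_eq_zero fun i _ => if_neg (by have := (u i).isLt; omega)

lemma gap_of_le_row (x w : Perm (Fin n)) (p : ℤ) (hq : n ≤ q) : gap x w p q = 0 := by
  simp [gap, rk_of_le _ _ hq]

lemma gap_of_neg_col (x w : Perm (Fin n)) (hp : p < 0) (q : ℤ) : gap x w p q = 0 := by
  simp [gap, rk_of_neg _ hp]

lemma gap_of_row_nonpos (x w : Perm (Fin n)) (p : ℤ) (hq : q ≤ 0) : gap x w p q = 0 := by
  have : ∀ u : Perm (Fin n), rk u p q = ∑ i : Fin n, if (i : ℕ) ≤ p then 1 else 0 := fun u =>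
    Finset.sum_congr rfl fun i _ => by split_ifs <;> omega
  simp [gap, this]

lemma gap_of_le_col (x w : Perm (Fin n)) (hp : (n : ℤ) ≤ p + 1) (q : ℤ) : gap x w p q = 0 := by
  have : ∀ u : Perm (Fin n), rk u p q = ∑ i : Fin n, if q ≤ (i : ℕ) then 1 else 0 := fun u => by
    rw [← Equiv.sum_comp u]
    exact Finset.sum_congr rfl fun i _ => by have := i.isLt; split_ifs <;> omega
  simp [gap, this]

/-- How a sum changes when only its terms at `i` and `j` change. -/
lemma sum_sub_sum_of_eq_off {ι : Type*} [Fintype ι] {i j : ι} (hij : i ≠ j) (f g : ι → ℤ)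
    (h : ∀ k, k ≠ i → k ≠ j → g k = f k) :
    ∑ k, g k - ∑ k, f k = g i + g j - (f i + f j) := by
  rw [← Finset.sum_sub_distrib, ← Finset.sum_subset (Finset.subset_univ {i, j})]
  · rw [Finset.sum_pair hij]; ring
  · intro k _ hk
    simp only [Finset.mem_insert, Finset.mem_singleton, not_or] at hk
    rw [h k hk.1 hk.2, sub_self]

lemma mul_swap_of_ne {i j k : Fin n} (hi : k ≠ i) (hj : k ≠ j) : (x * swap i j) k = x k := by
  rw [Perm.mul_apply, swap_apply_of_ne_of_ne hi hj]

lemma mul_swap_left (x : Perm (Fin n)) (i j : Fin n) : (x * swap i j) i = x j := by simp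

lemma mul_swap_right (x : Perm (Fin n)) (i j : Fin n) : (x * swap i j) j = x i := by simp

lemma rk_mul_swap {i j : Fin n} (hij : i < j) (hx : x i < x j) (p q : ℤ) :
    rk (x * swap i j) p q = rk x p q +
      if (i : ℕ) ≤ p ∧ p < (j : ℕ) ∧ (x i : ℕ) < q ∧ q ≤ (x j : ℕ) then 1 else 0 := by
  have h := sum_sub_sum_of_eq_off hij.ne
    (fun k : Fin n => if (k : ℕ) ≤ p ∧ q ≤ (x k : ℕ) then (1 : ℤ) else 0)
    (fun k : Fin n => if (k : ℕ) ≤ p ∧ q ≤ ((x * swap i j) k : ℕ) then (1 : ℤ) else 0)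
    (fun k hi hj => by rw [mul_swap_of_ne hi hj])
  simp only [mul_swap_left, mul_swap_right] at h
  simp only [rk]
  rw [Fin.lt_def] at hij hx
  rw [sub_eq_iff_eq_add] at h
  rw [h]
  split_ifs <;> omega

lemma gap_mul_swap {i j : Fin n} (hij : i < j) (hx : x i < x j) (w : Perm (Fin n)) (p q : ℤ) :
    gap (x * swap i j) w p q = gap x w p q -
      if (i : ℕ) ≤ p ∧ p < (j : ℕ) ∧ (x i : ℕ) < q ∧ q ≤ (x j : ℕ) then 1 else 0 := by
  simp only [gap, rk_mul_swap hij hx]; ring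

lemma le_mul_swap {i j : Fin n} (hij : i < j) (hx : x i < x j) : bruhatLE x (x * swap i j) :=
  bruhatLE_iff.2 fun p q => by
    simp only [gap, rk_mul_swap hij hx]; split_ifs <;> omega

/-- `(i, j)` is an increasing pair of `x` whose box lies in the support of the difference
function of `x` and `w`; such pairs correspond to the elements of `R x w`. -/
def Good (x w : Perm (Fin n)) (i j : Fin n) : Prop :=
  i < j ∧ x i < x j ∧ ∀ p q : ℤ, (i : ℕ) ≤ p → p < (j : ℕ) → (x i : ℕ) < q → q ≤ (x j : ℕ) →
    1 ≤ gap x w p q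

lemma mul_swap_le_iff {i j : Fin n} (hij : i < j) (hx : x i < x j) (h : bruhatLE x w) :
    bruhatLE (x * swap i j) w ↔ Good x w i j := by
  simp only [bruhatLE_iff, gap_mul_swap hij hx]
  refine ⟨fun H => ⟨hij, hx, fun p q h1 h2 h3 h4 => ?_⟩, fun H p q => ?_⟩
  · have := H p q
    rw [if_pos ⟨h1, h2, h3, h4⟩] at this
    omega
  · split_ifs with hc
    · have := H.2.2 p q hc.1 hc.2.1 hc.2.2.1 hc.2.2.2
      omega
    · have := h.gap_nonneg p q
      omega

lemma gap_eq_zero_of_eq_below {f : ℕ} (h : ∀ s : Fin n, (s : ℕ) < f → x s = w s)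
    (hp : p < f) (q : ℤ) : gap x w p q = 0 := by
  rw [gap, sub_eq_zero]
  refine Finset.sum_congr rfl fun i _ => ?_
  by_cases hi : ((i : ℕ) : ℤ) ≤ p
  · rw [h i (by omega)]
  · rw [if_neg (by omega), if_neg (by omega)]

/-- If `x < w` and `f` is the first position at which `x` and `w` differ, then exchanging the
entry at `f` with the next entry whose value lies in `(x f, w f]` gives an element below `w`. -/
lemma exists_first_diff (h : bruhatLE x w) (hne : x ≠ w) :
    ∃ f b : Fin n, f < b ∧ x f < x b ∧ x b ≤ w f ∧
      (∀ s : Fin n, f < s → s < b → x f < x s → x s ≤ w f → False) ∧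
      (∀ p q : ℤ, p < (f : ℕ) → gap x w p q = 0) ∧
      gap x w (f : ℕ) ((w f : ℕ) + 1) = 0 ∧
      ∀ p q : ℤ, (f : ℕ) ≤ p → p < (b : ℕ) → (x f : ℕ) < q → q ≤ (w f : ℕ) →
        1 ≤ gap x w p q := by
  obtain ⟨f, hf, hmin⟩ := wellFounded_lt.has_min {s : Fin n | x s ≠ w s} (by
    by_contra hc
    exact hne (Equiv.ext fun s => by
      by_contra hs
      exact hc ⟨s, hs⟩))
  have heq : ∀ s : Fin n, s < f → x s = w s := fun s hs => by
    by_contra hc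
    exact hmin s hc hs
  have hzero : ∀ p q : ℤ, p < (f : ℕ) → gap x w p q = 0 := fun p q hp =>
    gap_eq_zero_of_eq_below (fun s hs => heq s hs) hp q
  have hlt : x f < w f := by
    refine lt_of_le_of_ne ?_ hf
    by_contra hc
    have h1 := gap_box x w (p := (f : ℕ) - 1) (p' := (f : ℕ)) (q := (x f : ℕ)) (q' := n)
      (by omega) (by omega)
    have h2 : boxCount w ((f : ℕ) - 1) (f : ℕ) (x f : ℕ) n = 0 :=
      boxCount_eq_zero fun s h1 h2 h3 h4 => by
        obtain rfl : s = f := by omega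
        omega
    have h3 : 1 ≤ boxCount x ((f : ℕ) - 1) (f : ℕ) (x f : ℕ) n :=
      one_le_boxCount f (by omega) (by omega) (by omega) (by omega)
    have h4 := hzero ((f : ℕ) - 1) (x f : ℕ) (by omega)
    have h5 := hzero ((f : ℕ) - 1) n (by omega)
    have h6 := gap_of_le_row x w (f : ℕ) (le_refl (n : ℤ))
    have h7 := h.gap_nonneg (f : ℕ) (x f : ℕ)
    omega
  obtain ⟨b, ⟨hfb, hb1, hb2⟩, hbmin⟩ := wellFounded_lt.has_min
    {s : Fin n | f < s ∧ x f < x s ∧ x s ≤ w f} (by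
      refine ⟨x.symm (w f), ?_, by simpa using hlt, by simp⟩
      rcases lt_trichotomy f (x.symm (w f)) with hs | hs | hs
      · exact hs
      · exact absurd ((Equiv.eq_symm_apply x).1 hs) hf
      · have := heq _ hs
        rw [apply_symm_apply] at this
        exact absurd (w.injective this) hs.ne')
  have hcov : ∀ s : Fin n, f < s → s < b → x f < x s → x s ≤ w f → False :=
    fun s h1 h2 h3 h4 => hbmin s ⟨h1, h3, h4⟩ h2
  refine ⟨f, b, hfb, hb1, hb2, hcov, hzero, ?_, fun p q h1 h2 h3 h4 => ?_⟩
  · have h1 := gap_box x w (p := (f : ℕ) - 1) (p' := (f : ℕ)) (q := (w f : ℕ) + 1) (q' := n)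
      (by omega) (by omega)
    have h2 : boxCount w ((f : ℕ) - 1) (f : ℕ) ((w f : ℕ) + 1) n = 0 :=
      boxCount_eq_zero fun s h1 h2 h3 h4 => by
        obtain rfl : s = f := by omega
        omega
    have h3 := boxCount_nonneg x ((f : ℕ) - 1) (f : ℕ) ((w f : ℕ) + 1) n
    have h4 := hzero ((f : ℕ) - 1) ((w f : ℕ) + 1) (by omega)
    have h5 := hzero ((f : ℕ) - 1) n (by omega)
    have h6 := gap_of_le_row x w (f : ℕ) (le_refl (n : ℤ))
    have h7 := h.gap_nonneg (f : ℕ) ((w f : ℕ) + 1)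
    omega
  · have h5 := gap_box x w (p := (f : ℕ) - 1) (p' := p) (q := q) (q' := (w f : ℕ) + 1)
      (by omega) (by omega)
    have h6 : boxCount x ((f : ℕ) - 1) p q ((w f : ℕ) + 1) = 0 :=
      boxCount_eq_zero fun s h1 h2 h3 h4 => by
        rcases eq_or_ne s f with rfl | hs
        · omega
        · exact hcov s (by omega) (by omega) (by omega) (by omega)
    have h7 : 1 ≤ boxCount w ((f : ℕ) - 1) p q ((w f : ℕ) + 1) :=
      one_le_boxCount f (by omega) (by omega) (by omega) (by omega)
    have h8 := hzero ((f : ℕ) - 1) ((w f : ℕ) + 1) (by omega)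
    have h9 := hzero ((f : ℕ) - 1) q (by omega)
    have h10 := h.gap_nonneg p ((w f : ℕ) + 1)
    omega

lemma bruhatLE.antisymm (h : bruhatLE x w) (h' : bruhatLE w x) : x = w := by
  by_contra hne
  obtain ⟨f, b, hfb, h1, h2, -, -, -, h3⟩ := exists_first_diff h hne
  have h4 := h3 (f : ℕ) (x b : ℕ) le_rfl (by omega) (by omega) (by omega)
  have h5 := h'.gap_nonneg (f : ℕ) (x b : ℕ)
  simp only [gap] at h4 h5
  omega

/-- The indicator of the symmetric closure of a relation. -/
noncomputable def pairInd (r : Fin n → Fin n → Prop) (i j : Fin n) : ℤ :=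
  if r i j ∨ r j i then 1 else 0

lemma pairInd_comm (r : Fin n → Fin n → Prop) (i j : Fin n) : pairInd r i j = pairInd r j i := by
  simp only [pairInd, or_comm]

lemma sum_pairInd (r : Fin n → Fin n → Prop) (hr : ∀ i j, r i j → i < j) :
    ∑ i, ∑ j, pairInd r i j =
      2 * ((Finset.univ.filter fun p : Fin n × Fin n => r p.1 p.2).card : ℤ) := by
  have h1 : ((Finset.univ.filter fun p : Fin n × Fin n => r p.1 p.2).card : ℤ) =
      ∑ i, ∑ j, if r i j then 1 else 0 := by
    rw [Finset.card_filter, Fintype.sum_prod_type]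
    push_cast
    rfl
  have h2 : ∑ i, ∑ j, pairInd r i j =
      ∑ i, ∑ j, ((if r i j then 1 else 0) + if r j i then 1 else 0) := by
    refine Finset.sum_congr rfl fun i _ => Finset.sum_congr rfl fun j _ => ?_
    have := hr i j
    have := hr j i
    simp only [pairInd]
    split_ifs <;> first | omega | tauto | (exfalso; exact lt_asymm (hr i j ‹_›) (hr j i ‹_›))
  rw [h2, h1]
  simp only [Finset.sum_add_distrib]
  rw [Finset.sum_comm (f := fun i j => if r j i then (1 : ℤ) else 0)]
  ring

lemma sum_pairs_split {F : Fin n → Fin n → ℤ} (hF : ∀ i j, F i j = F j i) (hF' : ∀ i, F i i = 0)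
    {i j : Fin n} (hij : i ≠ j) :
    ∑ k, ∑ l, F k l =
      ∑ k ∈ (Finset.univ.erase i).erase j, ∑ l ∈ (Finset.univ.erase i).erase j, F k l +
        2 * ∑ k ∈ (Finset.univ.erase i).erase j, (F i k + F j k) + 2 * F i j := by
  have h : ∀ g : Fin n → ℤ,
      ∑ k, g k = g i + (g j + ∑ k ∈ (Finset.univ.erase i).erase j, g k) := fun g => by
    rw [Finset.add_sum_erase _ _ (by simp [hij.symm]), Finset.add_sum_erase _ _ (by simp)]
  simp only [h, Finset.sum_add_distrib, hF', hF j i]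
  have h1 : ∀ l, ∑ k ∈ (Finset.univ.erase i).erase j, F k l =
      ∑ k ∈ (Finset.univ.erase i).erase j, F l k := fun l =>
    Finset.sum_congr rfl fun k _ => hF k l
  rw [h1, h1]
  ring

lemma sum_pairInd_sub {r r' : Fin n → Fin n → Prop} (hr : ∀ i j, r i j → i < j)
    (hr' : ∀ i j, r' i j → i < j) {i j : Fin n} (hij : i ≠ j) :
    ∑ k, ∑ l, pairInd r' k l - ∑ k, ∑ l, pairInd r k l =
      ∑ k ∈ (Finset.univ.erase i).erase j, ∑ l ∈ (Finset.univ.erase i).erase j,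
        (pairInd r' k l - pairInd r k l) +
        2 * ∑ k ∈ (Finset.univ.erase i).erase j,
          ((pairInd r' i k + pairInd r' j k) - (pairInd r i k + pairInd r j k)) +
        2 * (pairInd r' i j - pairInd r i j) := by
  have h0 : ∀ r : Fin n → Fin n → Prop, (∀ i j, r i j → i < j) → ∀ i, pairInd r i i = 0 :=
    fun r hr i => if_neg fun h => (h.elim (hr i i) (hr i i)).false
  rw [sum_pairs_split (pairInd_comm r) (h0 r hr) hij,
    sum_pairs_split (pairInd_comm r') (h0 r' hr') hij]
  simp only [Finset.sum_sub_distrib]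
  ring

lemma sum_pairInd_inv (u : Perm (Fin n)) :
    ∑ i, ∑ j, pairInd (fun k l => k < l ∧ u l < u k) i j = 2 * (invLen u : ℤ) := by
  rw [sum_pairInd _ fun _ _ h => h.1, invLen]
  congr!

lemma invLen_mul_swap {i j : Fin n} (hij : i < j) (hx : x i < x j) :
    invLen x < invLen (x * swap i j) ∧
      ((∀ s : Fin n, i < s → s < j → x i < x s → x s < x j → False) →
        invLen (x * swap i j) = invLen x + 1) := by
  have h := sum_pairInd_sub (r := fun k l => k < l ∧ x l < x k)
    (r' := fun k l => k < l ∧ (x * swap i j) l < (x * swap i j) k)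
    (fun _ _ h => h.1) (fun _ _ h => h.1) hij.ne
  have h1 : ∑ k ∈ (Finset.univ.erase i).erase j, ∑ l ∈ (Finset.univ.erase i).erase j,
      (pairInd (fun k l => k < l ∧ (x * swap i j) l < (x * swap i j) k) k l -
        pairInd (fun k l => k < l ∧ x l < x k) k l) = 0 :=
    Finset.sum_eq_zero fun k hk => Finset.sum_eq_zero fun l hl => by
      simp only [Finset.mem_erase] at hk hl
      simp only [pairInd, mul_swap_of_ne hk.2.1 hk.1, mul_swap_of_ne hl.2.1 hl.1]
      split_ifs <;> omega
  have h2 : pairInd (fun k l => k < l ∧ (x * swap i j) l < (x * swap i j) k) i j -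
      pairInd (fun k l => k < l ∧ x l < x k) i j = 1 := by
    simp only [pairInd, mul_swap_left, mul_swap_right]
    split_ifs <;> omega
  have h3 : ∀ k ∈ (Finset.univ.erase i).erase j,
      (pairInd (fun k l => k < l ∧ (x * swap i j) l < (x * swap i j) k) i k +
        pairInd (fun k l => k < l ∧ (x * swap i j) l < (x * swap i j) k) j k) -
      (pairInd (fun k l => k < l ∧ x l < x k) i k + pairInd (fun k l => k < l ∧ x l < x k) j k) =
      if i < k ∧ k < j ∧ x i < x k ∧ x k < x j then 2 else 0 := fun k hk => by
    simp only [Finset.mem_erase] at hk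
    have := x.injective.ne hk.1
    have := x.injective.ne hk.2.1
    simp only [pairInd, mul_swap_left, mul_swap_right, mul_swap_of_ne hk.2.1 hk.1]
    split_ifs <;> omega
  rw [h1, h2, Finset.sum_congr rfl h3] at h
  rw [sum_pairInd_inv, sum_pairInd_inv] at h
  constructor
  · have : 0 ≤ ∑ k ∈ (Finset.univ.erase i).erase j,
        if i < k ∧ k < j ∧ x i < x k ∧ x k < x j then (2 : ℤ) else 0 :=
      Finset.sum_nonneg fun k _ => by split_ifs <;> omega
    omega
  · intro hc
    rw [Finset.sum_eq_zero fun k _ => if_neg fun hk => hc k hk.1 hk.2.1 hk.2.2.1 hk.2.2.2] at h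
    omega

lemma invLen_lt_mul_swap_iff {i j : Fin n} (hij : i < j) :
    invLen x < invLen (x * swap i j) ↔ x i < x j := by
  refine ⟨fun h => ?_, fun h => (invLen_mul_swap hij h).1⟩
  by_contra hc
  have h1 := (invLen_mul_swap (x := x * swap i j) hij (by
    rw [mul_swap_left, mul_swap_right]
    exact lt_of_le_of_ne (not_lt.1 hc) (x.injective.ne hij.ne'))).1
  rw [mul_assoc, swap_mul_self, mul_one] at h1
  omega

/-- The elements of `R x w` correspond to the good pairs. -/
lemma ncard_R (h : bruhatLE x w) :
    (R x w).ncard = (Finset.univ.filter fun p : Fin n × Fin n => Good x w p.1 p.2).card := by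
  have h1 : R x w = (fun p : Fin n × Fin n => swap p.1 p.2) ''
      (Finset.univ.filter fun p : Fin n × Fin n => Good x w p.1 p.2 : Finset (Fin n × Fin n)) := by
    ext t
    simp only [R, transpositions, Set.mem_ofPred_eq, Set.mem_image, Finset.coe_filter,
      Finset.mem_univ, true_and, Prod.exists]
    have key : ∀ i j : Fin n, i < j →
        ((invLen x < invLen (x * swap i j) ∧ bruhatLE (x * swap i j) w) ↔ Good x w i j) := by
      intro i j hij
      rw [invLen_lt_mul_swap_iff hij]
      refine ⟨fun H => (mul_swap_le_iff hij H.1 h).1 H.2, fun H => ⟨H.2.1, ?_⟩⟩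
      exact (mul_swap_le_iff hij H.2.1 h).2 H
    constructor
    · rintro ⟨⟨i, j, hij, rfl⟩, h2⟩
      rcases lt_or_gt_of_ne hij with hlt | hlt
      · exact ⟨i, j, (key i j hlt).1 h2, rfl⟩
      · rw [swap_comm] at h2 ⊢
        exact ⟨j, i, (key j i hlt).1 h2, rfl⟩
    · rintro ⟨i, j, hg, rfl⟩
      exact ⟨⟨i, j, hg.1.ne, rfl⟩, (key i j hg.1).2 hg⟩
  rw [h1, Set.InjOn.ncard_image, Set.ncard_coe_finset]
  rintro ⟨i, j⟩ hij ⟨k, l⟩ hkl heq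
  simp only [Finset.coe_filter, Finset.mem_univ, true_and, Set.mem_ofPred_eq] at hij hkl heq
  have h2 := hij.1
  have h3 := hkl.1
  have h4 : swap k l i = j := by rw [← heq, swap_apply_left]
  have h5 : swap k l j = i := by rw [← heq, swap_apply_right]
  rw [swap_apply_def] at h4 h5
  split_ifs at h4 h5 <;> first | omega | (subst_vars; simp_all) 

/-- The number of good pairs formed by `k` and one of `i`, `j`. -/
noncomputable def goodInd (x w : Perm (Fin n)) (i j k : Fin n) : ℤ :=
  pairInd (Good x w) i k + pairInd (Good x w) j k

lemma pairInd_of_lt {i j : Fin n} (hij : i < j) :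
    pairInd (Good x w) i j = if Good x w i j then 1 else 0 := by
  have h : ¬ Good x w j i := fun h => lt_asymm h.1 hij
  simp [pairInd, h]

lemma pairInd_of_gt {i j : Fin n} (hij : j < i) :
    pairInd (Good x w) i j = if Good x w j i then 1 else 0 := by
  rw [pairInd_comm, pairInd_of_lt hij]

/-- `(i, j)` is an increasing pair of `x` with no other entry of `x` inside its box. -/
def IsCover (x : Perm (Fin n)) (i j : Fin n) : Prop :=
  i < j ∧ x i < x j ∧ ∀ s : Fin n, i < s → s < j → x i < x s → x s < x j → False

lemma two_mul_ncard_R_sub {i j : Fin n} (hij : i < j) (hx : x i < x j) (h : bruhatLE x w)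
    (hg : Good x w i j) :
    2 * ((R x w).ncard : ℤ) - 2 * ((R (x * swap i j) w).ncard : ℤ) =
      ∑ k ∈ (Finset.univ.erase i).erase j, ∑ l ∈ (Finset.univ.erase i).erase j,
        (pairInd (Good x w) k l - pairInd (Good (x * swap i j) w) k l) +
        2 * ∑ k ∈ (Finset.univ.erase i).erase j,
          (goodInd x w i j k - goodInd (x * swap i j) w i j k) + 2 := by
  rw [ncard_R h, ncard_R ((mul_swap_le_iff hij hx h).2 hg),
    ← sum_pairInd _ fun _ _ h => h.1, ← sum_pairInd _ fun _ _ h => h.1,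
    sum_pairInd_sub (fun _ _ h => h.1) (fun _ _ h => h.1) hij.ne]
  have h1 : pairInd (Good x w) i j = 1 := by rw [pairInd_of_lt hij, if_pos hg]
  have h2 : pairInd (Good (x * swap i j) w) i j = 0 := by
    rw [pairInd_of_lt hij, if_neg]
    intro hc
    have := hc.2.1
    rw [mul_swap_left, mul_swap_right] at this
    exact lt_asymm this hx
  rw [h1, h2]
  rfl

lemma gap_mul_swap_le {i j : Fin n} (hij : i < j) (hx : x i < x j) (w : Perm (Fin n)) (p q : ℤ) :
    gap (x * swap i j) w p q ≤ gap x w p q := by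
  rw [gap_mul_swap hij hx]; split_ifs <;> omega

lemma Good.of_mul_swap {i j k l : Fin n} (hij : i < j) (hx : x i < x j)
    (hk : k ≠ i ∧ k ≠ j) (hl : l ≠ i ∧ l ≠ j) (h : Good (x * swap i j) w k l) : Good x w k l := by
  obtain ⟨h1, h2, h3⟩ := h
  rw [mul_swap_of_ne hk.1 hk.2, mul_swap_of_ne hl.1 hl.2] at h2 h3
  exact ⟨h1, h2, fun p q a b c d => (h3 p q a b c d).trans (gap_mul_swap_le hij hx w p q)⟩

lemma pairInd_mul_swap_le {i j k l : Fin n} (hij : i < j) (hx : x i < x j)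
    (hk : k ≠ i ∧ k ≠ j) (hl : l ≠ i ∧ l ≠ j) :
    pairInd (Good (x * swap i j) w) k l ≤ pairInd (Good x w) k l := by
  have h1 : Good (x * swap i j) w k l → Good x w k l := Good.of_mul_swap hij hx hk hl
  have h2 : Good (x * swap i j) w l k → Good x w l k := Good.of_mul_swap hij hx hl hk
  simp only [pairInd]
  split_ifs <;> first | omega | tauto

lemma goodInd_mul_swap_le {i j k : Fin n} (hc : IsCover x i j) (hg : Good x w i j)
    (hki : k ≠ i) (hkj : k ≠ j) : goodInd (x * swap i j) w i j k ≤ goodInd x w i j k := by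
  obtain ⟨hij, hx, hcov⟩ := hc
  have hle := gap_mul_swap_le hij hx w
  have hoff : ∀ p q : ℤ, ¬ ((i : ℕ) ≤ p ∧ p < (j : ℕ) ∧ (x i : ℕ) < q ∧ q ≤ (x j : ℕ)) →
      gap (x * swap i j) w p q = gap x w p q := fun p q h => by
    rw [gap_mul_swap hij hx, if_neg h, sub_zero]
  have hxi := x.injective.ne hki
  have hxj := x.injective.ne hkj
  rcases lt_or_gt_of_ne hki with h1 | h1
  · have h2 : k < j := h1.trans hij
    simp only [goodInd, pairInd_of_gt h1, pairInd_of_gt h2]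
    have a1 : Good (x * swap i j) w k i → x k < x i → Good x w k i := fun h hr =>
      ⟨h1, hr, fun p q c1 c2 c3 c4 => (h.2.2 p q c1 c2
        (by rw [mul_swap_of_ne hki hkj]; omega) (by rw [mul_swap_left]; omega)).trans (hle p q)⟩
    have a2 : Good (x * swap i j) w k j → Good x w k i := fun h => by
      obtain ⟨-, e2, e3⟩ := h
      rw [mul_swap_of_ne hki hkj, mul_swap_right] at e2 e3
      exact ⟨h1, e2, fun p q c1 c2 c3 c4 => (e3 p q c1 (by omega) c3 c4).trans (hle p q)⟩
    have a3 : Good (x * swap i j) w k i → (x k < x i → Good (x * swap i j) w k j) →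
        Good x w k j := fun h h' => by
      obtain ⟨-, e2, e3⟩ := h
      rw [mul_swap_of_ne hki hkj, mul_swap_left] at e2 e3
      refine ⟨h2, e2, fun p q c1 c2 c3 c4 => ?_⟩
      by_cases c5 : p < (i : ℕ)
      · exact (e3 p q c1 c5 c3 c4).trans (hle p q)
      · by_cases c6 : (x i : ℕ) < q
        · exact hg.2.2 p q (by omega) c2 c6 c4
        · have := (h' (by omega)).2.2 p q c1 c2 (by rw [mul_swap_of_ne hki hkj]; omega)
            (by rw [mul_swap_right]; omega)
          exact this.trans (hle p q)
    have a4 : Good (x * swap i j) w k j → x k < x i := fun h => by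
      have := h.2.1
      rwa [mul_swap_of_ne hki hkj, mul_swap_right] at this
    by_cases hr : x k < x i <;> split_ifs <;> first | omega | tauto
  rcases lt_or_gt_of_ne hkj with h2 | h2
  · simp only [goodInd, pairInd_of_lt h1, pairInd_of_gt h2]
    have a1 : Good (x * swap i j) w i k → Good x w i k := fun h => by
      obtain ⟨-, e2, e3⟩ := h
      rw [mul_swap_of_ne hki hkj, mul_swap_left] at e2 e3
      refine ⟨h1, by omega, fun p q c1 c2 c3 c4 => ?_⟩
      by_cases c5 : (x j : ℕ) < q
      · exact (e3 p q c1 c2 c5 c4).trans (hle p q)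
      · exact hg.2.2 p q c1 (by omega) c3 (by omega)
    have a2 : Good (x * swap i j) w k j → Good x w k j := fun h => by
      obtain ⟨-, e2, e3⟩ := h
      rw [mul_swap_of_ne hki hkj, mul_swap_right] at e2 e3
      refine ⟨h2, by omega, fun p q c1 c2 c3 c4 => ?_⟩
      by_cases c5 : (x i : ℕ) < q
      · exact hg.2.2 p q (by omega) c2 c5 c4
      · exact (e3 p q c1 c2 c3 (by omega)).trans (hle p q)
    split_ifs <;> first | omega | tauto
  · simp only [goodInd, pairInd_of_lt h1, pairInd_of_lt h2]
    have a1 : Good (x * swap i j) w j k → x j < x k → Good x w j k := fun h hr =>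
      ⟨h2, hr, fun p q c1 c2 c3 c4 => (h.2.2 p q c1 c2 (by rw [mul_swap_right]; omega)
        (by rw [mul_swap_of_ne hki hkj]; omega)).trans (hle p q)⟩
    have a2 : Good (x * swap i j) w i k → Good x w j k := fun h => by
      obtain ⟨-, e2, e3⟩ := h
      rw [mul_swap_of_ne hki hkj, mul_swap_left] at e2 e3
      exact ⟨h2, e2, fun p q c1 c2 c3 c4 => (e3 p q (by omega) c2 c3 c4).trans (hle p q)⟩
    have a3 : Good (x * swap i j) w j k → (x j < x k → Good (x * swap i j) w i k) →
        Good x w i k := fun h h' => by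
      obtain ⟨-, e2, e3⟩ := h
      rw [mul_swap_of_ne hki hkj, mul_swap_right] at e2 e3
      refine ⟨h1, e2, fun p q c1 c2 c3 c4 => ?_⟩
      by_cases c5 : (j : ℕ) ≤ p
      · exact (e3 p q c5 c2 c3 c4).trans (hle p q)
      · by_cases c6 : q ≤ (x j : ℕ)
        · exact hg.2.2 p q c1 (by omega) c3 c6
        · have := (h' (by omega)).2.2 p q c1 c2 (by rw [mul_swap_left]; omega)
            (by rw [mul_swap_of_ne hki hkj]; omega)
          exact this.trans (hle p q)
    have a4 : Good (x * swap i j) w i k → x j < x k := fun h => by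
      have := h.2.1
      rwa [mul_swap_of_ne hki hkj, mul_swap_left] at this
    by_cases hr : x j < x k <;> split_ifs <;> first | omega | tauto

lemma ncard_R_mul_swap_add_one_le {i j : Fin n} (hc : IsCover x i j) (h : bruhatLE x w)
    (hg : Good x w i j) : (R (x * swap i j) w).ncard + 1 ≤ (R x w).ncard := by
  have h1 := two_mul_ncard_R_sub hc.1 hc.2.1 h hg
  have h2 : 0 ≤ ∑ k ∈ (Finset.univ.erase i).erase j, ∑ l ∈ (Finset.univ.erase i).erase j,
      (pairInd (Good x w) k l - pairInd (Good (x * swap i j) w) k l) :=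
    Finset.sum_nonneg fun k hk => Finset.sum_nonneg fun l hl => by
      simp only [Finset.mem_erase] at hk hl
      exact sub_nonneg.2 (pairInd_mul_swap_le hc.1 hc.2.1 ⟨hk.2.1, hk.1⟩ ⟨hl.2.1, hl.1⟩)
  have h3 : 0 ≤ ∑ k ∈ (Finset.univ.erase i).erase j,
      (goodInd x w i j k - goodInd (x * swap i j) w i j k) :=
    Finset.sum_nonneg fun k hk => by
      simp only [Finset.mem_erase] at hk
      exact sub_nonneg.2 (goodInd_mul_swap_le hc hg hk.2.1 hk.1)
  omega

/-- A good pair disjoint from the cover `(i, j)` that is lost on passing to `x * swap i j`. -/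
lemma ncard_R_mul_swap_add_one_lt_of_disjoint {i j k l : Fin n} (hc : IsCover x i j)
    (h : bruhatLE x w) (hg : Good x w i j) (hk : k ≠ i ∧ k ≠ j) (hl : l ≠ i ∧ l ≠ j)
    (hkl : Good x w k l) (hkl' : ¬ Good (x * swap i j) w k l) :
    (R (x * swap i j) w).ncard + 1 < (R x w).ncard := by
  have h1 := two_mul_ncard_R_sub hc.1 hc.2.1 h hg
  have h0 : ∀ k ∈ (Finset.univ.erase i).erase j, ∀ l ∈ (Finset.univ.erase i).erase j,
      0 ≤ pairInd (Good x w) k l - pairInd (Good (x * swap i j) w) k l := fun k hk l hl => by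
    simp only [Finset.mem_erase] at hk hl
    exact sub_nonneg.2 (pairInd_mul_swap_le hc.1 hc.2.1 ⟨hk.2.1, hk.1⟩ ⟨hl.2.1, hl.1⟩)
  have hkm : k ∈ (Finset.univ.erase i).erase j := by simp [hk.1, hk.2]
  have hlm : l ∈ (Finset.univ.erase i).erase j := by simp [hl.1, hl.2]
  have h2 := Finset.single_le_sum (f := fun k => ∑ l ∈ (Finset.univ.erase i).erase j,
    (pairInd (Good x w) k l - pairInd (Good (x * swap i j) w) k l))
    (fun k hk => Finset.sum_nonneg (h0 k hk)) hkm
  have h2' := Finset.single_le_sum (h0 k hkm) hlm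
  rw [pairInd_of_lt hkl.1, pairInd_of_lt hkl.1, if_pos hkl, if_neg hkl'] at h2'
  have h3 : 0 ≤ ∑ k ∈ (Finset.univ.erase i).erase j,
      (goodInd x w i j k - goodInd (x * swap i j) w i j k) :=
    Finset.sum_nonneg fun k hk => by
      simp only [Finset.mem_erase] at hk
      exact sub_nonneg.2 (goodInd_mul_swap_le hc hg hk.2.1 hk.1)
  omega

/-- Three entries `i < j < k` of an increasing chain such that the good pair `(j, k)` is lost
on passing to `x * swap i j`. -/
lemma ncard_R_mul_swap_add_one_lt_of_chain {i j k : Fin n} (hc : IsCover x i j)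
    (h : bruhatLE x w) (hg : Good x w i j) (hjk : Good x w j k)
    (h1 : ∃ p q : ℤ, (i : ℕ) ≤ p ∧ p < (j : ℕ) ∧ (x j : ℕ) < q ∧ q ≤ (x k : ℕ) ∧ gap x w p q = 0)
    (h2 : ∃ p q : ℤ, (j : ℕ) ≤ p ∧ p < (k : ℕ) ∧ (x i : ℕ) < q ∧ q ≤ (x j : ℕ) ∧
      gap x w p q = 0) :
    (R (x * swap i j) w).ncard + 1 < (R x w).ncard := by
  have h3 := two_mul_ncard_R_sub hc.1 hc.2.1 h hg
  have h4 : 0 ≤ ∑ k ∈ (Finset.univ.erase i).erase j, ∑ l ∈ (Finset.univ.erase i).erase j,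
      (pairInd (Good x w) k l - pairInd (Good (x * swap i j) w) k l) :=
    Finset.sum_nonneg fun k hk => Finset.sum_nonneg fun l hl => by
      simp only [Finset.mem_erase] at hk hl
      exact sub_nonneg.2 (pairInd_mul_swap_le hc.1 hc.2.1 ⟨hk.2.1, hk.1⟩ ⟨hl.2.1, hl.1⟩)
  have hki : k ≠ i := (hc.1.trans hjk.1).ne'
  have hkj : k ≠ j := hjk.1.ne'
  have hkm : k ∈ (Finset.univ.erase i).erase j := by simp [hki, hkj]
  have h5 := Finset.single_le_sum (f := fun k => goodInd x w i j k - goodInd (x * swap i j) w i j k)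
    (fun k hk => by
      simp only [Finset.mem_erase] at hk
      exact sub_nonneg.2 (goodInd_mul_swap_le hc hg hk.2.1 hk.1)) hkm
  have hle := gap_mul_swap_le hc.1 hc.2.1 w
  have h6 : goodInd (x * swap i j) w i j k = 0 := by
    rw [goodInd, pairInd_of_lt (hc.1.trans hjk.1), pairInd_of_lt hjk.1, if_neg, if_neg, add_zero]
    · rintro ⟨-, -, e⟩
      obtain ⟨p, q, c1, c2, c3, c4, c5⟩ := h2
      have := hjk.2.1
      have := e p q c1 c2 (by rwa [mul_swap_right])
        (by rw [mul_swap_of_ne hki hkj]; omega)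
      have := hle p q
      omega
    · rintro ⟨-, -, e⟩
      obtain ⟨p, q, c1, c2, c3, c4, c5⟩ := h1
      have := hjk.1
      have := e p q c1 (by omega) (by rwa [mul_swap_left])
        (by rwa [mul_swap_of_ne hki hkj])
      have := hle p q
      omega
  have h7 : 1 ≤ goodInd x w i j k := by
    rw [goodInd, pairInd_of_lt (hc.1.trans hjk.1), pairInd_of_lt hjk.1, if_pos hjk]
    split_ifs <;> omega
  omega

/-- **Deodhar's inequality.** -/
lemma invLen_sub_le_ncard_R (h : bruhatLE x w) :
    invLen x ≤ invLen w ∧ invLen w ≤ (R x w).ncard + invLen x := by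
  induction hN : n * n - invLen x using Nat.strong_induction_on generalizing x with
  | _ N ih =>
    rcases eq_or_ne x w with rfl | hne
    · omega
    obtain ⟨f, b, hfb, h1, h2, hcov, -, -, h3⟩ := exists_first_diff h hne
    have hc : IsCover x f b := ⟨hfb, h1, fun s a1 a2 a3 a4 => hcov s a1 a2 a3 (a4.le.trans h2)⟩
    have hg : Good x w f b := ⟨hfb, h1, fun p q a1 a2 a3 a4 => h3 p q a1 a2 a3 (by omega)⟩
    have h4 := (mul_swap_le_iff hfb h1 h).2 hg
    have h5 := (invLen_mul_swap hfb h1).2 hc.2.2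
    have h6 : ∀ u : Perm (Fin n), invLen u ≤ n * n := fun u => by
      refine (Finset.card_le_univ _).trans ?_
      simp
    have h7 := ncard_R_mul_swap_add_one_le hc h hg
    have h8 := h6 (x * swap f b)
    have := ih _ (by omega) h4 rfl
    omega

/-- An element strictly more of whose reflections survive than the length allows is singular. -/
lemma mem_SingSet_of_lt {i j : Fin n} (hc : IsCover x i j) (h : bruhatLE x w)
    (hg : Good x w i j) (hlt : (R (x * swap i j) w).ncard + 1 < (R x w).ncard) :
    x ∈ SingSet w := by
  refine ⟨h, ?_⟩
  have h1 := (invLen_sub_le_ncard_R ((mul_swap_le_iff hc.1 hc.2.1 h).2 hg)).2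
  have h2 := (invLen_mul_swap hc.1 hc.2.1).2 hc.2.2
  omega

lemma goodInd_le_mul_swap {f b k : Fin n} (hfb : f < b)
    (hx : x f < x b) (hb : x b ≤ w f)
    (hcov : ∀ s : Fin n, f < s → s < b → x f < x s → x s ≤ w f → False)
    (hzero : ∀ p q : ℤ, p < (f : ℕ) → gap x w p q = 0)
    (hf : gap x w (f : ℕ) ((w f : ℕ) + 1) = 0)
    (hpos : ∀ p q : ℤ, (f : ℕ) ≤ p → p < (b : ℕ) → (x f : ℕ) < q → q ≤ (w f : ℕ) →
        1 ≤ gap x w p q)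
    (hkf : k ≠ f) (hkb : k ≠ b)
    (hB : w f < x k → Good x w b k → ∀ p q : ℤ, (b : ℕ) ≤ p → p < (k : ℕ) → (x f : ℕ) < q →
      q ≤ (x b : ℕ) → 1 ≤ gap x w p q) :
    goodInd x w f b k ≤ goodInd (x * swap f b) w f b k := by
  have hoff : ∀ p q : ℤ, ¬ ((f : ℕ) ≤ p ∧ p < (b : ℕ) ∧ (x f : ℕ) < q ∧ q ≤ (x b : ℕ)) →
      gap (x * swap f b) w p q = gap x w p q := fun p q h => by
    rw [gap_mul_swap hfb hx, if_neg h, sub_zero]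
  have hxf := x.injective.ne hkf
  have hxb := x.injective.ne hkb
  rcases lt_or_gt_of_ne hkf with h1 | h1
  · have h2 : k < b := h1.trans hfb
    have h0 : ∀ l, k < l → ¬ Good x w k l := fun l hl e => by
      have e2 := e.2.1
      have := e.2.2 (k : ℕ) ((x k : ℕ) + 1) le_rfl (by omega) (by omega) (by omega)
      have := hzero (k : ℕ) ((x k : ℕ) + 1) (by omega)
      omega
    simp only [goodInd, pairInd_of_gt h1, pairInd_of_gt h2, if_neg (h0 _ h1), if_neg (h0 _ h2)]
    split_ifs <;> omega
  rcases lt_or_gt_of_ne hkb with h2 | h2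
  · simp only [goodInd, pairInd_of_lt h1, pairInd_of_gt h2]
    have a0 := hcov k h1 h2
    have a1 : Good x w f k → Good (x * swap f b) w f k := fun ⟨_, e2, e3⟩ => by
      refine ⟨h1, ?_, ?_⟩ <;> rw [mul_swap_of_ne hkf hkb, mul_swap_left]
      · by_contra hcon
        exact a0 e2 (by omega)
      · intro p q c1 c2 c3 c4
        rw [hoff _ _ (by omega)]
        exact e3 p q c1 c2 (by omega) c4
    have a2 : Good x w k b → Good (x * swap f b) w k b := fun ⟨_, e2, e3⟩ => by
      have e4 : x k < x f := by
        by_contra hcon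
        exact a0 (by omega) (by omega)
      refine ⟨h2, ?_, ?_⟩ <;> rw [mul_swap_of_ne hkf hkb, mul_swap_right]
      · exact e4
      · intro p q c1 c2 c3 c4
        rw [hoff _ _ (by omega)]
        exact e3 p q c1 c2 c3 (by omega)
    split_ifs <;> first | omega | tauto
  · simp only [goodInd, pairInd_of_lt h1, pairInd_of_lt h2]
    have a1 : Good x w f k → Good (x * swap f b) w b k := fun ⟨_, e2, e3⟩ => by
      refine ⟨h2, ?_, ?_⟩ <;> rw [mul_swap_of_ne hkf hkb, mul_swap_right]
      · exact e2
      · intro p q c1 c2 c3 c4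
        rw [hoff _ _ (by omega)]
        exact e3 p q (by omega) c2 c3 c4
    have a3 : Good x w b k → w f < x k → Good (x * swap f b) w b k := fun e hlt => by
      have e2 := e.2.1
      refine ⟨h2, ?_, ?_⟩ <;> rw [mul_swap_of_ne hkf hkb, mul_swap_right]
      · omega
      · intro p q c1 c2 c3 c4
        rw [hoff _ _ (by omega)]
        by_cases c5 : (x b : ℕ) < q
        · exact e.2.2 p q c1 c2 c5 c4
        · exact hB hlt e p q c1 c2 c3 (by omega)
    have a4 : Good x w b k → ¬ w f < x k → Good (x * swap f b) w f k := fun e hlt => by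
      have e2 := e.2.1
      refine ⟨h1, ?_, ?_⟩ <;> rw [mul_swap_of_ne hkf hkb, mul_swap_left]
      · exact e2
      · intro p q c1 c2 c3 c4
        rw [hoff _ _ (by omega)]
        by_cases c5 : p < (b : ℕ)
        · exact hpos p q c1 c5 (by omega) (by omega)
        · exact e.2.2 p q (by omega) c2 c3 c4
    have a5 : Good x w f k → ¬ w f < x k := fun e hlt => by
      have := e.2.2 (f : ℕ) ((w f : ℕ) + 1) le_rfl (by omega) (by omega) (by omega)
      omega
    by_cases hlt : w f < x k
    · rw [if_neg fun e => a5 e hlt]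
      by_cases e : Good x w b k
      · rw [if_pos e, if_pos (a3 e hlt)]
        split_ifs <;> omega
      · rw [if_neg e]
        split_ifs <;> omega
    · have a6 : Good x w b k → Good (x * swap f b) w f k := fun e => a4 e hlt
      clear a3 a4 a5
      split_ifs <;> first | omega | tauto

/-- If `x` is singular but `x * swap f b` is not, where `(f, b)` is the pair of
`exists_first_diff`, then some good pair is lost. -/
lemma exists_lost_pair (h : bruhatLE x w) (hs : x ∈ SingSet w) {f b : Fin n} (hfb : f < b)
    (hx : x f < x b) (hb : x b ≤ w f)
    (hcov : ∀ s : Fin n, f < s → s < b → x f < x s → x s ≤ w f → False)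
    (hzero : ∀ p q : ℤ, p < (f : ℕ) → gap x w p q = 0)
    (hf : gap x w (f : ℕ) ((w f : ℕ) + 1) = 0)
    (hpos : ∀ p q : ℤ, (f : ℕ) ≤ p → p < (b : ℕ) → (x f : ℕ) < q → q ≤ (w f : ℕ) →
        1 ≤ gap x w p q)
    (hns : x * swap f b ∉ SingSet w) :
    (∃ i j : Fin n, (i ≠ f ∧ i ≠ b) ∧ (j ≠ f ∧ j ≠ b) ∧ Good x w i j ∧ ∃ p q : ℤ,
      (i : ℕ) ≤ p ∧ p < (j : ℕ) ∧ (x i : ℕ) < q ∧ q ≤ (x j : ℕ) ∧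
      (f : ℕ) ≤ p ∧ p < (b : ℕ) ∧ (x f : ℕ) < q ∧ q ≤ (x b : ℕ) ∧ gap x w p q = 1) ∨
    ∃ j : Fin n, w f < x j ∧ Good x w b j ∧ ∃ p q : ℤ,
      (b : ℕ) ≤ p ∧ p < (j : ℕ) ∧ (x f : ℕ) < q ∧ q ≤ (x b : ℕ) ∧ gap x w p q = 0 := by
  have hc : IsCover x f b := ⟨hfb, hx, fun s a1 a2 a3 a4 => hcov s a1 a2 a3 (a4.le.trans hb)⟩
  have hg : Good x w f b := ⟨hfb, hx, fun p q a1 a2 a3 a4 => hpos p q a1 a2 a3 (by omega)⟩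
  by_contra! hno
  obtain ⟨hA, hB⟩ := hno
  have hoff : ∀ p q : ℤ, ¬ ((f : ℕ) ≤ p ∧ p < (b : ℕ) ∧ (x f : ℕ) < q ∧ q ≤ (x b : ℕ)) →
      gap (x * swap f b) w p q = gap x w p q := fun p q h => by
    rw [gap_mul_swap hfb hx, if_neg h, sub_zero]
  have hA' : ∀ i j : Fin n, (i ≠ f ∧ i ≠ b) → (j ≠ f ∧ j ≠ b) → Good x w i j →
      Good (x * swap f b) w i j := by
    intro i j hi hj hij
    obtain ⟨e1, e2, e3⟩ := hij
    refine ⟨e1, ?_, ?_⟩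
    · rwa [mul_swap_of_ne hi.1 hi.2, mul_swap_of_ne hj.1 hj.2]
    rw [mul_swap_of_ne hi.1 hi.2, mul_swap_of_ne hj.1 hj.2]
    intro p q c1 c2 c3 c4
    have c5 := e3 p q c1 c2 c3 c4
    rw [gap_mul_swap hfb hx]
    split_ifs with hQ
    · have := hA i j hi hj ⟨e1, e2, e3⟩ p q c1 c2 c3 c4 hQ.1 hQ.2.1 hQ.2.2.1 hQ.2.2.2
      omega
    · omega
  have hN : ∀ k : Fin n, k ≠ f → k ≠ b →
      goodInd x w f b k ≤ goodInd (x * swap f b) w f b k := fun k hkf hkb =>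
    goodInd_le_mul_swap hfb hx hb hcov hzero hf hpos hkf hkb fun hlt e p q c1 c2 c3 c4 => by
      have := hB k hlt e p q c1 c2 c3 c4
      have := h.gap_nonneg p q
      omega
  have h1 := two_mul_ncard_R_sub hfb hx h hg
  have h2 : ∑ k ∈ (Finset.univ.erase f).erase b, ∑ l ∈ (Finset.univ.erase f).erase b,
      (pairInd (Good x w) k l - pairInd (Good (x * swap f b) w) k l) ≤ 0 :=
    Finset.sum_nonpos fun k hk => Finset.sum_nonpos fun l hl => by
      simp only [Finset.mem_erase] at hk hl
      have e1 := hA' k l ⟨hk.2.1, hk.1⟩ ⟨hl.2.1, hl.1⟩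
      have e2 := hA' l k ⟨hl.2.1, hl.1⟩ ⟨hk.2.1, hk.1⟩
      simp only [pairInd]
      split_ifs <;> first | omega | tauto
  have h3 : ∑ k ∈ (Finset.univ.erase f).erase b,
      (goodInd x w f b k - goodInd (x * swap f b) w f b k) ≤ 0 :=
    Finset.sum_nonpos fun k hk => by
      simp only [Finset.mem_erase] at hk
      have := hN k hk.2.1 hk.1
      omega
  have h4 := (invLen_mul_swap hfb hx).2 hc.2.2
  have h5 := hs.2
  exact hns ⟨(mul_swap_le_iff hfb hx h).2 hg, by omega⟩

lemma hasPatternAt_4231 {i j k l : Fin n} :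
    HasPatternAt u ![i, j, k, l] pat4231 ↔ u l < u j ∧ u j < u k ∧ u k < u i := by
  refine ⟨fun h => ⟨(h 3 1).2 (by decide), (h 1 2).2 (by decide), (h 2 0).2 (by decide)⟩, ?_⟩
  rintro ⟨h1, h2, h3⟩ a b
  fin_cases a <;> fin_cases b <;>
    first
    | exact iff_of_true (by simp; omega) (by decide)
    | exact iff_of_false (by simp; try omega) (by decide)

lemma hasPatternAt_2143 {i j k l : Fin n} :
    HasPatternAt u ![i, j, k, l] pat2143 ↔ u j < u i ∧ u i < u l ∧ u l < u k := by
  refine ⟨fun h => ⟨(h 1 0).2 (by decide), (h 0 3).2 (by decide), (h 3 2).2 (by decide)⟩, ?_⟩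
  rintro ⟨h1, h2, h3⟩ a b
  fin_cases a <;> fin_cases b <;>
    first
    | exact iff_of_true (by simp; omega) (by decide)
    | exact iff_of_false (by simp; try omega) (by decide)

lemma hasPatternAt_3412 {i j k l : Fin n} :
    HasPatternAt u ![i, j, k, l] pat3412 ↔ u k < u l ∧ u l < u i ∧ u i < u j := by
  refine ⟨fun h => ⟨(h 2 3).2 (by decide), (h 3 0).2 (by decide), (h 0 1).2 (by decide)⟩, ?_⟩
  rintro ⟨h1, h2, h3⟩ a b
  fin_cases a <;> fin_cases b <;>
    first
    | exact iff_of_true (by simp; omega) (by decide)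
    | exact iff_of_false (by simp; try omega) (by decide)

lemma hasPatternAt_1324 {i j k l : Fin n} :
    HasPatternAt u ![i, j, k, l] pat1324 ↔ u i < u k ∧ u k < u j ∧ u j < u l := by
  refine ⟨fun h => ⟨(h 0 2).2 (by decide), (h 2 1).2 (by decide), (h 1 3).2 (by decide)⟩, ?_⟩
  rintro ⟨h1, h2, h3⟩ a b
  fin_cases a <;> fin_cases b <;>
    first
    | exact iff_of_true (by simp; omega) (by decide)
    | exact iff_of_false (by simp; try omega) (by decide)

/-- Moving the small value `u s` to the right through the entries at positions in `(s, P]` with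
values below `Q`: the rank function grows by one on the cells shielded by these entries. -/
lemma exists_left_chain (u : Perm (Fin n)) (s : Fin n) (P Q : ℤ) (hs : (s : ℕ) ≤ P)
    (hQ : (u s : ℕ) < Q) :
    ∃ (z : Perm (Fin n)) (s' : Fin n), s ≤ s' ∧ (s' : ℕ) ≤ P ∧ z s' = u s ∧
      (∀ k : Fin n, k < s ∨ P < (k : ℕ) → z k = u k) ∧
      (∀ p q : ℤ, rk z p q = rk u p q + if (s : ℕ) ≤ p ∧ (u s : ℕ) < q ∧
        ∃ t : Fin n, p < (t : ℕ) ∧ (t : ℕ) ≤ P ∧ q ≤ (u t : ℕ) ∧ (u t : ℕ) < Q then 1 else 0) ∧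
      (∀ t : Fin n, s' < t → (t : ℕ) ≤ P → u s < u t → (u t : ℕ) < Q → False) ∧
      ((s' = s ∧ z s = u s ∧
          ∀ t : Fin n, s < t → (t : ℕ) ≤ P → u s < u t → (u t : ℕ) < Q → False) ∨
        ∃ g : Fin n, s < g ∧ g ≤ s' ∧ u s < u g ∧ (u g : ℕ) < Q ∧ z s = u g ∧
          ∀ t : Fin n, s < t → (t : ℕ) ≤ P → (u t : ℕ) < Q → u t ≤ u g) := by
  induction hN : n - (s : ℕ) using Nat.strong_induction_on generalizing u s with
  | _ N ih =>
    by_cases hex : ∃ t : Fin n, s < t ∧ (t : ℕ) ≤ P ∧ u s < u t ∧ (u t : ℕ) < Q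
    · obtain ⟨g, ⟨hg1, hg2, hg3, hg4⟩, hgm⟩ := (Set.toFinite
        {t : Fin n | s < t ∧ (t : ℕ) ≤ P ∧ u s < u t ∧ (u t : ℕ) < Q}).exists_maximalFor u _ hex
      have hmax : ∀ t : Fin n, s < t → (t : ℕ) ≤ P → (u t : ℕ) < Q → u t ≤ u g := by
        intro t h1 h2 h3
        by_contra hc
        exact hc (hgm ⟨h1, h2, by omega, h3⟩ (by omega))
      have hoff : ∀ t : Fin n, g < t → (u * swap s g) t = u t := fun t ht =>
        mul_swap_of_ne (hg1.trans ht).ne' ht.ne'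
      obtain ⟨z, s', h1, h2, h3, h4, h5, h6, -⟩ := ih (n - (g : ℕ)) (by omega) (u * swap s g) g hg2
        (by rw [mul_swap_right]; exact hQ) rfl
      rw [mul_swap_right] at h3 h6
      have hzs : z s = u g := by rw [h4 s (Or.inl hg1), mul_swap_left]
      refine ⟨z, s', by omega, h2, h3, ?_, ?_, ?_, Or.inr ⟨g, hg1, h1, hg3, hg4, hzs, hmax⟩⟩
      · intro k hk
        rw [h4 k (by omega), mul_swap_of_ne (by rintro rfl; omega) (by rintro rfl; omega)]
      · intro p q
        rw [h5, rk_mul_swap hg1 hg3, mul_swap_right]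
        have e1 : ((g : ℕ) ≤ p ∧ (u s : ℕ) < q ∧ ∃ t : Fin n, p < (t : ℕ) ∧ (t : ℕ) ≤ P ∧
            q ≤ ((u * swap s g) t : ℕ) ∧ ((u * swap s g) t : ℕ) < Q) ↔
            ((g : ℕ) ≤ p ∧ (u s : ℕ) < q ∧ ∃ t : Fin n, p < (t : ℕ) ∧ (t : ℕ) ≤ P ∧
            q ≤ (u t : ℕ) ∧ (u t : ℕ) < Q) := by
          refine and_congr_right fun hp => and_congr_right fun _ => exists_congr fun t =>
            and_congr_right fun ht => ?_
          rw [hoff t (by omega)]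
        have e2 : (s : ℕ) ≤ p → p < (g : ℕ) → (u s : ℕ) < q → ((∃ t : Fin n, p < (t : ℕ) ∧
            (t : ℕ) ≤ P ∧ q ≤ (u t : ℕ) ∧ (u t : ℕ) < Q) ↔ q ≤ (u g : ℕ)) := by
          refine fun a1 a2 a3 => ⟨fun ⟨t, b1, b2, b3, b4⟩ => ?_, fun a4 => ⟨g, a2, hg2, a4, hg4⟩⟩
          have := hmax t (by omega) b2 b4
          omega
        simp only [e1]
        by_cases a1 : (s : ℕ) ≤ p ∧ p < (g : ℕ) ∧ (u s : ℕ) < q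
        · simp only [e2 a1.1 a1.2.1 a1.2.2]
          split_ifs <;> omega
        · rw [if_neg (by omega), add_zero]
          congr 1
          refine if_congr ⟨fun a => ⟨by omega, a.2⟩, fun a => ⟨by omega, a.2⟩⟩ rfl rfl
      · intro t a1 a2 a3 a4
        exact h6 t a1 a2 (by rw [hoff t (by omega)]; exact a3) (by rw [hoff t (by omega)]; exact a4)
    · refine ⟨u, s, le_rfl, hs, rfl, fun _ _ => rfl, fun p q => ?_,
        fun t a1 a2 a3 a4 => hex ⟨t, a1, a2, a3, a4⟩,
        Or.inl ⟨rfl, rfl, fun t a1 a2 a3 a4 => hex ⟨t, a1, a2, a3, a4⟩⟩⟩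
      rw [if_neg, add_zero]
      rintro ⟨a1, a2, t, a3, a4, a5, a6⟩
      exact hex ⟨t, by omega, a4, by omega, a6⟩

/-- Moving the large value `u s` to the left through the entries at positions in `(P, s)` with
values at least `Q`: the rank function grows by one on the cells shielded by these entries. -/
lemma exists_right_chain (u : Perm (Fin n)) (s : Fin n) (P Q : ℤ) (hs : P < (s : ℕ))
    (hQ : Q ≤ (u s : ℕ)) :
    ∃ (z : Perm (Fin n)) (s' : Fin n), s' ≤ s ∧ P < (s' : ℕ) ∧ z s' = u s ∧
      (∀ k : Fin n, s < k ∨ (k : ℕ) ≤ P → z k = u k) ∧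
      (∀ p q : ℤ, rk z p q = rk u p q + if p < (s : ℕ) ∧ q ≤ (u s : ℕ) ∧
        ∃ t : Fin n, P < (t : ℕ) ∧ (t : ℕ) ≤ p ∧ Q ≤ (u t : ℕ) ∧ (u t : ℕ) < q then 1 else 0) ∧
      (∀ t : Fin n, t < s' → P < (t : ℕ) → u t < u s → Q ≤ (u t : ℕ) → False) ∧
      ((s' = s ∧ z s = u s ∧
          ∀ t : Fin n, t < s → P < (t : ℕ) → u t < u s → Q ≤ (u t : ℕ) → False) ∨
        ∃ g : Fin n, g < s ∧ s' ≤ g ∧ u g < u s ∧ Q ≤ (u g : ℕ) ∧ z s = u g ∧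
          ∀ t : Fin n, t < s → P < (t : ℕ) → Q ≤ (u t : ℕ) → u g ≤ u t) := by
  induction hN : (s : ℕ) using Nat.strong_induction_on generalizing u s with
  | _ N ih =>
    subst hN
    by_cases hex : ∃ t : Fin n, t < s ∧ P < (t : ℕ) ∧ u t < u s ∧ Q ≤ (u t : ℕ)
    · obtain ⟨g, ⟨hg1, hg2, hg3, hg4⟩, hgm⟩ := (Set.toFinite
        {t : Fin n | t < s ∧ P < (t : ℕ) ∧ u t < u s ∧ Q ≤ (u t : ℕ)}).exists_minimalFor u _ hex
      have hmin : ∀ t : Fin n, t < s → P < (t : ℕ) → Q ≤ (u t : ℕ) → u g ≤ u t := by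
        intro t h1 h2 h3
        by_contra hc
        exact hc (hgm ⟨h1, h2, by omega, h3⟩ (by omega))
      have hoff : ∀ t : Fin n, t < g → (u * swap g s) t = u t := fun t ht =>
        mul_swap_of_ne ht.ne (ht.trans hg1).ne
      obtain ⟨z, s', h1, h2, h3, h4, h5, h6, -⟩ := ih (g : ℕ) hg1 (u * swap g s) g hg2
        (by rw [mul_swap_left]; exact hQ) rfl
      rw [mul_swap_left] at h3 h6
      have hzs : z s = u g := by rw [h4 s (Or.inl hg1), mul_swap_right]
      refine ⟨z, s', by omega, h2, h3, ?_, ?_, ?_, Or.inr ⟨g, hg1, h1, hg3, hg4, hzs, hmin⟩⟩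
      · intro k hk
        rw [h4 k (by omega), mul_swap_of_ne (by rintro rfl; omega) (by rintro rfl; omega)]
      · intro p q
        rw [h5, rk_mul_swap hg1 hg3, mul_swap_left]
        have e1 : (p < (g : ℕ) ∧ q ≤ (u s : ℕ) ∧ ∃ t : Fin n, P < (t : ℕ) ∧ (t : ℕ) ≤ p ∧
            Q ≤ ((u * swap g s) t : ℕ) ∧ ((u * swap g s) t : ℕ) < q) ↔
            (p < (g : ℕ) ∧ q ≤ (u s : ℕ) ∧ ∃ t : Fin n, P < (t : ℕ) ∧ (t : ℕ) ≤ p ∧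
            Q ≤ (u t : ℕ) ∧ (u t : ℕ) < q) := by
          refine and_congr_right fun hp => and_congr_right fun _ => exists_congr fun t =>
            and_congr_right fun _ => and_congr_right fun ht => ?_
          rw [hoff t (by omega)]
        have e2 : (g : ℕ) ≤ p → p < (s : ℕ) → q ≤ (u s : ℕ) → ((∃ t : Fin n, P < (t : ℕ) ∧
            (t : ℕ) ≤ p ∧ Q ≤ (u t : ℕ) ∧ (u t : ℕ) < q) ↔ (u g : ℕ) < q) := by
          refine fun a1 a2 a3 => ⟨fun ⟨t, b1, b2, b3, b4⟩ => ?_, fun a4 => ⟨g, hg2, a1, hg4, a4⟩⟩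
          have := hmin t (by omega) b1 b3
          omega
        simp only [e1]
        by_cases a1 : (g : ℕ) ≤ p ∧ p < (s : ℕ) ∧ q ≤ (u s : ℕ)
        · simp only [e2 a1.1 a1.2.1 a1.2.2]
          split_ifs <;> omega
        · rw [if_neg (by omega), add_zero]
          congr 1
          refine if_congr ⟨fun a => ⟨by omega, a.2⟩, fun a => ⟨by omega, a.2⟩⟩ rfl rfl
      · intro t a1 a2 a3 a4
        exact h6 t a1 a2 (by rw [hoff t (by omega)]; exact a3) (by rw [hoff t (by omega)]; exact a4)
    · refine ⟨u, s, le_rfl, hs, rfl, fun _ _ => rfl, fun p q => ?_,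
        fun t a1 a2 a3 a4 => hex ⟨t, a1, a2, a3, a4⟩,
        Or.inl ⟨rfl, rfl, fun t a1 a2 a3 a4 => hex ⟨t, a1, a2, a3, a4⟩⟩⟩
      rw [if_neg, add_zero]
      rintro ⟨a1, a2, t, a3, a4, a5, a6⟩
      exact hex ⟨t, by omega, a3, by omega, a5⟩

lemma rk_of_mul_swap {i j : Fin n} (hij : i < j) (hx : x j < x i) (p q : ℤ) :
    rk x p q = rk (x * swap i j) p q +
      if (i : ℕ) ≤ p ∧ p < (j : ℕ) ∧ (x j : ℕ) < q ∧ q ≤ (x i : ℕ) then 1 else 0 := by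
  have h := rk_mul_swap (x := x * swap i j) hij (by rwa [mul_swap_left, mul_swap_right]) p q
  rwa [mul_assoc, swap_mul_self, mul_one, mul_swap_left, mul_swap_right] at h

lemma rearranged_4231_to_2143 {i j k l : Fin n} (h1 : i < j) (h2 : j < k) (h3 : k < l)
    (hu : u l < u j ∧ u j < u k ∧ u k < u i) :
    ∃ v : Perm (Fin n), IsRearrangedAs u v ![i, j, k, l] pat2143 ∧
      ∀ p q : ℤ, rk u p q = rk v p q +
        (if (i : ℕ) ≤ p ∧ p < (l : ℕ) ∧ (u l : ℕ) < q ∧ q ≤ (u i : ℕ) then 1 else 0) -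
        (if (i : ℕ) ≤ p ∧ p < (j : ℕ) ∧ (u l : ℕ) < q ∧ q ≤ (u j : ℕ) then 1 else 0) -
        (if (k : ℕ) ≤ p ∧ p < (l : ℕ) ∧ (u k : ℕ) < q ∧ q ≤ (u i : ℕ) then 1 else 0) := by
  have n1 := h1.ne
  have n2 := h2.ne
  have n3 := h3.ne
  have n4 := (h1.trans h2).ne
  have n5 := (h2.trans h3).ne
  have n6 := (h1.trans (h2.trans h3)).ne
  have a1 : (u * swap i l) i = u l := by simp
  have a2 : (u * swap i l) j = u j := mul_swap_of_ne n1.symm n5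
  have a3 : (u * swap i l) k = u k := mul_swap_of_ne n4.symm n3
  have a4 : (u * swap i l) l = u i := by simp
  have b1 : (u * swap i l * swap i j) i = u j := by rw [mul_swap_left, a2]
  have b2 : (u * swap i l * swap i j) j = u l := by rw [mul_swap_right, a1]
  have b3 : (u * swap i l * swap i j) k = u k := by rw [mul_swap_of_ne n4.symm n2.symm, a3]
  have b4 : (u * swap i l * swap i j) l = u i := by rw [mul_swap_of_ne n6.symm n5.symm, a4]
  have c1 : (u * swap i l * swap i j * swap k l) i = u j := by rw [mul_swap_of_ne n4 n6, b1]
  have c2 : (u * swap i l * swap i j * swap k l) j = u l := by rw [mul_swap_of_ne n2 n5, b2]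
  have c3 : (u * swap i l * swap i j * swap k l) k = u i := by rw [mul_swap_left, b4]
  have c4 : (u * swap i l * swap i j * swap k l) l = u k := by rw [mul_swap_right, b3]
  refine ⟨u * swap i l * swap i j * swap k l, ⟨fun t ht => ?_, fun a => ?_, ?_⟩, fun p q => ?_⟩
  · have t0 := ht 0
    have t1 := ht 1
    have t2 := ht 2
    have t3 := ht 3
    simp only [Matrix.cons_val] at t0 t1 t2 t3
    rw [mul_swap_of_ne t2 t3, mul_swap_of_ne t0 t1, mul_swap_of_ne t0 t3]
  · fin_cases a
    · exact ⟨1, c1⟩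
    · exact ⟨3, c2⟩
    · exact ⟨0, c3⟩
    · exact ⟨2, c4⟩
  · rw [hasPatternAt_2143, c1, c2, c3, c4]
    omega
  · rw [rk_mul_swap h3 (by rw [b3, b4]; omega), rk_mul_swap h1 (by rw [a1, a2]; omega),
      rk_of_mul_swap (h1.trans (h2.trans h3)) (by omega), b3, b4, a1, a2]
    ring

lemma rearranged_2143_to_4231 {i j k l : Fin n} (h1 : i < j) (h2 : j < k) (h3 : k < l)
    (hu : u j < u i ∧ u i < u l ∧ u l < u k) :
    ∃ v : Perm (Fin n), IsRearrangedAs u v ![i, j, k, l] pat4231 ∧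
      ∀ p q : ℤ, rk v p q = rk u p q +
        (if (i : ℕ) ≤ p ∧ p < (l : ℕ) ∧ (u j : ℕ) < q ∧ q ≤ (u k : ℕ) then 1 else 0) -
        (if (i : ℕ) ≤ p ∧ p < (j : ℕ) ∧ (u j : ℕ) < q ∧ q ≤ (u i : ℕ) then 1 else 0) -
        (if (k : ℕ) ≤ p ∧ p < (l : ℕ) ∧ (u l : ℕ) < q ∧ q ≤ (u k : ℕ) then 1 else 0) := by
  have n1 := h1.ne
  have n2 := h2.ne
  have n3 := h3.ne
  have n4 := (h1.trans h2).ne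
  have n5 := (h2.trans h3).ne
  have n6 := (h1.trans (h2.trans h3)).ne
  have a1 : (u * swap i j) i = u j := by simp
  have a2 : (u * swap i j) j = u i := by simp
  have a3 : (u * swap i j) k = u k := mul_swap_of_ne n4.symm n2.symm
  have a4 : (u * swap i j) l = u l := mul_swap_of_ne n6.symm n5.symm
  have b1 : (u * swap i j * swap k l) i = u j := by rw [mul_swap_of_ne n4 n6, a1]
  have b2 : (u * swap i j * swap k l) j = u i := by rw [mul_swap_of_ne n2 n5, a2]
  have b3 : (u * swap i j * swap k l) k = u l := by rw [mul_swap_left, a4]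
  have b4 : (u * swap i j * swap k l) l = u k := by rw [mul_swap_right, a3]
  have c1 : (u * swap i j * swap k l * swap i l) i = u k := by rw [mul_swap_left, b4]
  have c2 : (u * swap i j * swap k l * swap i l) j = u i := by rw [mul_swap_of_ne n1.symm n5, b2]
  have c3 : (u * swap i j * swap k l * swap i l) k = u l := by rw [mul_swap_of_ne n4.symm n3, b3]
  have c4 : (u * swap i j * swap k l * swap i l) l = u j := by rw [mul_swap_right, b1]
  refine ⟨u * swap i j * swap k l * swap i l, ⟨fun t ht => ?_, fun a => ?_, ?_⟩, fun p q => ?_⟩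
  · have t0 := ht 0
    have t1 := ht 1
    have t2 := ht 2
    have t3 := ht 3
    simp only [Matrix.cons_val] at t0 t1 t2 t3
    rw [mul_swap_of_ne t0 t3, mul_swap_of_ne t2 t3, mul_swap_of_ne t0 t1]
  · fin_cases a
    · exact ⟨2, c1⟩
    · exact ⟨0, c2⟩
    · exact ⟨3, c3⟩
    · exact ⟨1, c4⟩
  · rw [hasPatternAt_4231, c1, c2, c3, c4]
    omega
  · rw [rk_mul_swap (h1.trans (h2.trans h3)) (by rw [b1, b4]; omega), b1, b4,
      rk_of_mul_swap (x := u) h1 (by omega),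
      rk_of_mul_swap (x := u * swap i j) h3 (by rw [a3, a4]; omega), a3, a4]
    ring

lemma rearranged_3412_to_1324 {i j k l : Fin n} (h1 : i < j) (h2 : j < k) (h3 : k < l)
    (hu : u k < u l ∧ u l < u i ∧ u i < u j) :
    ∃ v : Perm (Fin n), IsRearrangedAs u v ![i, j, k, l] pat1324 ∧
      (v i = u k ∧ v j = u i ∧ v k = u l ∧ v l = u j) ∧
      ∀ p q : ℤ, rk u p q = rk v p q +
        (if (i : ℕ) ≤ p ∧ p < (k : ℕ) ∧ (u k : ℕ) < q ∧ q ≤ (u i : ℕ) then 1 else 0) +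
        (if (j : ℕ) ≤ p ∧ p < (l : ℕ) ∧ (u l : ℕ) < q ∧ q ≤ (u j : ℕ) then 1 else 0) -
        (if (j : ℕ) ≤ p ∧ p < (k : ℕ) ∧ (u l : ℕ) < q ∧ q ≤ (u i : ℕ) then 1 else 0) := by
  have n1 := h1.ne
  have n2 := h2.ne
  have n3 := h3.ne
  have n4 := (h1.trans h2).ne
  have n5 := (h2.trans h3).ne
  have n6 := (h1.trans (h2.trans h3)).ne
  have a1 : (u * swap i k) i = u k := by simp
  have a2 : (u * swap i k) j = u j := mul_swap_of_ne n1.symm n2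
  have a3 : (u * swap i k) k = u i := by simp
  have a4 : (u * swap i k) l = u l := mul_swap_of_ne n6.symm n3.symm
  have b1 : (u * swap i k * swap j l) i = u k := by rw [mul_swap_of_ne n1 n6, a1]
  have b2 : (u * swap i k * swap j l) j = u l := by rw [mul_swap_left, a4]
  have b3 : (u * swap i k * swap j l) k = u i := by rw [mul_swap_of_ne n2.symm n3, a3]
  have b4 : (u * swap i k * swap j l) l = u j := by rw [mul_swap_right, a2]
  have c1 : (u * swap i k * swap j l * swap j k) i = u k := by rw [mul_swap_of_ne n1 n4, b1]
  have c2 : (u * swap i k * swap j l * swap j k) j = u i := by rw [mul_swap_left, b3]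
  have c3 : (u * swap i k * swap j l * swap j k) k = u l := by rw [mul_swap_right, b2]
  have c4 : (u * swap i k * swap j l * swap j k) l = u j := by
    rw [mul_swap_of_ne n5.symm n3.symm, b4]
  refine ⟨u * swap i k * swap j l * swap j k, ⟨fun t ht => ?_, fun a => ?_, ?_⟩,
    ⟨c1, c2, c3, c4⟩, fun p q => ?_⟩
  · have t0 := ht 0
    have t1 := ht 1
    have t2 := ht 2
    have t3 := ht 3
    simp only [Matrix.cons_val] at t0 t1 t2 t3
    rw [mul_swap_of_ne t1 t2, mul_swap_of_ne t1 t3, mul_swap_of_ne t0 t2]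
  · fin_cases a
    · exact ⟨2, c1⟩
    · exact ⟨0, c2⟩
    · exact ⟨3, c3⟩
    · exact ⟨1, c4⟩
  · rw [hasPatternAt_1324, c1, c2, c3, c4]
    omega
  · rw [rk_mul_swap h2 (by rw [b2, b3]; omega), b2, b3,
      rk_of_mul_swap (x := u) (h1.trans h2) (by omega),
      rk_of_mul_swap (x := u * swap i k) (h2.trans h3) (by rw [a2, a4]; omega), a2, a4]
    ring

lemma rearranged_1324_to_3412 {i j k l : Fin n} (h1 : i < j) (h2 : j < k) (h3 : k < l)
    (hu : u i < u k ∧ u k < u j ∧ u j < u l) :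
    ∃ v : Perm (Fin n), IsRearrangedAs u v ![i, j, k, l] pat3412 ∧
      ∀ p q : ℤ, rk v p q = rk u p q +
        (if (i : ℕ) ≤ p ∧ p < (k : ℕ) ∧ (u i : ℕ) < q ∧ q ≤ (u j : ℕ) then 1 else 0) +
        (if (j : ℕ) ≤ p ∧ p < (l : ℕ) ∧ (u k : ℕ) < q ∧ q ≤ (u l : ℕ) then 1 else 0) -
        (if (j : ℕ) ≤ p ∧ p < (k : ℕ) ∧ (u k : ℕ) < q ∧ q ≤ (u j : ℕ) then 1 else 0) := by
  have n1 := h1.ne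
  have n2 := h2.ne
  have n3 := h3.ne
  have n4 := (h1.trans h2).ne
  have n5 := (h2.trans h3).ne
  have n6 := (h1.trans (h2.trans h3)).ne
  have a1 : (u * swap j k) i = u i := mul_swap_of_ne n1 n4
  have a2 : (u * swap j k) j = u k := by simp
  have a3 : (u * swap j k) k = u j := by simp
  have a4 : (u * swap j k) l = u l := mul_swap_of_ne n5.symm n3.symm
  have b1 : (u * swap j k * swap i k) i = u j := by rw [mul_swap_left, a3]
  have b2 : (u * swap j k * swap i k) j = u k := by rw [mul_swap_of_ne n1.symm n2, a2]
  have b3 : (u * swap j k * swap i k) k = u i := by rw [mul_swap_right, a1]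
  have b4 : (u * swap j k * swap i k) l = u l := by rw [mul_swap_of_ne n6.symm n3.symm, a4]
  have c1 : (u * swap j k * swap i k * swap j l) i = u j := by rw [mul_swap_of_ne n1 n6, b1]
  have c2 : (u * swap j k * swap i k * swap j l) j = u l := by rw [mul_swap_left, b4]
  have c3 : (u * swap j k * swap i k * swap j l) k = u i := by rw [mul_swap_of_ne n2.symm n3, b3]
  have c4 : (u * swap j k * swap i k * swap j l) l = u k := by rw [mul_swap_right, b2]
  refine ⟨u * swap j k * swap i k * swap j l, ⟨fun t ht => ?_, fun a => ?_, ?_⟩, fun p q => ?_⟩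
  · have t0 := ht 0
    have t1 := ht 1
    have t2 := ht 2
    have t3 := ht 3
    simp only [Matrix.cons_val] at t0 t1 t2 t3
    rw [mul_swap_of_ne t1 t3, mul_swap_of_ne t0 t2, mul_swap_of_ne t1 t2]
  · fin_cases a
    · exact ⟨1, c1⟩
    · exact ⟨3, c2⟩
    · exact ⟨0, c3⟩
    · exact ⟨2, c4⟩
  · rw [hasPatternAt_3412, c1, c2, c3, c4]
    omega
  · rw [rk_mul_swap (h2.trans h3) (by rw [b2, b4]; omega), b2, b4,
      rk_mul_swap (h1.trans h2) (by rw [a1, a3]; omega), a1, a3,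
      rk_of_mul_swap (x := u) h2 (by omega)]
    ring

lemma four_values_eq {a b c d e f g h : Fin n} (ha : a = e ∨ a = f ∨ a = g ∨ a = h)
    (hb : b = e ∨ b = f ∨ b = g ∨ b = h) (hc : c = e ∨ c = f ∨ c = g ∨ c = h)
    (hd : d = e ∨ d = f ∨ d = g ∨ d = h) (h1 : a < b ∧ b < c ∧ c < d)
    (h2 : e < f ∧ f < g ∧ g < h) : a = e ∧ b = f ∧ c = g ∧ d = h := by
  refine ⟨?_, ?_, ?_, ?_⟩ <;> omega

/-- Some entry of `w` lies weakly above row `q` and to the right of column `p`, in the region of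
positions at most `P` and values below `Q`. -/
def LeftShield (w : Perm (Fin n)) (P Q p q : ℤ) : Prop :=
  ∃ s : Fin n, p < (s : ℕ) ∧ (s : ℕ) ≤ P ∧ q ≤ (w s : ℕ) ∧ (w s : ℕ) < Q

/-- Some entry of `w` lies below row `q` and weakly to the left of column `p`, in the region of
positions greater than `P` and values at least `Q`. -/
def RightShield (w : Perm (Fin n)) (P Q p q : ℤ) : Prop :=
  ∃ s : Fin n, P < (s : ℕ) ∧ (s : ℕ) ≤ p ∧ Q ≤ (w s : ℕ) ∧ (w s : ℕ) < q

/-- Construction of an element of `E_w` above `x` out of a pattern `4231` of `w`. -/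
lemma exists_mem_Ew_of_4231 (h : bruhatLE x w) {f l : Fin n} {p₀ q₀ : ℤ} (hf : (f : ℕ) ≤ p₀)
    (hl : p₀ < (l : ℕ)) (he : (w l : ℕ) < q₀) (hc : q₀ ≤ (w f : ℕ))
    (h2 : ∃ s : Fin n, f < s ∧ (s : ℕ) ≤ p₀ ∧ w l < w s ∧ (w s : ℕ) < q₀)
    (h3 : ∃ s : Fin n, p₀ < (s : ℕ) ∧ s < l ∧ q₀ ≤ (w s : ℕ) ∧ w s < w f)
    (hd : ∀ p q : ℤ, (f : ℕ) ≤ p → p < (l : ℕ) → (w l : ℕ) < q → q ≤ (w f : ℕ) →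
      ¬ LeftShield w p₀ q₀ p q → ¬ RightShield w p₀ q₀ p q →
      1 ≤ gap x w p q) :
    ∃ z ∈ Ew w, bruhatLE x z := by
  have hfl : f < l := by omega
  have hu : ∀ t, t ≠ f → t ≠ l → (w * swap f l) t = w t := fun t => mul_swap_of_ne
  have huf := mul_swap_left w f l
  have hul := mul_swap_right w f l
  have rk0 := rk_of_mul_swap (x := w) hfl (by omega)
  obtain ⟨z₁, s, hs1, hs2, hs3, hs4, hs5, hs6, hs7⟩ := exists_left_chain (w * swap f l) f p₀ q₀ hf
    (by rw [huf]; exact he)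
  have hz₁l : z₁ l = w f := by rw [hs4 l (Or.inr hl), hul]
  obtain ⟨z, t, ht1, ht2, ht3, ht4, ht5, ht6, ht7⟩ := exists_right_chain z₁ l p₀ q₀ hl
    (by rw [hz₁l]; exact hc)
  rw [huf] at hs3 hs6 hs7
  rw [hz₁l] at ht3 ht6 ht7
  have hmid : ∀ k : Fin n, p₀ < (k : ℕ) → k < l → z₁ k = w k := fun k h1 h2 => by
    rw [hs4 k (Or.inr h1), hu k (by omega) (by omega)]
  have hleft : ∀ k : Fin n, f < k → (k : ℕ) ≤ p₀ → (w * swap f l) k = w k := fun k h1 h2 =>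
    hu k (by omega) (by omega)
  obtain ⟨g, hg1, hg2, hg3, hg4, hg5, hg6⟩ := hs7.resolve_left fun hcon => by
    obtain ⟨r, a1, a2, a3, a4⟩ := h2
    exact hcon.2.2 r a1 a2 (by rwa [hleft r a1 a2]) (by rwa [hleft r a1 a2])
  obtain ⟨k, hk1, hk2, hk3, hk4, hk5, hk6⟩ := ht7.resolve_left fun hcon => by
    obtain ⟨r, a1, a2, a3, a4⟩ := h3
    exact hcon.2.2 r a2 a1 (by rwa [hmid r a1 a2]) (by rwa [hmid r a1 a2])
  have hgp : (g : ℕ) ≤ p₀ := by omega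
  have hkp : p₀ < (k : ℕ) := by omega
  rw [hleft g hg1 hgp] at hg3 hg4 hg5 hg6
  rw [hmid k hkp hk1] at hk3 hk4 hk5 hk6
  have hzf : z f = w g := by rw [ht4 f (Or.inr hf), hg5]
  have hzs : z s = w l := by rw [ht4 s (Or.inr hs2), hs3]
  have hsht : ∀ p q : ℤ, rk w p q +
      (if (f : ℕ) ≤ p ∧ (w l : ℕ) < q ∧ LeftShield w p₀ q₀ p q then 1 else 0) +
      (if p < (l : ℕ) ∧ q ≤ (w f : ℕ) ∧ RightShield w p₀ q₀ p q then 1 else 0) =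
      rk z p q +
      if (f : ℕ) ≤ p ∧ p < (l : ℕ) ∧ (w l : ℕ) < q ∧ q ≤ (w f : ℕ) then 1 else 0 := by
    intro p q
    rw [ht5, hs5, rk0, huf, hz₁l]
    have e1 : ((f : ℕ) ≤ p ∧ (w l : ℕ) < q ∧ ∃ t : Fin n, p < (t : ℕ) ∧ (t : ℕ) ≤ p₀ ∧
        q ≤ ((w * swap f l) t : ℕ) ∧ ((w * swap f l) t : ℕ) < q₀) ↔
        ((f : ℕ) ≤ p ∧ (w l : ℕ) < q ∧ LeftShield w p₀ q₀ p q) := by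
      refine and_congr_right fun a1 => and_congr_right fun a2 => exists_congr fun t =>
        and_congr_right fun a3 => and_congr_right fun a4 => ?_
      rw [hleft t (by omega) a4]
    have e2 : (p < (l : ℕ) ∧ q ≤ (w f : ℕ) ∧ ∃ t : Fin n, p₀ < (t : ℕ) ∧ (t : ℕ) ≤ p ∧
        q₀ ≤ (z₁ t : ℕ) ∧ (z₁ t : ℕ) < q) ↔
        (p < (l : ℕ) ∧ q ≤ (w f : ℕ) ∧ RightShield w p₀ q₀ p q) := by
      refine and_congr_right fun a1 => and_congr_right fun a2 => exists_congr fun t =>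
        and_congr_right fun a3 => and_congr_right fun a4 => ?_
      rw [hmid t a3 (by omega)]
    simp only [e1, e2]
    ring
  have d1 : ∀ p q : ℤ, (f : ℕ) ≤ p → (w l : ℕ) < q → LeftShield w p₀ q₀ p q →
      p < p₀ ∧ q < q₀ ∧ p < (s : ℕ) ∧ q ≤ (w g : ℕ) := fun p q a0 a5 ⟨r, a1, a2, a3, a4⟩ => by
    have e1 := hleft r (by omega) a2
    have e2 := hg6 r (by omega) a2 (by rwa [e1])
    have e3 := hs6 r
    rw [e1] at e2 e3
    refine ⟨by omega, by omega, ?_, by omega⟩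
    by_contra hcon
    exact e3 (by omega) a2 (by omega) a4
  have d2 : ∀ p q : ℤ, p < (l : ℕ) → q ≤ (w f : ℕ) → RightShield w p₀ q₀ p q →
      p₀ < p ∧ q₀ < q ∧ (t : ℕ) ≤ p ∧ (w k : ℕ) < q := fun p q a0 a5 ⟨r, a1, a2, a3, a4⟩ => by
    have e1 := hmid r a1 (by omega)
    have e2 := hk6 r (by omega) a1 (by rwa [e1])
    have e3 := ht6 r
    rw [e1] at e2 e3
    refine ⟨by omega, by omega, ?_, by omega⟩
    by_contra hcon
    exact e3 (by omega) a1 (by omega) a3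
  have d3 : ∀ p q : ℤ, p < (g : ℕ) → q ≤ (w g : ℕ) → LeftShield w p₀ q₀ p q :=
    fun p q a1 a2 => ⟨g, a1, hgp, a2, hg4⟩
  have d4 : ∀ p q : ℤ, (k : ℕ) ≤ p → (w k : ℕ) < q → RightShield w p₀ q₀ p q :=
    fun p q a1 a2 => ⟨k, hkp, a1, hk4, a2⟩
  have hzval : z s < z f ∧ z f < z l ∧ z l < z t := by
    rw [hzs, hzf, hk5, ht3]
    omega
  obtain ⟨v, hv, rkv⟩ := rearranged_4231_to_2143 (u := w) hg1 (show g < k by omega) hk1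
    ⟨hg3, by omega, hk3⟩
  obtain ⟨v', hv', rkv'⟩ := rearranged_2143_to_4231 (u := z) (show f < s by omega)
    (show s < t by omega) (show t < l by omega) hzval
  rw [hzf, hzs, hk5, ht3] at rkv'
  refine ⟨z, ⟨f, g, k, l, f, s, t, l, hg1, by omega, hk1, by omega, by omega, by omega, ?_,
    Or.inr ⟨hasPatternAt_4231.2 ⟨hg3, by omega, hk3⟩, hasPatternAt_2143.2 hzval, v, v', hv, hv',
      ?_, ?_, ?_⟩⟩, ?_⟩
  · rw [hzf, hzs, hk5, ht3]
    ext r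
    simp only [Set.mem_insert_iff, Set.mem_singleton_iff]
    clear * -
    tauto
  · refine bruhatLE_iff.2 fun p q => ?_
    have c1 := hsht p q
    have c2 := rkv p q
    have c3 := d3 p q
    have c4 := d4 p q
    rw [gap]
    clear * - c1 c2 c3 c4 hgp hkp hf hl he hc hg4 hk4 hk1 hg1
    by_cases hA : LeftShield w p₀ q₀ p q <;> by_cases hB : RightShield w p₀ q₀ p q <;>
      simp only [hA, hB, and_true, and_false, if_false, imp_false, imp_true_iff] at c1 c3 c4 <;>
      (split_ifs at c1 c2 <;> omega)
  · refine bruhatLE_iff.2 fun p q => ?_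
    have c1 := rkv' p q
    rw [gap]
    clear * - c1 hs1 hs2 ht1 ht2 hf hl he hc hg4 hk4 hk1 hg1
    split_ifs at c1 <;> omega
  · refine bruhatLE_iff.2 fun p q => ?_
    have c1 := hsht p q
    have c2 := rkv' p q
    have c3 := d1 p q
    have c4 := d2 p q
    rw [gap]
    clear * - c1 c2 c3 c4 hgp hkp hf hl he hc hg4 hk4 hk1 hg1
    by_cases hA : LeftShield w p₀ q₀ p q <;> by_cases hB : RightShield w p₀ q₀ p q <;>
      simp only [hA, hB, and_true, and_false, if_false, forall_const, false_imp_iff,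
        imp_true_iff] at c1 c3 c4 <;>
      (split_ifs at c1 c2 <;> omega)
  · refine bruhatLE_iff.2 fun p q => ?_
    have c1 := hsht p q
    have c2 := h.gap_nonneg p q
    have c3 := hd p q
    have c4 := d1 p q
    have c5 := d2 p q
    rw [gap] at c2 c3 ⊢
    clear * - c1 c2 c3 c4 c5 hf hl he hc
    by_cases hA : LeftShield w p₀ q₀ p q <;> by_cases hB : RightShield w p₀ q₀ p q <;>
      simp only [hA, hB, and_true, and_false, if_false, not_true_eq_false, not_false_eq_true,
        forall_const, false_imp_iff, imp_true_iff] at c1 c3 c4 c5 <;>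
      (split_ifs at c1 <;> omega)

set_option maxHeartbeats 800000 in
/-- Construction of an element of `E_w` above `x` out of a pattern `3412` of `w`. -/
lemma exists_mem_Ew_of_3412 (h : bruhatLE x w) {f g k l : Fin n} (hfg : f < g) (hgk : g < k)
    (hkl : k < l) (hw : w k < w l ∧ w l < w f ∧ w f < w g)
    (hd₁ : ∀ p q : ℤ, (f : ℕ) ≤ p → p < (g : ℕ) → (w k : ℕ) < q → q ≤ (w f : ℕ) →
      ¬ LeftShield w ((g : ℕ) - 1) (w l : ℕ) p q → 1 ≤ gap x w p q)
    (hd₂ : ∀ p q : ℤ, (g : ℕ) ≤ p → p < (k : ℕ) → (w k : ℕ) < q → q ≤ (w g : ℕ) →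
      1 ≤ gap x w p q)
    (hd₃ : ∀ p q : ℤ, (k : ℕ) ≤ p → p < (l : ℕ) → (w l : ℕ) < q → q ≤ (w g : ℕ) →
      ¬ RightShield w (k : ℕ) (w f : ℕ) p q → 1 ≤ gap x w p q) :
    ∃ z ∈ Ew w, bruhatLE x z := by
  obtain ⟨v, hv, ⟨hvf, hvg, hvk, hvl⟩, rkv⟩ := rearranged_3412_to_1324 (u := w) hfg hgk hkl hw
  have hu : ∀ t, t ≠ f → t ≠ g → t ≠ k → t ≠ l → v t = w t := fun t a1 a2 a3 a4 =>
    hv.1 t fun b => by fin_cases b <;> assumption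
  obtain ⟨z₁, s, hs1, hs2, hs3, hs4, hs5, hs6, -⟩ := exists_left_chain v f ((g : ℕ) - 1) (w l : ℕ)
    (by omega) (by rw [hvf]; omega)
  have hz₁l : z₁ l = w g := by rw [hs4 l (Or.inr (by omega)), hvl]
  obtain ⟨z, t, ht1, ht2, ht3, ht4, ht5, ht6, -⟩ := exists_right_chain z₁ l (k : ℕ) (w f : ℕ)
    (by omega) (by rw [hz₁l]; omega)
  rw [hvf] at hs3 hs6
  rw [hz₁l] at ht3 ht6
  have hright : ∀ r : Fin n, k < r → r < l → z₁ r = w r := fun r h1 h2 => by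
    rw [hs4 r (Or.inr (by omega)), hu r (by omega) (by omega) (by omega) (by omega)]
  have hleft : ∀ r : Fin n, f < r → r < g → v r = w r := fun r h1 h2 =>
    hu r (by omega) (by omega) (by omega) (by omega)
  have hzs : z s = w k := by rw [ht4 s (Or.inr (by omega)), hs3]
  have hzg : z g = w f := by rw [ht4 g (Or.inr (by omega)), hs4 g (Or.inr (by omega)), hvg]
  have hzk : z k = w l := by rw [ht4 k (Or.inr (by omega)), hs4 k (Or.inr (by omega)), hvk]
  have hsht : ∀ p q : ℤ, rk z p q = rk v p q +
      (if (f : ℕ) ≤ p ∧ (w k : ℕ) < q ∧ LeftShield w ((g : ℕ) - 1) (w l : ℕ) p q then 1 else 0) +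
      (if p < (l : ℕ) ∧ q ≤ (w g : ℕ) ∧ RightShield w (k : ℕ) (w f : ℕ) p q then 1 else 0) := by
    intro p q
    rw [ht5, hs5, hvf, hz₁l]
    have e1 : ((f : ℕ) ≤ p ∧ (w k : ℕ) < q ∧
        ∃ r : Fin n, p < (r : ℕ) ∧ (r : ℕ) ≤ ((g : ℕ) - 1 : ℤ) ∧
        q ≤ (v r : ℕ) ∧ (v r : ℕ) < ((w l : ℕ) : ℤ)) ↔
        ((f : ℕ) ≤ p ∧ (w k : ℕ) < q ∧ LeftShield w ((g : ℕ) - 1) (w l : ℕ) p q) := by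
      refine and_congr_right fun a1 => and_congr_right fun a2 => exists_congr fun r =>
        and_congr_right fun a3 => and_congr_right fun a4 => ?_
      rw [hleft r (by omega) (by omega)]
    have e2 : (p < (l : ℕ) ∧ q ≤ (w g : ℕ) ∧ ∃ r : Fin n, ((k : ℕ) : ℤ) < (r : ℕ) ∧ (r : ℕ) ≤ p ∧
        ((w f : ℕ) : ℤ) ≤ (z₁ r : ℕ) ∧ (z₁ r : ℕ) < q) ↔
        (p < (l : ℕ) ∧ q ≤ (w g : ℕ) ∧ RightShield w (k : ℕ) (w f : ℕ) p q) := by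
      refine and_congr_right fun a1 => and_congr_right fun a2 => exists_congr fun r =>
        and_congr_right fun a3 => and_congr_right fun a4 => ?_
      rw [hright r (by omega) (by omega)]
    simp only [e1, e2]
  have d1 : ∀ p q : ℤ, (f : ℕ) ≤ p → (w k : ℕ) < q →
      LeftShield w ((g : ℕ) - 1) (w l : ℕ) p q → p < (s : ℕ) ∧ q < (w l : ℕ) :=
    fun p q a0 a5 ⟨r, a1, a2, a3, a4⟩ => by
    have e1 := hleft r (by omega) (by omega)
    have e3 := hs6 r
    rw [e1] at e3
    refine ⟨?_, by omega⟩
    by_contra hcon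
    exact e3 (by omega) a2 (by omega) a4
  have d2 : ∀ p q : ℤ, p < (l : ℕ) → q ≤ (w g : ℕ) → RightShield w (k : ℕ) (w f : ℕ) p q →
      (t : ℕ) ≤ p ∧ (w f : ℕ) < q := fun p q a0 a5 ⟨r, a1, a2, a3, a4⟩ => by
    have e1 := hright r (by omega) (by omega)
    have e3 := ht6 r
    rw [e1] at e3
    refine ⟨?_, by omega⟩
    by_contra hcon
    exact e3 (by omega) a1 (by omega) a3
  have hzval : z s < z k ∧ z k < z g ∧ z g < z t := by
    rw [hzs, hzg, hzk, ht3]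
    exact hw
  obtain ⟨v', hv', rkv'⟩ := rearranged_1324_to_3412 (u := z) (show s < g by omega) hgk
    (show k < t by omega) hzval
  rw [hzg, hzs, hzk, ht3] at rkv'
  refine ⟨z, ⟨f, g, k, l, s, g, k, t, hfg, hgk, hkl, by omega, hgk, by omega, ?_,
    Or.inl ⟨hasPatternAt_3412.2 hw, hasPatternAt_1324.2 hzval, v, v', hv, hv', ?_, ?_, ?_⟩⟩, ?_⟩
  · rw [hzg, hzs, hzk, ht3]
    ext r
    simp only [Set.mem_insert_iff, Set.mem_singleton_iff]
    clear * -
    tauto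
  · refine bruhatLE_iff.2 fun p q => ?_
    have c1 := hsht p q
    rw [gap]
    clear * - c1
    split_ifs at c1 <;> omega
  · refine bruhatLE_iff.2 fun p q => ?_
    have c1 := rkv' p q
    rw [gap]
    clear * - c1 hgk hkl hw hs2 ht2
    split_ifs at c1 <;> omega
  · refine bruhatLE_iff.2 fun p q => ?_
    have c1 := hsht p q
    have c2 := rkv' p q
    have c3 := d1 p q
    have c4 := d2 p q
    have c5 := rkv p q
    rw [gap]
    clear * - c1 c2 c3 c4 c5 hgk hkl hfg hw hs1 hs2 ht1 ht2
    by_cases hA : LeftShield w ((g : ℕ) - 1) (w l : ℕ) p q <;>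
      by_cases hB : RightShield w (k : ℕ) (w f : ℕ) p q <;>
      simp only [hA, hB, and_true, and_false, if_false, forall_const, false_imp_iff,
        imp_true_iff] at c1 c3 c4 <;>
      (split_ifs at c1 c2 c5 <;> omega)
  · refine bruhatLE_iff.2 fun p q => ?_
    have c1 := hsht p q
    have c2 := h.gap_nonneg p q
    have c6 := rkv p q
    have c7 : rk w p q ≤ rk z p q ∨ rk w p q ≤ rk z p q + 1 ∧ 1 ≤ gap x w p q := by
      by_cases hR : ((f : ℕ) ≤ p ∧ p < (g : ℕ) ∧ (w k : ℕ) < q ∧ q ≤ (w f : ℕ)) ∨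
          ((g : ℕ) ≤ p ∧ p < (k : ℕ) ∧ (w k : ℕ) < q ∧ q ≤ (w g : ℕ)) ∨
          ((k : ℕ) ≤ p ∧ p < (l : ℕ) ∧ (w l : ℕ) < q ∧ q ≤ (w g : ℕ))
      · have c8 : rk w p q = rk v p q + 1 := by
          clear * - c6 hR hgk hkl hfg hw
          split_ifs at c6 <;> omega
        by_cases hA : LeftShield w ((g : ℕ) - 1) (w l : ℕ) p q
        · left
          rw [if_pos ⟨by obtain ⟨r, a1, a2, a3, a4⟩ := hA; omega,
            by obtain ⟨r, a1, a2, a3, a4⟩ := hA; omega, hA⟩] at c1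
          split_ifs at c1 <;> omega
        by_cases hB : RightShield w (k : ℕ) (w f : ℕ) p q
        · left
          rw [if_pos (c := p < (l : ℕ) ∧ _) ⟨by obtain ⟨r, a1, a2, a3, a4⟩ := hB; omega,
            by obtain ⟨r, a1, a2, a3, a4⟩ := hB; omega, hB⟩] at c1
          split_ifs at c1 <;> omega
        right
        refine ⟨by clear * - c1 c8; split_ifs at c1 <;> omega, ?_⟩
        rcases hR with ⟨a1, a2, a3, a4⟩ | ⟨a1, a2, a3, a4⟩ | ⟨a1, a2, a3, a4⟩
        · exact hd₁ p q a1 a2 a3 a4 hA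
        · exact hd₂ p q a1 a2 a3 a4
        · exact hd₃ p q a1 a2 a3 a4 hB
      · left
        clear * - c1 c6 hR hgk hkl hfg hw
        split_ifs at c1 c6 <;> omega
    rw [gap] at c2 c7 ⊢
    omega

lemma gap_box_le (x : Perm (Fin n)) (hp : p ≤ p') (hq : q ≤ q')
    (hw : ∀ s : Fin n, p < (s : ℕ) → (s : ℕ) ≤ p' → q ≤ (w s : ℕ) → (w s : ℕ) < q' → False) :
    gap x w p' q + gap x w p q' ≤ gap x w p q + gap x w p' q' := by
  have h1 := gap_box x w hp hq
  have h2 := boxCount_eq_zero hw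
  have h3 := boxCount_nonneg x p p' q q'
  omega

/-- A `3412`-pattern of `w` arises from a first column `f` of `w` together with two zeros of the
difference function, one just above the row of `w f` and one further to the right and below. -/
lemma exists_mem_Ew_of_zeros (h : bruhatLE x w) {f : Fin n} {p₁ p₂ q₁ : ℤ} (hf : (f : ℕ) ≤ p₂)
    (hp : p₂ < p₁) (hq : q₁ ≤ (w f : ℕ)) (hz₂ : gap x w p₂ ((w f : ℕ) + 1) = 0)
    (hz₁ : gap x w p₁ q₁ = 0)
    (hd : ∀ p q : ℤ, (f : ℕ) ≤ p → p < p₁ → q₁ ≤ q → q ≤ (w f : ℕ) → 1 ≤ gap x w p q)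
    (hd₁ : ∀ q : ℤ, q₁ < q → q ≤ (w f : ℕ) → 1 ≤ gap x w p₁ q)
    (hd₂ : ∀ p : ℤ, p₂ < p → p ≤ p₁ → 1 ≤ gap x w p ((w f : ℕ) + 1)) :
    ∃ z ∈ Ew w, bruhatLE x z := by
  have hq0 : 0 < q₁ := by
    by_contra hcon
    have a1 := hd p₂ q₁ hf hp le_rfl hq
    rw [gap_of_row_nonpos x w _ (by omega)] at a1
    omega
  have hpn : p₁ < n := by
    by_contra hcon
    have a1 := hd₂ p₁ hp le_rfl
    rw [gap_of_le_col x w (by omega)] at a1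
    omega
  -- the lowest point of `w` above row `w f` between the columns of the two zeros
  obtain ⟨g, ⟨hg1, hg2, hg3⟩, hgm⟩ := (Set.toFinite {s : Fin n | p₂ < (s : ℕ) ∧ (s : ℕ) ≤ p₁ ∧
      w f < w s}).exists_minimalFor w _ (by
    have a1 := gap_box x w (p := p₂) (p' := p₂ + 1) (q := (w f : ℕ) + 1) (q' := n) (by omega)
      (by omega)
    rw [gap_of_le_row x w _ le_rfl, gap_of_le_row x w _ le_rfl, hz₂] at a1
    have a2 := hd₂ (p₂ + 1) (by omega) (by omega)
    have a3 := boxCount_nonneg x p₂ (p₂ + 1) ((w f : ℕ) + 1) n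
    obtain ⟨s, b1, b2, b3, b4⟩ := exists_of_boxCount_pos (u := w) (p := p₂) (p' := p₂ + 1)
      (q := (w f : ℕ) + 1) (q' := n) (by omega)
    exact ⟨s, b1, by omega, by omega⟩)
  have hgmin : ∀ s : Fin n, p₂ < (s : ℕ) → (s : ℕ) ≤ p₁ → w f < w s → w g ≤ w s := by
    intro s a1 a2 a3
    by_contra hc
    exact hc (hgm ⟨a1, a2, a3⟩ (by omega))
  obtain ⟨r, hr1, hr2⟩ : ∃ r : Fin n, (r : ℕ) = p₁ ∧ (w r : ℕ) < q₁ := by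
    have a1 := gap_box x w (p := p₁ - 1) (p' := p₁) (q := 0) (q' := q₁) (by omega) (by omega)
    rw [gap_of_row_nonpos x w _ le_rfl, gap_of_row_nonpos x w _ le_rfl, hz₁] at a1
    have a2 := hd (p₁ - 1) q₁ (by omega) (by omega) le_rfl hq
    have a3 := boxCount_nonneg x (p₁ - 1) p₁ 0 q₁
    obtain ⟨s, b1, b2, b3, b4⟩ := exists_of_boxCount_pos (u := w) (p := p₁ - 1) (p' := p₁)
      (q := 0) (q' := q₁) (by omega)
    exact ⟨s, by omega, b4⟩
  have hgr : g < r := by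
    rcases lt_or_eq_of_le (show g ≤ r by omega) with a | rfl
    · exact a
    · omega
  obtain ⟨k, ⟨hk1, hk2, hk3⟩, hkm⟩ := (Set.toFinite {s : Fin n | g < s ∧ (s : ℕ) ≤ p₁ ∧
      (w s : ℕ) < q₁}).exists_maximalFor w _ ⟨r, hgr, by omega, hr2⟩
  have hkmax : ∀ s : Fin n, g < s → (s : ℕ) ≤ p₁ → (w s : ℕ) < q₁ → w s ≤ w k := by
    intro s a1 a2 a3
    by_contra hc
    exact hc (hkm ⟨a1, a2, a3⟩ (by omega))
  obtain ⟨l, ⟨hl1, hl2, hl3⟩, hlm⟩ := (Set.toFinite {s : Fin n | p₁ < (s : ℕ) ∧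
      q₁ ≤ (w s : ℕ) ∧ w s < w f}).exists_minimalFor id _ (by
    have a1 := gap_box x w (p := p₁) (p' := n) (q := q₁) (q' := q₁ + 1) (by omega) (by omega)
    rw [gap_of_le_col x w (p := n) (by omega), gap_of_le_col x w (p := n) (by omega), hz₁] at a1
    have a2 : 1 ≤ gap x w p₁ (q₁ + 1) := by
      rcases eq_or_lt_of_le hq with a | a
      · rw [a]
        exact hd₂ p₁ hp le_rfl
      · exact hd₁ (q₁ + 1) (by omega) (by omega)
    have a3 := boxCount_nonneg x p₁ n q₁ (q₁ + 1)
    obtain ⟨s, b1, b2, b3, b4⟩ := exists_of_boxCount_pos (u := w) (p := p₁) (p' := n)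
      (q := q₁) (q' := q₁ + 1) (by omega)
    have a4 := w.injective.ne (show s ≠ f by rintro rfl; omega)
    exact ⟨s, b1, by omega, by omega⟩)
  have hlmin : ∀ s : Fin n, p₁ < (s : ℕ) → q₁ ≤ (w s : ℕ) → w s < w f → l ≤ s := by
    intro s a1 a2 a3
    by_contra hc
    exact hc (hlm ⟨a1, a2, a3⟩ (by simp only [id]; omega))
  have habove : ∀ p q : ℤ, p₂ < p → p ≤ p₁ → (w f : ℕ) < q → q ≤ (w g : ℕ) →
      1 ≤ gap x w p q := by
    intro p q a1 a2 a3 a4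
    have b1 := gap_box_le (w := w) x (p := p₂) (p' := p) (q := (w f : ℕ) + 1) (q' := q)
      (by omega) (by omega) fun s c1 c2 c3 c4 => by
        have := hgmin s c1 (by omega) (by omega)
        omega
    have b2 := hd₂ p a1 a2
    have b3 := h.gap_nonneg p₂ q
    omega
  have hbelow : ∀ p q : ℤ, (f : ℕ) ≤ p → p < p₁ → q < q₁ →
      (∀ s : Fin n, p < (s : ℕ) → (s : ℕ) ≤ p₁ → q ≤ (w s : ℕ) → (w s : ℕ) < q₁ → False) →
      1 ≤ gap x w p q := by
    intro p q a1 a2 a3 a4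
    have b1 := gap_box_le (w := w) x (p := p) (p' := p₁) (q := q) (q' := q₁)
      (by omega) (by omega) a4
    have b2 := hd p q₁ a1 a2 le_rfl hq
    have b3 := h.gap_nonneg p₁ q
    omega
  refine exists_mem_Ew_of_3412 (f := f) (g := g) (k := k) (l := l) h (by omega) hk1 (by omega)
    ⟨by omega, hl3, hg3⟩ ?_ ?_ ?_
  · intro p q a1 a2 a3 a4 a5
    rcases le_or_gt q₁ q with b | b
    · exact hd p q a1 (by omega) b a4
    · refine hbelow p q a1 (by omega) b fun s c1 c2 c3 c4 => ?_
      rcases lt_trichotomy s g with c5 | rfl | c5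
      · exact a5 ⟨s, c1, by omega, c3, by omega⟩
      · omega
      · have := hkmax s c5 c2 c4
        omega
  · intro p q a1 a2 a3 a4
    rcases le_or_gt q (w f : ℕ) with b' | b'
    · rcases le_or_gt q₁ q with b | b
      · exact hd p q (by omega) (by omega) b b'
      · refine hbelow p q (by omega) (by omega) b fun s c1 c2 c3 c4 => ?_
        have := hkmax s (by omega) c2 c4
        omega
    · exact habove p q (by omega) (by omega) b' a4
  · intro p q a1 a2 a3 a4 a5
    have hmid : p ≤ p₁ → 1 ≤ gap x w p q := by
      intro b0
      rcases le_or_gt q (w f : ℕ) with b' | b'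
      · rcases lt_or_eq_of_le b0 with b | rfl
        · exact hd p q (by omega) b (by omega) b'
        · exact hd₁ q (by omega) b'
      · exact habove p q (by omega) b0 b' a4
    rcases le_or_gt p p₁ with b | b
    · exact hmid b
    have hcol : 1 ≤ gap x w p₁ q := by
      rcases le_or_gt q (w f : ℕ) with b' | b'
      · exact hd₁ q (by omega) b'
      · exact habove p₁ q hp le_rfl b' a4
    have b1 := gap_box_le (w := w) x (p := p₁) (p' := p) (q := q₁) (q' := q)
      (by omega) (by omega) fun s c1 c2 c3 c4 => by
        rcases lt_or_ge (w s) (w f) with c5 | c5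
        · have := hlmin s c1 c3 c5
          omega
        · exact a5 ⟨s, by omega, c2, by omega, c4⟩
    have b2 := h.gap_nonneg p q₁
    omega

lemma exists_mem_Ew_of_chain (h : bruhatLE x w) {f b j : Fin n} (hfb : f < b)
    (hb : x b ≤ w f) (hf : gap x w (f : ℕ) ((w f : ℕ) + 1) = 0)
    (hpos : ∀ p q : ℤ, (f : ℕ) ≤ p → p < (b : ℕ) → (x f : ℕ) < q → q ≤ (w f : ℕ) →
      1 ≤ gap x w p q)
    (hj : w f < x j) (hg : Good x w b j)
    (hz : ∃ p q : ℤ, (b : ℕ) ≤ p ∧ p < (j : ℕ) ∧ (x f : ℕ) < q ∧ q ≤ (x b : ℕ) ∧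
      gap x w p q = 0) :
    ∃ z ∈ Ew w, bruhatLE x z := by
  obtain ⟨-, -, hg⟩ := hg
  obtain ⟨p₁, ⟨hp1, hp2, q₀, hq1, hq2, hq3⟩, hpm⟩ := Int.exists_least_of_bdd
    (P := fun p => (b : ℕ) ≤ p ∧ p < (j : ℕ) ∧ ∃ q : ℤ, (x f : ℕ) < q ∧ q ≤ (x b : ℕ) ∧
      gap x w p q = 0) ⟨(b : ℕ), fun p hp => hp.1⟩
    (by obtain ⟨p, q, a1, a2, a3⟩ := hz; exact ⟨p, a1, a2, q, a3⟩)
  obtain ⟨q₁, ⟨hr1, hr2, hr3⟩, hqm⟩ := Int.exists_greatest_of_bdd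
    (P := fun q => (x f : ℕ) < q ∧ q ≤ (x b : ℕ) ∧ gap x w p₁ q = 0)
    ⟨(x b : ℕ), fun q hq => hq.2.1⟩ ⟨q₀, hq1, hq2, hq3⟩
  obtain ⟨p₂, ⟨hs1, hs2, hs3⟩, hsm⟩ := Int.exists_greatest_of_bdd
    (P := fun p => (f : ℕ) ≤ p ∧ p < (b : ℕ) ∧ gap x w p ((w f : ℕ) + 1) = 0)
    ⟨(b : ℕ), fun p hp => hp.2.1.le⟩ ⟨(f : ℕ), le_rfl, by omega, hf⟩
  refine exists_mem_Ew_of_zeros (f := f) (p₁ := p₁) (p₂ := p₂) (q₁ := q₁) h hs1 (by omega)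
    (by omega) hs3 hr3 ?_ ?_ ?_
  · intro p q a1 a2 a3 a4
    rcases lt_or_ge p (b : ℕ) with c1 | c1
    · exact hpos p q a1 c1 (by omega) a4
    rcases le_or_gt q (x b : ℕ) with c2 | c2
    · by_contra hcon
      have := h.gap_nonneg p q
      have := hpm p ⟨c1, by omega, q, by omega, c2, by omega⟩
      omega
    · exact hg p q c1 (by omega) c2 (by omega)
  · intro q a1 a2
    rcases le_or_gt q (x b : ℕ) with c2 | c2
    · by_contra hcon
      have := h.gap_nonneg p₁ q
      have := hqm q ⟨by omega, c2, by omega⟩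
      omega
    · exact hg p₁ q hp1 hp2 c2 (by omega)
  · intro p a1 a2
    rcases lt_or_ge p (b : ℕ) with c1 | c1
    · by_contra hcon
      have := h.gap_nonneg p ((w f : ℕ) + 1)
      have := hsm p ⟨by omega, c1, by omega⟩
      omega
    · exact hg p _ c1 (by omega) (by omega) (by omega)

/-- If `y ≤ w` and `y` has a point strictly to the right of and below the cell `(p₀, q₀)`, then so
has `w`, and the cells between the two are covered by the point of `y` or by the difference
function. -/
lemma exists_point_of_le (h : bruhatLE y w) {J : Fin n} {p₀ q₀ : ℤ} (hJ : p₀ < (J : ℕ))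
    (hV : (y J : ℕ) < q₀) :
    ∃ l : Fin n, p₀ < (l : ℕ) ∧ (w l : ℕ) < q₀ ∧ ∀ p q : ℤ, p₀ ≤ p → p < (l : ℕ) →
      (w l : ℕ) < q → q ≤ q₀ → (p < (J : ℕ) ∧ (y J : ℕ) < q) ∨ 1 ≤ gap y w p q := by
  by_contra! hno
  let Q : ℤ → ℤ → Prop := fun p q => (p < (J : ℕ) ∧ (y J : ℕ) < q) ∨ 1 ≤ gap y w p q
  obtain ⟨p', ⟨hp1, hp2⟩, hpm⟩ := Int.exists_greatest_of_bdd
    (P := fun p' => (J : ℕ) - 1 ≤ p' ∧ ∀ p q : ℤ, p₀ ≤ p → p ≤ p' → (y J : ℕ) < q → q ≤ q₀ → Q p q)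
    ⟨n, fun p' hp' => by
      by_contra hcon
      rcases hp'.2 n q₀ (by omega) (by omega) hV le_rfl with a | a
      · omega
      · rw [gap_of_le_col y w (by omega)] at a
        omega⟩
    ⟨(J : ℕ) - 1, le_rfl, fun p q a1 a2 a3 a4 => Or.inl ⟨by omega, a3⟩⟩
  obtain ⟨q', ⟨hq1, hq2⟩, hqm⟩ := Int.exists_least_of_bdd
    (P := fun q' => q' ≤ (y J : ℕ) + 1 ∧
      ∀ p q : ℤ, p₀ ≤ p → p ≤ p' → q' ≤ q → q ≤ q₀ → Q p q)
    ⟨0, fun q' hq' => by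
      by_contra hcon
      rcases hq'.2 p₀ 0 le_rfl (by omega) (by omega) (by omega) with a | a
      · omega
      · rw [gap_of_row_nonpos y w _ le_rfl] at a
        omega⟩
    ⟨(y J : ℕ) + 1, le_rfl, fun p q a1 a2 a3 a4 => hp2 p q a1 a2 (by omega) a4⟩
  have hzero : ∀ p q : ℤ, ¬ Q p q → gap y w p q = 0 ∧ (p < (J : ℕ) → q ≤ (y J : ℕ)) := by
    intro p q hQ
    simp only [Q, not_or, not_and] at hQ
    have := h.gap_nonneg p q
    exact ⟨by omega, fun a => by have := hQ.1 a; omega⟩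
  obtain ⟨q, hq3, hq4, hq5⟩ : ∃ q : ℤ, (y J : ℕ) < q ∧ q ≤ q₀ ∧ ¬ Q (p' + 1) q := by
    by_contra! hcon
    have := hpm (p' + 1) ⟨by omega, fun p q a1 a2 a3 a4 => by
      rcases lt_or_eq_of_le a2 with a | rfl
      · exact hp2 p q a1 (by omega) a3 a4
      · exact hcon q a3 a4⟩
    omega
  obtain ⟨p, hp3, hp4, hp5⟩ : ∃ p : ℤ, p₀ ≤ p ∧ p ≤ p' ∧ ¬ Q p (q' - 1) := by
    by_contra! hcon
    have := hqm (q' - 1) ⟨by omega, fun p q a1 a2 a3 a4 => by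
      rcases lt_or_eq_of_le a3 with a | rfl
      · exact hq2 p q a1 a2 (by omega) a4
      · exact hcon p a1 a2⟩
    omega
  have hempty : ∀ s : Fin n, p < (s : ℕ) → (s : ℕ) ≤ p' + 1 → q' - 1 ≤ (w s : ℕ) →
      (w s : ℕ) < q → False := by
    intro s a1 a2 a3 a4
    obtain ⟨r, t, b1, b2, b3, b4, b5, b6⟩ := hno s (by omega) (by omega)
    rcases hq2 r t b1 (by omega) (by omega) b4 with b | b
    · have := b5 b.1
      omega
    · omega
  have e1 := gap_box y w (p := p) (p' := p' + 1) (q := q' - 1) (q' := q) (by omega) (by omega)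
  rw [boxCount_eq_zero hempty, (hzero _ _ hp5).1, (hzero _ _ hq5).1] at e1
  have e2 := h.gap_nonneg p q
  have e3 := h.gap_nonneg (p' + 1) (q' - 1)
  have e4 := boxCount_nonneg y p (p' + 1) (q' - 1) q
  rcases hq2 p q hp3 hp4 (by omega) hq4 with a | a
  · have := one_le_boxCount (u := y) (p := p) (p' := p' + 1) (q := q' - 1) (q' := q) J a.1
      (by omega) (by omega) a.2
    omega
  · omega

lemma exists_mem_Ew_of_disjoint (h : bruhatLE x w) {f b i j : Fin n} (hfb : f < b)
    (hx : x f < x b) (hb : x b ≤ w f)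
    (hcov : ∀ s : Fin n, f < s → s < b → x f < x s → x s ≤ w f → False)
    (hzero : ∀ p q : ℤ, p < (f : ℕ) → gap x w p q = 0)
    (hpos : ∀ p q : ℤ, (f : ℕ) ≤ p → p < (b : ℕ) → (x f : ℕ) < q → q ≤ (w f : ℕ) →
      1 ≤ gap x w p q)
    (hi : i ≠ f ∧ i ≠ b) (hj : j ≠ f ∧ j ≠ b) (hg : Good x w i j)
    (hone : ∃ p q : ℤ, (i : ℕ) ≤ p ∧ p < (j : ℕ) ∧ (x i : ℕ) < q ∧ q ≤ (x j : ℕ) ∧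
      (f : ℕ) ≤ p ∧ p < (b : ℕ) ∧ (x f : ℕ) < q ∧ q ≤ (x b : ℕ) ∧ gap x w p q = 1) :
    ∃ z ∈ Ew w, bruhatLE x z := by
  have hle := (mul_swap_le_iff hg.1 hg.2.1 h).2 hg
  have hgle := gap_mul_swap_le hg.1 hg.2.1 w
  have hyj := mul_swap_right x i j
  obtain ⟨hij, hxij, hg⟩ := hg
  have hxif := x.injective.ne hi.1
  -- the north-west corner of a cell with value one
  have hcorner : ∀ p q : ℤ, (f : ℕ) ≤ p → p < (b : ℕ) → (x f : ℕ) < q → q ≤ (x b : ℕ) →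
      gap x w p q = 1 → gap x w p ((w f : ℕ) + 1) = 0 ∧
        ∀ s : Fin n, (s : ℕ) ≤ p → q ≤ (w s : ℕ) → w s < w f → f < s → False := by
    intro p q a1 a2 a3 a4 a5
    have b1 := gap_box x w (p := ((f : ℕ) : ℤ) - 1) (p' := p) (q := q) (q' := (w f : ℕ) + 1)
      (by omega) (by omega)
    rw [hzero (((f : ℕ) : ℤ) - 1) _ (by omega),
      hzero (((f : ℕ) : ℤ) - 1) _ (by omega), boxCount_eq_zero (u := x)
      (p := ((f : ℕ) : ℤ) - 1) (p' := p) (q := q) (q' := (w f : ℕ) + 1) fun s c1 c2 c3 c4 => by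
        rcases eq_or_lt_of_le (show f ≤ s by omega) with rfl | c5
        · omega
        · exact hcov s c5 (by omega) (by omega) (by omega)] at b1
    have b2 := one_le_boxCount (u := w) (p := ((f : ℕ) : ℤ) - 1) (p' := p) (q := q)
      (q' := (w f : ℕ) + 1) f (by omega) a1 (by omega) (by omega)
    have b3 := h.gap_nonneg p ((w f : ℕ) + 1)
    refine ⟨by omega, fun s c1 c2 c3 c4 => ?_⟩
    have b4 := two_le_boxCount (u := w) (p := ((f : ℕ) : ℤ) - 1) (p' := p) (q := q)
      (q' := (w f : ℕ) + 1) c4.ne ⟨by omega, a1, by omega, by omega⟩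
      ⟨by omega, c1, c2, by omega⟩
    omega
  obtain ⟨p, q, a1, a2, a3, a4, a5, a6, a7, a8, a9⟩ := hone
  have hxjc : x j ≤ w f := by
    by_contra hcon
    have := hg p ((w f : ℕ) + 1) a1 a2 (by omega) (by omega)
    have := (hcorner p q a5 a6 a7 a8 a9).1
    omega
  have hfi : f < i := by
    by_contra hcon
    have := hg (i : ℕ) q le_rfl (by omega) a3 a4
    rw [hzero _ _ (by omega)] at this
    omega
  have hxi : x i < x f := by
    by_contra hcon
    exact hcov i hfi (by omega) (by omega) (by omega)
  have hbj : b < j := by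
    by_contra hcon
    exact hcov j (by omega) (by omega) (by omega) hxjc
  obtain ⟨p₀, ⟨hp1, hp2, q₁, hq1, hq2, hq3, hq4⟩, hpm⟩ := Int.exists_greatest_of_bdd
    (P := fun p => (i : ℕ) ≤ p ∧ p < (b : ℕ) ∧ ∃ q : ℤ, (x f : ℕ) < q ∧ q ≤ (x b : ℕ) ∧
      q ≤ (x j : ℕ) ∧ gap x w p q = 1)
    ⟨(b : ℕ), fun p hp => hp.2.1.le⟩ ⟨p, a1, a6, q, a7, a8, a4, a9⟩
  obtain ⟨q₀, ⟨hr1, hr2, hr3, hr4⟩, hqm⟩ := Int.exists_least_of_bdd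
    (P := fun q => (x f : ℕ) < q ∧ q ≤ (x b : ℕ) ∧ q ≤ (x j : ℕ) ∧ gap x w p₀ q = 1)
    ⟨(x f : ℕ), fun q hq => hq.1.le⟩ ⟨q₁, hq1, hq2, hq3, hq4⟩
  clear a1 a2 a3 a4 a5 a6 a7 a8 a9 p q hq1 hq2 hq3 hq4 q₁
  obtain ⟨htop, honly⟩ := hcorner p₀ q₀ (by omega) hp2 hr1 hr2 hr4
  clear hcorner
  have htwo : ∀ p : ℤ, p₀ < p → p < (b : ℕ) → 2 ≤ gap x w p q₀ := by
    intro p b1 b2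
    have := hpos p q₀ (by omega) b2 hr1 (by omega)
    by_contra hcon
    have := hpm p ⟨by omega, b2, q₀, hr1, hr2, hr3, by omega⟩
    omega
  obtain ⟨l, hl1, hl2, hl3⟩ := exists_point_of_le hle (J := j) (p₀ := p₀) (q₀ := q₀) (by omega)
    (by rw [hyj]; omega)
  rw [hyj] at hl3
  have hSE : ∀ p q : ℤ, p₀ ≤ p → p < (l : ℕ) → (w l : ℕ) < q → q ≤ q₀ → 1 ≤ gap x w p q := by
    intro p q b1 b2 b3 b4
    rcases hl3 p q b1 b2 b3 b4 with c | c
    · exact hg p q (by omega) c.1 c.2 (by omega)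
    · exact c.trans (hgle p q)
  clear hl3
  have hSW : ∀ p q : ℤ, (f : ℕ) ≤ p → p ≤ p₀ → (w l : ℕ) < q → q < q₀ →
      ¬ LeftShield w p₀ q₀ p q → 1 ≤ gap x w p q := by
    intro p q b1 b2 b3 b4 b5
    have c1 := gap_box_le (w := w) x (p := p) (p' := p₀) (q := q) (q' := (w f : ℕ) + 1)
      b2 (by omega) fun s d1 d2 d3 d4 => by
        rcases lt_or_ge (w s : ℤ) q₀ with d5 | d5
        · exact b5 ⟨s, d1, d2, d3, d5⟩
        · have := w.injective.ne (show s ≠ f by omega)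
          exact honly s d2 d5 (by omega) (by omega)
    have c2 := hSE p₀ q le_rfl hl1 b3 b4.le
    have c3 := h.gap_nonneg p ((w f : ℕ) + 1)
    omega
  have hNE : ∀ p q : ℤ, p₀ ≤ p → q₀ ≤ q → q ≤ (w f : ℕ) → ¬ RightShield w p₀ q₀ p q →
      gap x w p q₀ ≤ gap x w p q := by
    intro p q b1 b2 b3 b4
    have c1 := gap_box_le (w := w) x (p := ((f : ℕ) : ℤ) - 1) (p' := p) (q := q₀) (q' := q)
      (by omega) b2 fun s d1 d2 d3 d4 => by
        rcases le_or_gt (s : ℤ) p₀ with d5 | d5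
        · have : s ≠ f := by rintro rfl; omega
          exact honly s d5 d3 (by omega) (by omega)
        · exact b4 ⟨s, d5, d2, d3, d4⟩
    rw [hzero (((f : ℕ) : ℤ) - 1) _ (by omega), hzero (((f : ℕ) : ℤ) - 1) _ (by omega)] at c1
    omega
  by_cases hs : ∃ s : Fin n, p₀ < (s : ℕ) ∧ s < l ∧ q₀ ≤ (w s : ℕ) ∧ w s < w f
  · refine exists_mem_Ew_of_4231 (f := f) (l := l) (p₀ := p₀) (q₀ := q₀) h (by omega) hl1 hl2
      (by omega) ?_ hs ?_
    · rcases eq_or_lt_of_le (show ((x f : ℕ) : ℤ) + 1 ≤ q₀ by omega) with c | c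
      · have c1 := gap_box x w (p := ((f : ℕ) : ℤ) - 1) (p' := p₀) (q := (w l : ℕ)) (q' := q₀)
          (by omega) (by omega)
        rw [hzero (((f : ℕ) : ℤ) - 1) _ (by omega),
          hzero (((f : ℕ) : ℤ) - 1) _ (by omega), hr4] at c1
        have c2 : 2 ≤ gap x w p₀ (w l : ℕ) + boxCount x (((f : ℕ) : ℤ) - 1) p₀ (w l : ℕ) q₀ := by
          rcases lt_or_ge (x i) (w l) with d | d
          · have := hg p₀ (w l : ℕ) hp1 (by omega) (by omega) (by omega)
            have := one_le_boxCount (u := x) (p := ((f : ℕ) : ℤ) - 1) (p' := p₀) (q := (w l : ℕ))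
              (q' := q₀) f (by omega) (by omega) (by omega) (by omega)
            omega
          · have := h.gap_nonneg p₀ (w l : ℕ)
            have := two_le_boxCount (u := x) (p := ((f : ℕ) : ℤ) - 1) (p' := p₀) (q := (w l : ℕ))
              (q' := q₀) hi.1 ⟨by omega, hp1, by omega, by omega⟩
              ⟨by omega, by omega, by omega, by omega⟩
            omega
        obtain ⟨s, d1, d2, d3, d4⟩ := exists_of_boxCount_pos (u := w) (p := ((f : ℕ) : ℤ) - 1)
          (p' := p₀) (q := (w l : ℕ)) (q' := q₀) (by omega)
        have d5 := w.injective.ne (show s ≠ l by omega)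
        exact ⟨s, lt_of_le_of_ne (by omega) (by rintro rfl; omega), d2, by omega, d4⟩
      · have c1 := gap_box x w (p := ((f : ℕ) : ℤ) - 1) (p' := p₀) (q := q₀ - 1) (q' := q₀)
          (by omega) (by omega)
        rw [hzero (((f : ℕ) : ℤ) - 1) _ (by omega),
          hzero (((f : ℕ) : ℤ) - 1) _ (by omega), hr4] at c1
        have c2 := hpos p₀ (q₀ - 1) (by omega) hp2 (by omega) (by omega)
        have c3 : gap x w p₀ (q₀ - 1) ≠ 1 := fun hcon => by
          have := hqm (q₀ - 1) ⟨by omega, by omega, by omega, hcon⟩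
          omega
        have c4 := boxCount_nonneg x (((f : ℕ) : ℤ) - 1) p₀ (q₀ - 1) q₀
        obtain ⟨s, d1, d2, d3, d4⟩ := exists_of_boxCount_pos (u := w) (p := ((f : ℕ) : ℤ) - 1)
          (p' := p₀) (q := q₀ - 1) (q' := q₀) (by omega)
        have d5 := w.injective.ne (show s ≠ l by omega)
        exact ⟨s, lt_of_le_of_ne (by omega) (by rintro rfl; omega), d2, by omega, d4⟩
    · intro p q b1 b2 b3 b4 b5 b6
      rcases le_or_gt p p₀ with c | c
      · rcases lt_or_ge q q₀ with c' | c'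
        · exact hSW p q b1 c b3 c' b5
        · exact hpos p q b1 (by omega) (by omega) b4
      · rcases le_or_gt q q₀ with c' | c'
        · exact hSE p q c.le b2 b3 c'
        · exact (hSE p q₀ c.le b2 hl2 le_rfl).trans (hNE p q c.le c'.le b4 b6)
  -- no point of `w` lies in the upper right part of the rectangle of `f` and `l`
  push Not at hs
  obtain ⟨p₁, ⟨hp3, hp4⟩, hpmin⟩ := Int.exists_least_of_bdd
    (P := fun p => p₀ < p ∧ ((∃ s : Fin n, (s : ℕ) = p ∧ q₀ ≤ (w s : ℕ) ∧ w s < w f) ∨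
      ∃ q : ℤ, q₀ ≤ q ∧ q ≤ (w f : ℕ) ∧ gap x w p q = 0))
    ⟨p₀, fun p hp => hp.1.le⟩
    ⟨n, by omega, Or.inr ⟨q₀, le_rfl, by omega, gap_of_le_col x w (by omega) _⟩⟩
  have hempty : ∀ s : Fin n, p₀ < (s : ℕ) → (s : ℕ) < p₁ → q₀ ≤ (w s : ℕ) → w s < w f → False :=
    fun s b1 b2 b3 b4 => by
      have := hpmin (s : ℕ) ⟨b1, Or.inl ⟨s, rfl, b3, b4⟩⟩
      omega
  have hbox : ∀ p q : ℤ, p₀ < p → p < p₁ → q₀ ≤ q → q ≤ (w f : ℕ) → 1 ≤ gap x w p q := by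
    intro p q b1 b2 b3 b4
    by_contra hcon
    have := h.gap_nonneg p q
    have := hpmin p ⟨b1, Or.inr ⟨q, b3, b4, by omega⟩⟩
    omega
  have hlp : (l : ℕ) ≤ p₁ := by
    by_contra hcon
    rcases hp4 with ⟨s, b1, b2, b3⟩ | ⟨q, b1, b2, b3⟩
    · have := hs s (by omega) (by omega) b2
      omega
    · have c1 := hNE p₁ q hp3.le b1 b2 fun ⟨s, d1, d2, d3, d4⟩ => by
        have := hs s d1 (by omega) d3
        omega
      have c2 := hSE p₁ q₀ hp3.le (by omega) hl2 le_rfl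
      omega
  have hrow : ∀ p : ℤ, p₀ < p → p ≤ p₁ →
      (∀ s : Fin n, (s : ℕ) = p → q₀ ≤ (w s : ℕ) → w s < w f → False) →
      1 ≤ gap x w p ((w f : ℕ) + 1) := by
    intro p b1 b2 b3
    have c1 := gap_box x w (p := p₀) (p' := p) (q := q₀) (q' := (w f : ℕ) + 1)
      b1.le (by omega)
    rw [boxCount_eq_zero (u := w) (p := p₀) (p' := p) (q := q₀)
      (q' := (w f : ℕ) + 1) fun s d1 d2 d3 d4 => by
      have := w.injective.ne (show s ≠ f by omega)
      rcases eq_or_lt_of_le d2 with d5 | d5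
      · exact b3 s d5 d3 (by omega)
      · exact hempty s d1 (by omega) d3 (by omega), htop, hr4] at c1
    have c2 := boxCount_nonneg x p₀ p q₀ ((w f : ℕ) + 1)
    rcases lt_or_ge p (b : ℕ) with d | d
    · have := htwo p b1 d
      omega
    rcases lt_or_ge p (j : ℕ) with d' | d'
    · have := hg p q₀ (by omega) d' (by omega) hr3
      have := one_le_boxCount (u := x) (p := p₀) (p' := p) (q := q₀) (q' := (w f : ℕ) + 1) b
        hp2 d hr2 (by omega)
      omega
    · have := two_le_boxCount (u := x) (p := p₀) (p' := p) (q := q₀) (q' := (w f : ℕ) + 1) hj.2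
        ⟨by omega, d', hr3, by omega⟩ ⟨hp2, d, hr2, by omega⟩
      have := h.gap_nonneg p q₀
      omega
  by_cases hr : ∃ r : Fin n, (r : ℕ) = p₁ ∧ q₀ ≤ (w r : ℕ) ∧ w r < w f
  · obtain ⟨r, rfl, hr5, hr6⟩ := hr
    have hlr : l < r := lt_of_le_of_ne (by omega) (by rintro rfl; omega)
    have hrow' : ∀ p : ℤ, p₀ < p → p < (r : ℕ) → 1 ≤ gap x w p ((w f : ℕ) + 1) :=
      fun p b1 b2 => hrow p b1 b2.le fun s c1 c2 c3 => hempty s (by omega) (by omega) c2 c3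
    obtain ⟨g, ⟨hg1, hg2, hg3⟩, hgm⟩ := (Set.toFinite {s : Fin n | p₀ < (s : ℕ) ∧ s < l ∧
        w f < w s}).exists_minimalFor w _ (by
      have b1 := gap_box x w (p := p₀) (p' := p₀ + 1) (q := (w f : ℕ) + 1) (q' := n) (by omega)
        (by omega)
      rw [gap_of_le_row x w _ le_rfl, gap_of_le_row x w _ le_rfl, htop] at b1
      have b2 := hrow' (p₀ + 1) (by omega) (by omega)
      have b3 := boxCount_nonneg x p₀ (p₀ + 1) ((w f : ℕ) + 1) n
      obtain ⟨s, c1, c2, c3, c4⟩ := exists_of_boxCount_pos (u := w) (p := p₀) (p' := p₀ + 1)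
        (q := (w f : ℕ) + 1) (q' := n) (by omega)
      exact ⟨s, c1, lt_of_le_of_ne (by omega) (by rintro rfl; omega), by omega⟩)
    have hgmin : ∀ s : Fin n, p₀ < (s : ℕ) → s < l → w f < w s → w g ≤ w s := by
      intro s b1 b2 b3
      by_contra hc
      exact hc (hgm ⟨b1, b2, b3⟩ (by omega))
    refine exists_mem_Ew_of_3412 (f := f) (g := g) (k := l) (l := r) h (by omega) hg2 hlr
      ⟨by omega, hr6, hg3⟩ ?_ ?_ ?_
    · intro p q b1 b2 b3 b4 b5
      rcases le_or_gt p p₀ with c | c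
      · rcases lt_or_ge q q₀ with c' | c'
        · exact hSW p q b1 c b3 c' fun ⟨s, d1, d2, d3, d4⟩ =>
            b5 ⟨s, d1, by omega, d3, by omega⟩
        · exact hpos p q b1 (by omega) (by omega) b4
      · rcases le_or_gt q q₀ with c' | c'
        · exact hSE p q c.le (by omega) b3 c'
        · exact hbox p q c (by omega) c'.le b4
    · intro p q b1 b2 b3 b4
      rcases le_or_gt q q₀ with c | c
      · exact hSE p q (by omega) b2 b3 c
      rcases le_or_gt q (w f : ℕ) with c' | c'
      · exact hbox p q (by omega) (by omega) c.le c'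
      · have d1 := gap_box_le (w := w) x (p := p₀) (p' := p) (q := (w f : ℕ) + 1) (q' := q)
          (by omega) (by omega) fun s e1 e2 e3 e4 => by
            have := hgmin s e1 (by omega) (by omega)
            omega
        have d2 := hrow' p (by omega) (by omega)
        have d3 := h.gap_nonneg p₀ q
        omega
    · intro p q b1 b2 b3 b4 b5
      rcases le_or_gt q (w f : ℕ) with c' | c'
      · exact hbox p q (by omega) (by omega) (by omega) c'
      · have d1 := gap_box_le (w := w) x (p := p₀) (p' := p) (q := (w f : ℕ) + 1) (q' := q)
          (by omega) (by omega) fun s e1 e2 e3 e4 => by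
            rcases lt_trichotomy s l with e5 | rfl | e5
            · have := hgmin s e1 e5 (by omega)
              omega
            · omega
            · exact b5 ⟨s, by omega, e2, by omega, e4⟩
        have d2 := hrow' p (by omega) (by omega)
        have d3 := h.gap_nonneg p₀ q
        omega
  · obtain ⟨q₁, ⟨hq1, hq2, hq3⟩, hqmax⟩ := Int.exists_greatest_of_bdd
      (P := fun q => q₀ ≤ q ∧ q ≤ (w f : ℕ) ∧ gap x w p₁ q = 0)
      ⟨(w f : ℕ), fun q hq => hq.2.1⟩ (hp4.resolve_left hr)
    refine exists_mem_Ew_of_zeros (f := f) (p₁ := p₁) (p₂ := p₀) (q₁ := q₁) h (by omega) hp3 hq2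
      htop hq3 ?_ ?_ ?_
    · intro p q b1 b2 b3 b4
      rcases le_or_gt p p₀ with c | c
      · exact hpos p q b1 (by omega) (by omega) b4
      · exact hbox p q c b2 (by omega) b4
    · intro q b1 b2
      by_contra hcon
      have := h.gap_nonneg p₁ q
      have := hqmax q ⟨by omega, b2, by omega⟩
      omega
    · intro p b1 b2
      refine hrow p b1 b2 fun s c1 c2 c3 => ?_
      rcases eq_or_lt_of_le b2 with rfl | b2
      · exact hr ⟨s, c1, c2, c3⟩
      · exact hempty s (by omega) (by omega) c2 c3

/-- Every singular point lies below an element of `Ew w`. -/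
lemma exists_mem_Ew_of_mem_SingSet (hs : x ∈ SingSet w) : ∃ z ∈ Ew w, bruhatLE x z := by
  induction hN : n * n - invLen x using Nat.strong_induction_on generalizing x with
  | _ N ih =>
    have h := hs.1
    rcases eq_or_ne x w with rfl | hne
    · obtain ⟨-, hs⟩ := hs
      rw [ncard_R h, sub_self, Nat.cast_pos, Finset.card_pos] at hs
      obtain ⟨⟨i, j⟩, hg⟩ := hs
      obtain ⟨hij, hx, hg⟩ := (Finset.mem_filter.1 hg).2
      have := hg (i : ℕ) (x j : ℕ) le_rfl (by simpa using hij) (by simpa using hx) le_rfl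
      simp [gap] at this
    obtain ⟨f, b, hfb, hx, hb, hcov, hzero, hf, hpos⟩ := exists_first_diff h hne
    by_cases hns : x * swap f b ∈ SingSet w
    · have hlen : ∀ u : Perm (Fin n), invLen u ≤ n * n := fun u => by
        refine (Finset.card_le_univ _).trans ?_
        simp
      have h1 := (invLen_mul_swap hfb hx).2
        fun s a1 a2 a3 a4 => hcov s a1 a2 a3 (a4.le.trans hb)
      have h2 := hlen (x * swap f b)
      obtain ⟨z, hz, hle⟩ := ih _ (by omega) hns rfl
      exact ⟨z, hz, (le_mul_swap hfb hx).trans hle⟩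
    rcases exists_lost_pair h hs hfb hx hb hcov hzero hf hpos hns with
      ⟨i, j, hi, hj, hg, hone⟩ | ⟨j, hj, hg, hz⟩
    · exact exists_mem_Ew_of_disjoint h hfb hx hb hcov hzero hpos hi hj hg hone
    · exact exists_mem_Ew_of_chain h hfb hb hf hpos hj hg hz

lemma IsRearrangedAs.unique {u v v' : Perm (Fin n)} {r : Fin 4 → Fin n} {σ : Perm (Fin 4)}
    (h : IsRearrangedAs u v r σ) (h' : IsRearrangedAs u v' r σ) : v = v' := by
  have hmono : ∀ v : Perm (Fin n), IsRearrangedAs u v r σ →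
      StrictMono (fun a => v (r (σ.symm a))) ∧
        Set.range (fun a => v (r (σ.symm a))) = Set.range fun a => u (r a) := by
    intro v hv
    have h1 : StrictMono fun a => v (r (σ.symm a)) := fun a b hab =>
      (hv.2.2 _ _).2 (by simpa using hab)
    refine ⟨h1, Set.eq_of_subset_of_ncard_le ?_ ?_⟩
    · rintro _ ⟨a, rfl⟩
      obtain ⟨b, hb⟩ := hv.2.1 (σ.symm a)
      exact ⟨b, hb.symm⟩
    · rw [← Set.image_univ, ← Set.image_univ, Set.ncard_image_of_injective _ h1.injective]
      exact Set.ncard_image_le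
  obtain ⟨h1, h2⟩ := hmono v h
  obtain ⟨h3, h4⟩ := hmono v' h'
  have heq := (h1.range_inj h3).1 (h2.trans h4.symm)
  ext s
  by_cases hs : ∃ a, s = r a
  · obtain ⟨a, rfl⟩ := hs
    simpa using congrArg Fin.val (congrFun heq (σ a))
  · push Not at hs
    rw [h.1 s hs, h'.1 s hs]

lemma mem_SingSet_of_2143 {i j k l : Fin n} (h : bruhatLE z w) (h1 : i < j) (h2 : j < k)
    (h3 : k < l) (hz : z j < z i ∧ z i < z l ∧ z l < z k) (hle : ∀ p q : ℤ, gap z w p q ≤ 1)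
    (hg : Good z w i l)
    (hpos : ∀ p q : ℤ, (j : ℕ) ≤ p → p < (k : ℕ) → (z j : ℕ) < q → q ≤ (z k : ℕ) →
      1 ≤ gap z w p q) : z ∈ SingSet w := by
  obtain ⟨s, ⟨a1, a2, a3, a4⟩, hsm⟩ := (Set.toFinite {s : Fin n | j ≤ s ∧ s < k ∧ z j ≤ z s ∧
    z s < z i}).exists_maximal ⟨j, le_rfl, h2, le_rfl, hz.1⟩
  obtain ⟨t, ⟨b1, b2, b3, b4⟩, htm⟩ := (Set.toFinite {t : Fin n | s < t ∧ t ≤ k ∧ z i < z t ∧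
    z t ≤ z k}).exists_minimal ⟨k, a2, le_rfl, hz.2.1.trans hz.2.2, le_rfl⟩
  have hc : IsCover z s t := by
    refine ⟨b1, a4.trans b3, fun r c1 c2 c3 c4 => ?_⟩
    have := z.injective.ne (show r ≠ i by omega)
    rcases lt_or_ge (z r) (z i) with d | d
    · have := hsm (y := r) ⟨by omega, by omega, by omega, d⟩ c1.le
      omega
    · have := htm (y := r) ⟨c1, by omega, by omega, by omega⟩ c2.le
      omega
  have hst : Good z w s t :=
    ⟨b1, a4.trans b3, fun p q c1 c2 c3 c4 => hpos p q (by omega) (by omega) (by omega) (by omega)⟩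
  have hi : i ≠ s ∧ i ≠ t := ⟨by omega, by omega⟩
  have hl : l ≠ s ∧ l ≠ t := ⟨by omega, by omega⟩
  refine mem_SingSet_of_lt hc h hst
    (ncard_R_mul_swap_add_one_lt_of_disjoint hc h hst hi hl hg fun hcon => ?_)
  have c1 := hcon.2.2 (s : ℕ) ((z i : ℕ) + 1)
  rw [mul_swap_of_ne hi.1 hi.2, mul_swap_of_ne hl.1 hl.2, gap_mul_swap b1 hc.2.1,
    if_pos ⟨by omega, by omega, by omega, by omega⟩] at c1
  have c2 := c1 (by omega) (by omega) (by omega) (by omega)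
  have c3 := hle (s : ℕ) ((z i : ℕ) + 1)
  omega

lemma exists_mem_SingSet_of_chain {a b c : Fin n} (h : bruhatLE z w) (hab : Good z w a b)
    (hbc : Good z w b c) (h1 : gap z w ((b : ℕ) - 1 : ℤ) ((z b : ℕ) + 1) = 0)
    (h2 : ∃ p q : ℤ, (b : ℕ) ≤ p ∧ p < (c : ℕ) ∧ (z a : ℕ) < q ∧ q ≤ (z b : ℕ) ∧
      gap z w p q = 0) : ∃ y ∈ SingSet w, bruhatLE z y := by
  induction hN : (b : ℕ) - a using Nat.strong_induction_on generalizing z a with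
  | _ N ih =>
    have hlt := hab.1
    have hzlt := hab.2.1
    have hlt' := hbc.1
    have hzlt' := hbc.2.1
    by_cases hm : ∃ m, a < m ∧ m < b ∧ z a < z m ∧ z m < z b
    · obtain ⟨m, m1, m2, m3, m4⟩ := hm
      have hg : Good z w a m :=
        ⟨m1, m3, fun p q c1 c2 c3 c4 => hab.2.2 p q c1 (by omega) c3 (by omega)⟩
      have hb : (z * swap a m) b = z b := mul_swap_of_ne (by omega) (by omega)
      have hc : (z * swap a m) c = z c := mul_swap_of_ne (by omega) (by omega)
      have hgap : ∀ p q : ℤ, (m : ℕ) ≤ p ∨ (z m : ℕ) < q →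
          gap (z * swap a m) w p q = gap z w p q := fun p q d => by
        rw [gap_mul_swap m1 m3, if_neg (by omega), sub_zero]
      obtain ⟨p₀, q₀, d1, d2, d3, d4, d5⟩ := h2
      obtain ⟨y, hy, hle⟩ := ih ((b : ℕ) - m) (by omega) (z := z * swap a m) (a := m)
        ((mul_swap_le_iff m1 m3 h).2 hg)
        ⟨m2, by rw [mul_swap_right, hb]; exact hzlt, fun p q c1 c2 c3 c4 => by
          rw [mul_swap_right] at c3
          rw [hb] at c4
          rw [hgap _ _ (Or.inl c1)]
          exact hab.2.2 p q (by omega) c2 c3 c4⟩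
        ⟨hlt', by rwa [hb, hc], fun p q c1 c2 c3 c4 => by
          rw [hb] at c3
          rw [hc] at c4
          rw [hgap _ _ (Or.inl (by omega))]
          exact hbc.2.2 p q c1 c2 c3 c4⟩
        (by rw [hb, hgap _ _ (Or.inr (by omega)), h1])
        ⟨p₀, q₀, d1, d2, by rwa [mul_swap_right], by rwa [hb], by
          rw [hgap _ _ (Or.inl (by omega)), d5]⟩ rfl
      exact ⟨y, hy, (le_mul_swap m1 m3).trans hle⟩
    · have hc : IsCover z a b := ⟨hlt, hzlt, fun s c1 c2 c3 c4 => hm ⟨s, c1, c2, c3, c4⟩⟩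
      exact ⟨z, mem_SingSet_of_lt hc h hab (ncard_R_mul_swap_add_one_lt_of_chain hc h hab hbc
        ⟨_, _, by omega, by omega, by omega, by omega, h1⟩ h2), bruhatLE_refl z⟩

lemma exists_values_eq {i j k l i' j' k' l' : Fin n}
    (hset : ({w i, w j, w k, w l} : Set (Fin n)) = {z i', z j', z k', z l'}) {a : Fin n}
    (ha : a = w i ∨ a = w j ∨ a = w k ∨ a = w l) :
    a = z i' ∨ a = z j' ∨ a = z k' ∨ a = z l' := by
  have : a ∈ ({z i', z j', z k', z l'} : Set (Fin n)) := hset ▸ ha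
  exact this

/-- Every element of `Ew w` lies below a singular point. -/
lemma exists_mem_SingSet_of_mem_Ew (hz : z ∈ Ew w) : ∃ y ∈ SingSet w, bruhatLE z y := by
  obtain ⟨i, j, k, l, i', j', k', l', h1, h2, h3, h1', h2', h3', hset, H⟩ := hz
  have hval := fun a => exists_values_eq hset (a := a)
  rcases H with ⟨hw, hz, lo, hi, hlo, hhi, hle1, hle2, hle3⟩ |
    ⟨hw, hz, lo, hi, hlo, hhi, hle1, hle2, hle3⟩
  · have h := hle2.trans hle3
    rw [hasPatternAt_3412] at hw
    rw [hasPatternAt_1324] at hz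
    obtain ⟨e1, e2, e3, e4⟩ := four_values_eq (a := w k) (b := w l) (c := w i) (d := w j)
      (e := z i') (f := z k') (g := z j') (h := z l')
      (by have := hval (w k) (by tauto); tauto) (by have := hval (w l) (by tauto); tauto)
      (by have := hval (w i) (by tauto); tauto) (by have := hval (w j) (by tauto); tauto) hw hz
    obtain ⟨lo', hlo', -, hrlo⟩ := rearranged_3412_to_1324 h1 h2 h3 hw
    obtain ⟨hi', hhi', hrhi⟩ := rearranged_1324_to_3412 h1' h2' h3' hz
    obtain rfl := hlo.unique hlo'
    obtain rfl := hhi.unique hhi'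
    rw [e1, e2, e3, e4] at hrlo
    have hup : ∀ p q : ℤ, gap z w p q ≤ rk w p q - rk lo p q := fun p q => by
      have := hle1.gap_nonneg p q
      have := gap_add_gap lo z w p q
      simp only [gap] at *
      omega
    have hdown : ∀ p q : ℤ, rk hi p q - rk z p q ≤ gap z w p q := fun p q => by
      have := hle3.gap_nonneg p q
      simp only [gap] at *
      omega
    have hnn := h.gap_nonneg
    refine exists_mem_SingSet_of_chain (a := i') (b := j') (c := l') h ?_ ?_ ?_ ?_
    · refine ⟨h1', by omega, fun p q a1 a2 a3 a4 => (?_ : (1 : ℤ) ≤ _).trans (hdown p q)⟩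
      rw [hrhi]
      clear * - a1 a2 a3 a4 h1' h2' h3' hz
      split_ifs <;> omega
    · refine ⟨by omega, by omega, fun p q a1 a2 a3 a4 => (?_ : (1 : ℤ) ≤ _).trans (hdown p q)⟩
      rw [hrhi]
      clear * - a1 a2 a3 a4 h1' h2' h3' hz
      split_ifs <;> omega
    · by_cases c : (j : ℕ) < (j' : ℕ)
      · have c1 := gap_box z w (p := -1) (p' := (j' : ℕ) - 1) (q := (z j' : ℕ))
          (q' := (z j' : ℕ) + 1) (by omega) (by omega)
        rw [gap_of_neg_col _ _ (p := -1) (by omega), gap_of_neg_col _ _ (p := -1) (by omega),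
          boxCount_eq_zero (u := z) (p := -1) (p' := (j' : ℕ) - 1) (q := (z j' : ℕ))
            (q' := (z j' : ℕ) + 1) fun s d1 d2 d3 d4 => by
              have := z.injective (a₁ := s) (a₂ := j') (by omega)
              omega] at c1
        have c2 := one_le_boxCount (u := w) (p := -1) (p' := (j' : ℕ) - 1) (q := (z j' : ℕ))
          (q' := (z j' : ℕ) + 1) i (by omega) (by omega) (by omega) (by omega)
        have c3 := hnn ((j' : ℕ) - 1) ((z j' : ℕ) + 1)
        have c4 := hup ((j' : ℕ) - 1) (z j' : ℕ)
        have c5 : rk w ((j' : ℕ) - 1) (z j' : ℕ) - rk lo ((j' : ℕ) - 1) (z j' : ℕ) ≤ 1 := by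
          rw [hrlo]
          clear * - h1 h2 h3
          split_ifs <;> omega
        omega
      · have c3 := hnn ((j' : ℕ) - 1) ((z j' : ℕ) + 1)
        have c4 := hup ((j' : ℕ) - 1) ((z j' : ℕ) + 1)
        rw [hrlo] at c4
        revert c4 c3
        clear * - h1 h2 h3 c
        split_ifs <;> omega
    · refine ⟨(k' : ℕ), (z k' : ℕ), by omega, by omega, by omega, by omega, ?_⟩
      by_cases c : (k' : ℕ) < (k : ℕ)
      · have c1 := gap_box z w (p := -1) (p' := (k' : ℕ)) (q := (z k' : ℕ))
          (q' := (z k' : ℕ) + 1) (by omega) (by omega)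
        rw [gap_of_neg_col _ _ (p := -1) (by omega), gap_of_neg_col _ _ (p := -1) (by omega),
          boxCount_eq_zero (u := w) (p := -1) (p' := (k' : ℕ)) (q := (z k' : ℕ))
            (q' := (z k' : ℕ) + 1) fun s d1 d2 d3 d4 => by
              have := w.injective (a₁ := s) (a₂ := l) (by omega)
              omega] at c1
        have c2 := one_le_boxCount (u := z) (p := -1) (p' := (k' : ℕ)) (q := (z k' : ℕ))
          (q' := (z k' : ℕ) + 1) k' (by omega) (by omega) (by omega) (by omega)
        have c3 := hnn (k' : ℕ) (z k' : ℕ)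
        have c4 := hup (k' : ℕ) ((z k' : ℕ) + 1)
        have c5 : rk w (k' : ℕ) ((z k' : ℕ) + 1) - rk lo (k' : ℕ) ((z k' : ℕ) + 1) ≤ 1 := by
          rw [hrlo]
          clear * - h1 h2 h3
          split_ifs <;> omega
        omega
      · have c3 := hnn (k' : ℕ) (z k' : ℕ)
        have c4 := hup (k' : ℕ) (z k' : ℕ)
        rw [hrlo] at c4
        revert c4 c3
        clear * - h1 h2 h3 c hz
        split_ifs <;> omega
  · have h := hle2.trans hle3
    rw [hasPatternAt_4231] at hw
    rw [hasPatternAt_2143] at hz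
    obtain ⟨lo', hlo', hrlo⟩ := rearranged_4231_to_2143 h1 h2 h3 hw
    obtain ⟨hi', hhi', hrhi⟩ := rearranged_2143_to_4231 h1' h2' h3' hz
    obtain rfl := hlo.unique hlo'
    obtain rfl := hhi.unique hhi'
    have hdown : ∀ p q : ℤ, rk hi p q - rk z p q ≤ gap z w p q := fun p q => by
      have := hle3.gap_nonneg p q
      simp only [gap] at *
      omega
    refine ⟨z, mem_SingSet_of_2143 (i := i') (j := j') (k := k') (l := l') h h1' h2' h3' hz
      (fun p q => ?_) ?_ fun p q a1 a2 a3 a4 => (?_ : (1 : ℤ) ≤ _).trans (hdown p q),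
      bruhatLE_refl z⟩
    · have c1 := hle1.gap_nonneg p q
      have c2 := hrlo p q
      simp only [gap] at *
      clear * - c1 c2 h1 h2 h3 hw
      split_ifs at c2 <;> omega
    · refine ⟨by omega, by omega, fun p q a1 a2 a3 a4 => (?_ : (1 : ℤ) ≤ _).trans (hdown p q)⟩
      rw [hrhi]
      clear * - a1 a2 a3 a4 h1' h2' h3' hz
      split_ifs <;> omega
    · rw [hrhi]
      clear * - a1 a2 a3 a4 h1' h2' h3' hz
      split_ifs <;> omega

/-- Mutually cofinal sets have the same maximal elements. -/
lemma maximal_subset_of_cofinal {A B : Set (Perm (Fin n))}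
    (hAB : ∀ a ∈ A, ∃ b ∈ B, bruhatLE a b) (hBA : ∀ b ∈ B, ∃ a ∈ A, bruhatLE b a) :
    {z | z ∈ A ∧ ∀ y ∈ A, bruhatLE z y → z = y} ⊆ {z | z ∈ B ∧ ∀ y ∈ B, bruhatLE z y → z = y} := by
  rintro z ⟨hz, hmax⟩
  have key : ∀ b ∈ B, bruhatLE z b → z = b := fun b hb hzb => by
    obtain ⟨a, ha, hba⟩ := hBA b hb
    obtain rfl := hmax a ha (hzb.trans hba)
    exact hzb.antisymm hba
  obtain ⟨b, hb, hzb⟩ := hAB z hz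
  exact ⟨(key b hb hzb).symm ▸ hb, key⟩

/-- Lakshmibai–Sandhya conjecture: the maximal elements (in Bruhat order) of the
set of singular `T`-fixed points of `X_w` coincide with the maximal elements of
the set `E_w`. -/
theorem lakshmibai_sandhya {n : ℕ} (w : Equiv.Perm (Fin n)) :
    {z | z ∈ SingSet w ∧ ∀ y ∈ SingSet w, bruhatLE z y → z = y} =
      {z | z ∈ Ew w ∧ ∀ y ∈ Ew w, bruhatLE z y → z = y} :=
  (maximal_subset_of_cofinal (fun _ => exists_mem_Ew_of_mem_SingSet)
    fun _ => exists_mem_SingSet_of_mem_Ew).antisymm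
  (maximal_subset_of_cofinal (fun _ => exists_mem_SingSet_of_mem_Ew)
    fun _ => exists_mem_Ew_of_mem_SingSet)

end BSW
end

section
/- Let k, m ≥ 2, n = k + m, and let P be a Kazhdan–Lusztig family for S_n. Then P_{x_{k,m}, w_{k,m}} = 1 + q + q² + ⋯ + q^{min(k−1, m−1)}. -/
open scoped Classical

namespace BSW

/-- `μ(z,w)`: the coefficient of `q^{(l(w)−l(z)−1)/2}` in `P z w`, interpreted as `0`
when `l(w) − l(z)` is even. -/
noncomputable def klmu {n : ℕ}
    (P : Equiv.Perm (Fin n) → Equiv.Perm (Fin n) → Polynomial ℤ)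
    (z w : Equiv.Perm (Fin n)) : ℤ :=
  if (invLen w - invLen z) % 2 = 1 then
    (P z w).coeff ((invLen w - invLen z - 1) / 2)
  else 0

/-- A Kazhdan–Lusztig family for `S_n`: a family of polynomials `P x w ∈ ℤ[q]`
(`q = Polynomial.X`) satisfying the defining properties of the Kazhdan–Lusztig
polynomials: (1) `P x w = 0` unless `x ≤ w`; (2) `P x w = 1` if `x ≤ w` and
`l(w) − l(x) ≤ 2`; (3) `deg (P x w) ≤ (l(w) − l(x) − 1)/2` whenever `x ≤ w`; and
(4) the Kazhdan–Lusztig recurrence with respect to any simple transposition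
`s = t_{a,a+1}` with `l(ws) < l(w)`. -/
structure KLFamily (n : ℕ) where
  P : Equiv.Perm (Fin n) → Equiv.Perm (Fin n) → Polynomial ℤ
  eq_zero : ∀ x w, ¬ bruhatLE x w → P x w = 0
  eq_one : ∀ x w, bruhatLE x w → invLen w ≤ invLen x + 2 → P x w = 1
  deg_le : ∀ x w, bruhatLE x w → 2 * (P x w).natDegree ≤ invLen w - invLen x - 1
  recurrence : ∀ (x w : Equiv.Perm (Fin n)) (a b : Fin n), (b : ℕ) = (a : ℕ) + 1 →
    invLen (w * Equiv.swap a b) < invLen w →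
    P x w =
      (if invLen (x * Equiv.swap a b) < invLen x then Polynomial.X else 1) *
          P x (w * Equiv.swap a b)
        + (if invLen (x * Equiv.swap a b) < invLen x then 1 else Polynomial.X) *
          P (x * Equiv.swap a b) (w * Equiv.swap a b)
        - ∑ z : Equiv.Perm (Fin n),
            if bruhatLE x z ∧ bruhatLE z (w * Equiv.swap a b) ∧ z ≠ w * Equiv.swap a b ∧
                invLen (z * Equiv.swap a b) < invLen z then
              Polynomial.C (klmu P z (w * Equiv.swap a b)) *
                Polynomial.X ^ ((invLen w - invLen z) / 2) * P x z
            else 0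

section Length

variable {n : ℕ} {a b : Fin n}

theorem val_mul_swap (w : Equiv.Perm (Fin n)) (a b p : Fin n) :
    ((w * Equiv.swap a b) p : ℕ) =
      if (p : ℕ) = a then (w b : ℕ) else if (p : ℕ) = b then (w a : ℕ) else w p := by
  simp only [Equiv.Perm.mul_apply, Equiv.swap_apply_def, Fin.ext_iff]
  split_ifs <;> rfl

theorem mul_swap_mul_swap (w : Equiv.Perm (Fin n)) (a b : Fin n) :
    w * Equiv.swap a b * Equiv.swap a b = w := by
  simp [mul_assoc]

/-- Multiplying on the right at an ascent adds exactly one inversion. -/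
theorem invLen_mul_swap_of_lt (hb : (b : ℕ) = a + 1) {w : Equiv.Perm (Fin n)} (h : w a < w b) :
    invLen (w * Equiv.swap a b) = invLen w + 1 := by
  have hswap : ∀ i j : Fin n, i < j → (i ≠ a ∨ j ≠ b) →
      Equiv.swap a b i < Equiv.swap a b j := by
    intro i j hij hne
    simp only [Equiv.swap_apply_def, ne_eq, Fin.ext_iff, Fin.lt_def] at *
    split_ifs <;> omega
  have hset : (Finset.univ.filter (fun p : Fin n × Fin n => p.1 < p.2 ∧
      (w * Equiv.swap a b) p.2 < (w * Equiv.swap a b) p.1)) =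
      insert (a, b) ((Finset.univ.filter (fun p : Fin n × Fin n => p.1 < p.2 ∧
        w p.2 < w p.1)).image (Prod.map (Equiv.swap a b) (Equiv.swap a b))) := by
    ext ⟨i, j⟩
    simp only [Finset.mem_filter, Finset.mem_univ, true_and, Finset.mem_insert, Finset.mem_image,
      Prod.mk.injEq, Prod.exists, Prod.map_apply]
    simp only [Equiv.Perm.mul_apply]
    constructor
    · rintro ⟨hij, hw⟩
      by_cases hab : i = a ∧ j = b
      · exact Or.inl hab
      · exact Or.inr ⟨Equiv.swap a b i, Equiv.swap a b j,
          ⟨hswap i j hij (by tauto), hw⟩, by simp, by simp⟩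
    · rintro (⟨rfl, rfl⟩ | ⟨i', j', ⟨hij, hw⟩, rfl, rfl⟩)
      · refine ⟨Fin.lt_def.2 (by omega), by simpa using h⟩
      · refine ⟨hswap i' j' hij ?_, by simpa using hw⟩
        by_contra! hc
        rw [hc.1, hc.2] at hw
        exact absurd hw (not_lt.2 h.le)
  unfold invLen
  rw [hset, Finset.card_insert_of_notMem, Finset.card_image_of_injective]
  · exact (Equiv.swap a b).injective.prodMap (Equiv.swap a b).injective
  · simp only [Finset.mem_image, Finset.mem_filter, Finset.mem_univ, true_and, Prod.exists,
      Prod.map_apply, Prod.mk.injEq, not_exists, not_and]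
    rintro i j ⟨hij, -⟩ hi hj
    rw [Equiv.swap_apply_eq_iff, Equiv.swap_apply_left] at hi
    rw [Equiv.swap_apply_eq_iff, Equiv.swap_apply_right] at hj
    subst hi hj
    rw [Fin.lt_def] at hij
    omega

theorem ne_of_val_eq_succ (hb : (b : ℕ) = a + 1) : a ≠ b := by
  rintro rfl
  omega

theorem invLen_mul_swap_of_gt (hb : (b : ℕ) = a + 1) {w : Equiv.Perm (Fin n)} (h : w b < w a) :
    invLen w = invLen (w * Equiv.swap a b) + 1 := by
  have := invLen_mul_swap_of_lt hb (w := w * Equiv.swap a b) (by simpa using h)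
  rwa [mul_swap_mul_swap] at this

theorem invLen_mul_swap_lt_iff (hb : (b : ℕ) = a + 1) {w : Equiv.Perm (Fin n)} :
    invLen (w * Equiv.swap a b) < invLen w ↔ w b < w a := by
  constructor
  · intro h
    by_contra! hc
    have := invLen_mul_swap_of_lt hb
      (lt_of_le_of_ne hc (w.injective.ne (ne_of_val_eq_succ hb)))
    omega
  · intro h
    have := invLen_mul_swap_of_gt hb h
    omega

theorem invLen_le (w : Equiv.Perm (Fin n)) : invLen w ≤ n * n := by
  unfold invLen
  refine (Finset.card_le_univ _).trans ?_
  simp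

end Length

/-- A sequence that decreases strictly on `L` consecutive indices, with values in an interval of
length `L`, lists that interval downwards. -/
theorem eq_of_decreasing_block (f : ℕ → ℕ) (L c : ℕ)
    (hlow : ∀ i < L, c ≤ f i) (hup : ∀ i < L, f i < c + L)
    (hdec : ∀ i, i + 1 < L → f (i + 1) < f i) : ∀ i < L, f i + i + 1 = c + L := by
  have h₁ : ∀ i < L, f i + i + 1 ≤ c + L := by
    intro i
    induction i with
    | zero => intro h; have := hup 0 h; omega
    | succ i ih => intro h; have := hdec i h; have := ih (by omega); omega
  have h₂ : ∀ j i, i + j + 1 = L → c + j ≤ f i := by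
    intro j
    induction j with
    | zero => intro i h; simpa using hlow i (by omega)
    | succ j ih =>
      intro i h
      have := ih (i + 1) (by omega)
      have := hdec i (by omega)
      omega
  intro i hi
  have := h₁ i hi
  have := h₂ (L - 1 - i) i (by omega)
  omega

section Bruhat

variable {n : ℕ}

theorem bruhatLE_refl_s2 (w : Equiv.Perm (Fin n)) : bruhatLE w w := by
  intro p q
  simp [dxw]

/-- If `v` takes values below `k` at the first `t` positions, so does every `z ≤ v`. -/
theorem val_lt_of_bruhatLE {z v : Equiv.Perm (Fin n)} (h : bruhatLE z v) {t k : ℕ}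
    (hv : ∀ p : Fin n, (p : ℕ) < t → (v p : ℕ) < k) (p : Fin n) (hp : (p : ℕ) < t) :
    (z p : ℕ) < k := by
  by_contra! hc
  have h₀ : rank v t (k + 1) = 0 := by
    unfold rank
    rw [Finset.card_eq_zero, Finset.filter_eq_empty_iff]
    rintro i - ⟨h₁, h₂⟩
    have := hv i (by omega)
    omega
  have h₁ : 0 < rank z t (k + 1) := by
    unfold rank
    rw [Finset.card_pos]
    exact ⟨p, by simp only [Finset.mem_filter, Finset.mem_univ, true_and]; omega⟩
  have := h t (k + 1)
  unfold dxw at this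
  omega

theorem card_filter_le_val (z : Equiv.Perm (Fin n)) (c : ℕ) :
    (Finset.univ.filter (fun i : Fin n => c ≤ (z i : ℕ))).card =
      (Finset.univ.filter (fun i : Fin n => c ≤ (i : ℕ))).card := by
  refine Finset.card_bij (fun i _ => z i) ?_ ?_ ?_
  · intro i hi
    simpa using hi
  · intro i _ j _ hij
    exact z.injective hij
  · intro j hj
    exact ⟨z.symm j, by simpa using hj, by simp⟩

theorem last_le_of_bruhatLE {z v : Equiv.Perm (Fin n)} (h : bruhatLE z v) (l : Fin n)
    (hl : (l : ℕ) + 1 = n) : (v l : ℕ) ≤ z l := by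
  by_contra! hc
  have hrank : ∀ u : Equiv.Perm (Fin n), rank u (n - 1) ((v l : ℕ) + 1) =
      ((Finset.univ.filter (fun i : Fin n => (v l : ℕ) ≤ (u i : ℕ))).erase l).card := by
    intro u
    unfold rank
    congr 1
    ext i
    simp only [Finset.mem_filter, Finset.mem_univ, true_and, Finset.mem_erase, ne_eq, Fin.ext_iff]
    omega
  have hz := hrank z
  have hv := hrank v
  rw [Finset.erase_eq_of_notMem (by simpa using hc), card_filter_le_val] at hz
  rw [Finset.card_erase_of_mem (by simp), card_filter_le_val] at hv
  have hpos : 0 < (Finset.univ.filter (fun i : Fin n => (v l : ℕ) ≤ (i : ℕ))).card :=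
    Finset.card_pos.2 ⟨v l, by simp⟩
  have := h (n - 1) ((v l : ℕ) + 1)
  unfold dxw at this
  omega

theorem eq_one_of_bruhatLE_one {z : Equiv.Perm (Fin n)} (h : bruhatLE z 1) : z = 1 := by
  have hle : ∀ i : Fin n, (z i : ℕ) ≤ i := by
    intro i
    have := val_lt_of_bruhatLE h (t := i + 1) (k := i + 1) (by simp) i (by omega)
    omega
  have heq : ∀ j : ℕ, ∀ i : Fin n, (i : ℕ) = j → z i = i := by
    intro j
    induction j using Nat.strong_induction_on with
    | _ j ih =>
      intro i hi
      by_contra hne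
      have hlt : (z i : ℕ) < j :=
        hi ▸ lt_of_le_of_ne (hle i) (fun hc => hne (Fin.ext hc))
      exact hne (z.injective (ih _ hlt (z i) rfl))
  ext i
  simp [heq i i rfl]

theorem exists_descent {w : Equiv.Perm (Fin n)} (hw : w ≠ 1) :
    ∃ a b : Fin n, (b : ℕ) = a + 1 ∧ w b < w a := by
  by_contra! hc
  apply hw
  have key := eq_of_decreasing_block
    (fun i => if h : i < n then n - 1 - (w ⟨i, h⟩ : ℕ) else 0) n 0 (by simp)
    (by intro i hi; simp only [hi, dite_true]; omega)
    (by
      intro i hi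
      have hi' : i < n := by omega
      simp only [hi, hi', dite_true]
      have hle := hc ⟨i, hi'⟩ ⟨i + 1, hi⟩ rfl
      have hne : w ⟨i, hi'⟩ ≠ w ⟨i + 1, hi⟩ := w.injective.ne (by simp)
      rw [Fin.le_def] at hle
      rw [ne_eq, Fin.ext_iff] at hne
      omega)
  ext i
  have := key i i.2
  simp only [i.2, dite_true, Fin.eta] at this
  simp only [Equiv.Perm.one_apply]
  omega

end Bruhat

namespace KLFamily

open Polynomial

variable {n : ℕ} (F : KLFamily n) {a b : Fin n}

theorem P_self (w : Equiv.Perm (Fin n)) : F.P w w = 1 :=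
  F.eq_one w w (bruhatLE_refl_s2 w) (by omega)

theorem bruhatLE_of_P_ne_zero {y w : Equiv.Perm (Fin n)} (h : F.P y w ≠ 0) : bruhatLE y w := by
  by_contra hc
  exact h (F.eq_zero y w hc)

theorem P_ne_zero_of_klmu_ne_zero {z v : Equiv.Perm (Fin n)} (h : klmu F.P z v ≠ 0) :
    F.P z v ≠ 0 := by
  intro hc
  simp [klmu, hc] at h

theorem invLen_lt_of_klmu_ne_zero {z v : Equiv.Perm (Fin n)} (h : klmu F.P z v ≠ 0) :
    invLen z < invLen v := by
  unfold klmu at h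
  split_ifs at h with h'
  · omega
  · exact absurd rfl h

/-- The recurrence, phrased at an ascent of `v` and with the redundant conditions on the
summation variable removed. -/
theorem P_mul_swap (hb : (b : ℕ) = a + 1) {v : Equiv.Perm (Fin n)} (hv : v a < v b)
    (y : Equiv.Perm (Fin n)) :
    F.P y (v * Equiv.swap a b) =
      (if y b < y a then X else 1) * F.P y v
        + (if y b < y a then 1 else X) * F.P (y * Equiv.swap a b) v
        - ∑ z : Equiv.Perm (Fin n), if z b < z a then
            C (klmu F.P z v) * X ^ ((invLen v + 1 - invLen z) / 2) * F.P y z else 0 := by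
  have hlen := invLen_mul_swap_of_lt hb hv
  rw [F.recurrence y (v * Equiv.swap a b) a b hb (by rw [mul_swap_mul_swap]; omega)]
  simp only [invLen_mul_swap_lt_iff hb, mul_swap_mul_swap, hlen]
  congr 1
  refine Finset.sum_congr rfl fun z _ => ?_
  by_cases hz : z b < z a
  · by_cases hyz : bruhatLE y z
    · by_cases hzv : bruhatLE z v
      · have : z ≠ v := by
          rintro rfl
          exact absurd hz (not_lt.2 hv.le)
        simp [hz, hyz, hzv, this]
      · have : klmu F.P z v = 0 := by simp [klmu, F.eq_zero z v hzv]
        simp [this]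
    · simp [F.eq_zero y z hyz]
  · simp [hz]

theorem invLen_lt_or_eq_of_P_ne_zero {y w : Equiv.Perm (Fin n)} (h : F.P y w ≠ 0) :
    invLen y < invLen w ∨ y = w := by
  induction hl : invLen w using Nat.strong_induction_on generalizing y w with
  | _ l ih =>
    subst hl
    by_contra! hc
    obtain ⟨hlen, hne⟩ := hc
    have hw : w ≠ 1 := by
      rintro rfl
      exact hne (eq_one_of_bruhatLE_one (F.bruhatLE_of_P_ne_zero h))
    obtain ⟨a, b, hb, hab⟩ := exists_descent hw
    have hws := invLen_mul_swap_of_gt hb hab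
    have hzero : ∀ z z' : Equiv.Perm (Fin n), invLen z' < invLen w → invLen z' ≤ invLen z →
        z ≠ z' → F.P z z' = 0 := by
      intro z z' hz' hz hzz
      by_contra hP
      rcases ih _ hz' hP rfl with h' | h'
      · omega
      · exact hzz h'
    apply h
    have hrec := F.P_mul_swap hb (v := w * Equiv.swap a b) (by simpa using hab) y
    rw [mul_swap_mul_swap] at hrec
    rw [hrec, Finset.sum_eq_zero, hzero y _ (by omega) (by omega),
      hzero (y * Equiv.swap a b) _ (by omega) _ (fun hc => hne (mul_right_cancel hc))]
    · simp
    · rcases lt_or_ge (y b) (y a) with hy | hy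
      · have := invLen_mul_swap_of_gt hb hy
        omega
      · have := invLen_mul_swap_of_lt hb
          (lt_of_le_of_ne hy (y.injective.ne (ne_of_val_eq_succ hb)))
        omega
    · rintro rfl
      omega
    · intro z _
      split_ifs with hz
      · by_cases hmu : klmu F.P z (w * Equiv.swap a b) = 0
        · simp [hmu]
        · have := F.invLen_lt_of_klmu_ne_zero hmu
          rw [hzero y z (by omega) (by omega) (by rintro rfl; omega), mul_zero]
      · rfl

/-- `P_{y,w} = P_{ys,w}` whenever `s` is a right descent of `w`. -/
theorem P_mul_swap_left (hb : (b : ℕ) = a + 1) {w : Equiv.Perm (Fin n)} (hw : w b < w a)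
    (y : Equiv.Perm (Fin n)) : F.P (y * Equiv.swap a b) w = F.P y w := by
  induction hl : invLen w using Nat.strong_induction_on generalizing w with
  | _ l ih =>
    subst hl
    have hws := invLen_mul_swap_of_gt hb hw
    have hrec := F.P_mul_swap hb (v := w * Equiv.swap a b) (by simpa using hw)
    simp only [mul_swap_mul_swap] at hrec
    rw [hrec y, hrec (y * Equiv.swap a b), mul_swap_mul_swap]
    congr 1
    · rcases lt_trichotomy (y a) (y b) with h | h | h
      · simp [h, not_lt.2 h.le, add_comm]
      · exact absurd (y.injective h) (ne_of_val_eq_succ hb)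
      · simp [h, not_lt.2 h.le, add_comm]
    · refine Finset.sum_congr rfl fun z _ => ?_
      split_ifs with hz
      · by_cases hmu : klmu F.P z (w * Equiv.swap a b) = 0
        · simp [hmu]
        · have := F.invLen_lt_of_klmu_ne_zero hmu
          rw [ih _ (by omega) hz rfl]
      · rfl

theorem klmu_mul_swap (hb : (b : ℕ) = a + 1) {v : Equiv.Perm (Fin n)} (hv : v b < v a) :
    klmu F.P (v * Equiv.swap a b) v = 1 := by
  have := invLen_mul_swap_of_gt hb hv
  rw [klmu, F.P_mul_swap_left hb hv, F.P_self, show invLen v - invLen (v * Equiv.swap a b) = 1 by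
    omega]
  simp

/-- If `μ(z,v) ≠ 0`, a right descent of `v` is a right descent of `z`, unless `z = vs`. -/
theorem descent_of_klmu_ne_zero (hb : (b : ℕ) = a + 1) {z v : Equiv.Perm (Fin n)} (hv : v b < v a)
    (h : klmu F.P z v ≠ 0) (hne : z ≠ v * Equiv.swap a b) : z b < z a := by
  by_contra! hz
  have hzs := invLen_mul_swap_of_lt hb
    (lt_of_le_of_ne hz (z.injective.ne (ne_of_val_eq_succ hb)))
  have hP := F.P_ne_zero_of_klmu_ne_zero h
  rw [← F.P_mul_swap_left hb hv] at hP
  have hlt : invLen (z * Equiv.swap a b) < invLen v := by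
    refine (F.invLen_lt_or_eq_of_P_ne_zero hP).resolve_right fun hc => hne ?_
    rw [← hc, mul_swap_mul_swap]
  have hdeg := F.deg_le _ _ (F.bruhatLE_of_P_ne_zero hP)
  unfold klmu at h
  split_ifs at h with hodd
  · rw [← F.P_mul_swap_left hb hv] at h
    have := le_natDegree_of_ne_zero h
    omega
  · exact h rfl

/-- The recurrence when the contributing `z` are known to lie in `S`. -/
theorem P_mul_swap_of_support (hb : (b : ℕ) = a + 1) {v : Equiv.Perm (Fin n)} (hv : v a < v b)
    (S : Finset (Equiv.Perm (Fin n))) (hS : ∀ z ∈ S, z b < z a)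
    (hsupp : ∀ z, z b < z a → klmu F.P z v ≠ 0 → z ∈ S) (y : Equiv.Perm (Fin n)) :
    F.P y (v * Equiv.swap a b) =
      (if y b < y a then X else 1) * F.P y v
        + (if y b < y a then 1 else X) * F.P (y * Equiv.swap a b) v
        - ∑ z ∈ S, C (klmu F.P z v) * X ^ ((invLen v + 1 - invLen z) / 2) * F.P y z := by
  rw [F.P_mul_swap hb hv, ← Finset.sum_subset (Finset.subset_univ S)]
  · congr 1
    exact Finset.sum_congr rfl fun z hz => if_pos (hS z hz)
  · intro z _ hz
    split_ifs with hz'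
    · by_cases hmu : klmu F.P z v = 0
      · simp [hmu]
      · exact absurd (hsupp z hz' hmu) hz
    · rfl

theorem P_mul_swap_of_support_of_eq (hb : (b : ℕ) = a + 1) {v : Equiv.Perm (Fin n)}
    (hv : v a < v b) (S : Finset (Equiv.Perm (Fin n))) (hS : ∀ z ∈ S, z b < z a)
    (hsupp : ∀ z, z b < z a → klmu F.P z v ≠ 0 → z ∈ S) (y : Equiv.Perm (Fin n)) {f : ℤ[X]}
    (h₁ : F.P y v = f) (h₂ : F.P (y * Equiv.swap a b) v = f) :
    F.P y (v * Equiv.swap a b) = (1 + X) * f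
        - ∑ z ∈ S, C (klmu F.P z v) * X ^ ((invLen v + 1 - invLen z) / 2) * F.P y z := by
  rw [F.P_mul_swap_of_support hb hv S hS hsupp, h₁, h₂]
  split_ifs <;> ring

end KLFamily

section Blocks

variable {k m : ℕ}

/-- The parabolic subgroup `S_k × S_m` of `S_{k+m}`, as a predicate. -/
def PreservesBlocks (k m : ℕ) (y : Equiv.Perm (Fin (k + m))) : Prop :=
  ∀ p : Fin (k + m), (y p : ℕ) < k ↔ (p : ℕ) < k

theorem preservesBlocks_of_val_lt {y : Equiv.Perm (Fin (k + m))}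
    (h : ∀ p : Fin (k + m), (p : ℕ) < k → (y p : ℕ) < k) : PreservesBlocks k m y := by
  have himage : (Finset.univ.filter (fun p : Fin (k + m) => (p : ℕ) < k)).image y =
      Finset.univ.filter (fun p : Fin (k + m) => (p : ℕ) < k) := by
    apply Finset.eq_of_subset_of_card_le
    · intro q hq
      simp only [Finset.mem_image, Finset.mem_filter, Finset.mem_univ, true_and] at hq ⊢
      obtain ⟨p, hp, rfl⟩ := hq
      exact h p hp
    · rw [Finset.card_image_of_injective _ y.injective]
  intro p
  refine ⟨fun hp => ?_, h p⟩
  have : y p ∈ (Finset.univ.filter (fun p : Fin (k + m) => (p : ℕ) < k)).image y := by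
    rw [himage]
    simpa using hp
  simpa using this

theorem PreservesBlocks.mul_swap {y : Equiv.Perm (Fin (k + m))} (hy : PreservesBlocks k m y)
    {a b : Fin (k + m)} (h : (a : ℕ) < k ↔ (b : ℕ) < k) :
    PreservesBlocks k m (y * Equiv.swap a b) := by
  intro p
  have ha := hy a
  have hb := hy b
  have hp := hy p
  rw [val_mul_swap]
  split_ifs with h₁ h₂ <;> simp only [*]

/-- The longest element of `S_k × S_m` is determined by its descents. -/
theorem val_eq_xkmVal {y : Equiv.Perm (Fin (k + m))} (hy : PreservesBlocks k m y)
    (hdesc : ∀ a b : Fin (k + m), (b : ℕ) = a + 1 → (b : ℕ) ≠ k → y b < y a)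
    (i : Fin (k + m)) : (y i : ℕ) = xkmVal k m i := by
  have h₁ := eq_of_decreasing_block
    (fun i => if h : i < k + m then (y ⟨i, h⟩ : ℕ) else 0) k 0 (by simp)
    (by
      intro i hi
      have hi' : i < k + m := by omega
      simpa [hi'] using (hy ⟨i, hi'⟩).2 hi)
    (by
      intro i hi
      have h₁ : i < k + m := by omega
      have h₂ : i + 1 < k + m := by omega
      simpa [h₁, h₂] using hdesc ⟨i, h₁⟩ ⟨i + 1, h₂⟩ rfl (by simp; omega))
  have h₂ := eq_of_decreasing_block
    (fun i => if h : k + i < k + m then (y ⟨k + i, h⟩ : ℕ) else 0) m k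
    (by
      intro i hi
      have := hy ⟨k + i, by omega⟩
      simp only [Nat.add_lt_add_iff_left, hi, dite_true]
      simp only [Nat.not_lt.2 (Nat.le_add_right k i), iff_false] at this
      omega)
    (by
      intro i hi
      simp only [Nat.add_lt_add_iff_left, hi, dite_true]
      omega)
    (by
      intro i hi
      have h₁ : i < m := by omega
      simpa [h₁, hi] using
        hdesc ⟨k + i, by omega⟩ ⟨k + (i + 1), by omega⟩ rfl (by simp))
  unfold xkmVal
  split_ifs with hi
  · have := h₁ i hi
    simp only [i.2, dite_true, Fin.eta] at this
    omega
  · have := h₂ (i - k) (by omega)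
    simp only [show k + ((i : ℕ) - k) = i by omega, i.2, dite_true, Fin.eta] at this
    omega

theorem preservesBlocks_of_xkmVal {x : Equiv.Perm (Fin (k + m))}
    (hx : ∀ i, (x i : ℕ) = xkmVal k m i) : PreservesBlocks k m x := by
  intro p
  rw [hx, xkmVal]
  split_ifs <;> omega

theorem descent_of_xkmVal {x : Equiv.Perm (Fin (k + m))}
    (hx : ∀ i, (x i : ℕ) = xkmVal k m i) {a b : Fin (k + m)} (hb : (b : ℕ) = a + 1)
    (hbk : (b : ℕ) ≠ k) : x b < x a := by
  rw [Fin.lt_def, hx, hx, xkmVal, xkmVal]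
  split_ifs <;> omega

theorem eq_of_preservesBlocks {x z : Equiv.Perm (Fin (k + m))}
    (hx : ∀ i, (x i : ℕ) = xkmVal k m i) (hz : PreservesBlocks k m z)
    (hdesc : ∀ a b : Fin (k + m), (b : ℕ) = a + 1 → (b : ℕ) ≠ k → z b < z a) : z = x := by
  ext i
  rw [val_eq_xkmVal hz hdesc, hx]

theorem P_xkm_eq_one (F : KLFamily (k + m)) {x : Equiv.Perm (Fin (k + m))}
    (hx : ∀ i, (x i : ℕ) = xkmVal k m i) {y : Equiv.Perm (Fin (k + m))}
    (hy : PreservesBlocks k m y) : F.P y x = 1 := by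
  induction hl : (k + m) * (k + m) - invLen y using Nat.strong_induction_on generalizing y with
  | _ l ih =>
    subst hl
    by_cases hyx : y = x
    · rw [hyx, F.P_self]
    · have : ∃ a b : Fin (k + m), (b : ℕ) = a + 1 ∧ (b : ℕ) ≠ k ∧ y a ≤ y b := by
        by_contra! hc
        exact hyx (eq_of_preservesBlocks hx hy hc)
      obtain ⟨a, b, hb, hbk, hle⟩ := this
      have hlen := invLen_mul_swap_of_lt hb
        (lt_of_le_of_ne hle (y.injective.ne (ne_of_val_eq_succ hb)))
      have hbound := invLen_le (y * Equiv.swap a b)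
      rw [← F.P_mul_swap_left hb (descent_of_xkmVal hx hb hbk)]
      exact ih _ (by omega) (hy.mul_swap (by omega)) rfl

/-- Values of the permutation obtained from `x_{k,m}` by moving its least value `i` places to the
right. -/
def firstVal (k m i p : ℕ) : ℕ :=
  if p < k - 1 then k - 1 - p
  else if p < k - 1 + i then k + m + k - 2 - p
  else if p = k - 1 + i then 0
  else k + m + k - 1 - p

/-- Values of the permutation `[k,…,2, k+m,…,k+1, 1]` (0-indexed) with its greatest value moved `i`
places to the left. -/
def secondVal (k m i p : ℕ) : ℕ :=
  if p < k - 1 - i then k - 1 - p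
  else if p = k - 1 - i then k + m - 1
  else if p < k then k - p
  else if p < k + m - 1 then k + m + k - 2 - p
  else 0

open Polynomial

variable {x : Equiv.Perm (Fin (k + m))}

theorem firstVal_mul_swap {v : Equiv.Perm (Fin (k + m))} {i : ℕ} (hk : 2 ≤ k)
    {a b : Fin (k + m)} (ha : (a : ℕ) = k - 1 + i) (hb : (b : ℕ) = a + 1)
    (hv : ∀ p, (v p : ℕ) = firstVal k m (i + 1) p) (p : Fin (k + m)) :
    ((v * Equiv.swap a b) p : ℕ) = firstVal k m i p := by
  have hva : (v a : ℕ) = k + m - (i + 1) := by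
    rw [hv, firstVal]
    split_ifs <;> omega
  have hvb : (v b : ℕ) = 0 := by
    rw [hv, firstVal]
    split_ifs <;> omega
  rw [val_mul_swap, hva, hvb, hv, firstVal, firstVal]
  split_ifs <;> omega

theorem secondVal_mul_swap {v : Equiv.Perm (Fin (k + m))} {i : ℕ} (hik : i + 1 < k)
    {a b : Fin (k + m)} (ha : (a : ℕ) + i + 2 = k) (hb : (b : ℕ) = a + 1)
    (hv : ∀ p, (v p : ℕ) = secondVal k m (i + 1) p) (p : Fin (k + m)) :
    ((v * Equiv.swap a b) p : ℕ) = secondVal k m i p := by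
  have hva : (v a : ℕ) = k + m - 1 := by
    rw [hv, secondVal]
    split_ifs <;> omega
  have hvb : (v b : ℕ) = i + 1 := by
    rw [hv, secondVal]
    split_ifs <;> omega
  rw [val_mul_swap, hva, hvb, hv, secondVal, secondVal]
  split_ifs <;> omega

theorem klmu_support_first_zero (F : KLFamily (k + m)) {v z : Equiv.Perm (Fin (k + m))}
    (hv : ∀ p, (v p : ℕ) = firstVal k m 0 p) {a b : Fin (k + m)}
    (ha : (a : ℕ) = k - 1) (hb : (b : ℕ) = a + 1) (hz : z b < z a) (hk : 2 ≤ k) :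
    klmu F.P z v = 0 := by
  by_contra h
  have hzv := F.bruhatLE_of_P_ne_zero (F.P_ne_zero_of_klmu_ne_zero h)
  have hzB : PreservesBlocks k m z := preservesBlocks_of_val_lt fun p hp => by
    refine val_lt_of_bruhatLE hzv (t := k) (fun q hq => ?_) p hp
    rw [hv, firstVal]
    split_ifs <;> omega
  have h₁ := hzB a
  have h₂ := hzB b
  rw [Fin.lt_def] at hz
  omega

theorem klmu_support_first (F : KLFamily (k + m)) {v z : Equiv.Perm (Fin (k + m))} {i : ℕ}
    (hk : 2 ≤ k) (hi : 1 ≤ i) (him : i < m) (hv : ∀ p, (v p : ℕ) = firstVal k m i p)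
    {a b c : Fin (k + m)} (ha : (a : ℕ) = k - 1 + i) (hb : (b : ℕ) = a + 1)
    (hc : (a : ℕ) = c + 1) (hz : z b < z a) (h : klmu F.P z v ≠ 0) :
    z = v * Equiv.swap c a := by
  by_contra hne
  have hzv := F.bruhatLE_of_P_ne_zero (F.P_ne_zero_of_klmu_ne_zero h)
  have hdesc : ∀ d e : Fin (k + m), (e : ℕ) = d + 1 → k - 1 ≤ (d : ℕ) → z e < z d := by
    intro d e he hd
    by_cases hda : d = a
    · have : e = b := Fin.ext (by rw [he, hda, hb])
      rwa [hda, this]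
    · have hda' : (d : ℕ) ≠ a := fun h => hda (Fin.ext h)
      refine F.descent_of_klmu_ne_zero he ?_ h ?_
      · rw [Fin.lt_def, hv, hv, firstVal, firstVal]
        split_ifs <;> omega
      · rintro rfl
        by_cases hdc : d = c
        · have : e = a := Fin.ext (by rw [he, hdc, hc])
          exact hne (by rw [hdc, this])
        · have hdc' : (d : ℕ) ≠ c := fun h => hdc (Fin.ext h)
          have hva : (v a : ℕ) = 0 := by
            rw [hv, firstVal]
            split_ifs <;> omega
          rw [Fin.lt_def, val_mul_swap _ _ _ a, if_neg (by omega), if_neg (by omega), hva] at hz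
          omega
  have hlast := last_le_of_bruhatLE hzv ⟨k + m - 1, by omega⟩ (by simp; omega)
  rw [hv, firstVal] at hlast
  have hlast' : k ≤ (z ⟨k + m - 1, by omega⟩ : ℕ) := by
    split_ifs at hlast <;> simp only at * <;> omega
  have hgrow : ∀ j, (hj : j ≤ m) → k + j ≤ (z ⟨k + m - 1 - j, by omega⟩ : ℕ) := by
    intro j
    induction j with
    | zero => intro _; simpa using hlast'
    | succ j ih =>
      intro hj
      have h₁ := ih (by omega)
      have h₂ := hdesc ⟨k + m - 1 - (j + 1), by omega⟩ ⟨k + m - 1 - j, by omega⟩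
        (by simp only; omega) (by simp only; omega)
      rw [Fin.lt_def] at h₂
      omega
  have := hgrow m le_rfl
  omega

theorem klmu_support_second (F : KLFamily (k + m)) (hx : ∀ i, (x i : ℕ) = xkmVal k m i)
    {v z : Equiv.Perm (Fin (k + m))} {i : ℕ} (hm : 2 ≤ m) (hi : i + 1 < k)
    (hv : ∀ p, (v p : ℕ) = secondVal k m i p)
    {a b c : Fin (k + m)} (ha : (a : ℕ) + i + 2 = k) (hb : (b : ℕ) = a + 1)
    (hc : (c : ℕ) = b + 1) (hz : z b < z a) (h : klmu F.P z v ≠ 0) :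
    z = x ∨ (1 ≤ i ∧ z = v * Equiv.swap b c) := by
  by_contra! hne
  obtain ⟨hzx, hne⟩ := hne
  have hzv := F.bruhatLE_of_P_ne_zero (F.P_ne_zero_of_klmu_ne_zero h)
  have hdesc : ∀ d e : Fin (k + m), (e : ℕ) = d + 1 → (e : ℕ) ≠ k → z e < z d := by
    intro d e he hek
    by_cases hda : d = a
    · have : e = b := Fin.ext (by rw [he, hda, hb])
      rwa [hda, this]
    · have hda' : (d : ℕ) ≠ a := fun h => hda (Fin.ext h)
      refine F.descent_of_klmu_ne_zero he ?_ h ?_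
      · rw [Fin.lt_def, hv, hv, secondVal, secondVal]
        split_ifs <;> omega
      · rintro rfl
        by_cases hdb : d = b
        · have : e = c := Fin.ext (by rw [he, hdb, hc])
          have hdb' : (d : ℕ) = b := by rw [hdb]
          exact hne (by omega) (by rw [hdb, this])
        · have hdb' : (d : ℕ) ≠ b := fun h => hdb (Fin.ext h)
          have hvb : (v b : ℕ) = k + m - 1 := by
            rw [hv, secondVal]
            split_ifs <;> omega
          rw [Fin.lt_def, val_mul_swap _ _ _ b, if_neg (by omega), if_neg (by omega), hvb] at hz
          omega
  refine hzx (eq_of_preservesBlocks hx (preservesBlocks_of_val_lt ?_) hdesc)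
  have hfirst : (z ⟨0, by omega⟩ : ℕ) < k := by
    refine val_lt_of_bruhatLE hzv (t := 1) (fun q hq => ?_) _ (by simp)
    rw [hv, secondVal]
    split_ifs <;> omega
  have hall : ∀ j, (hj : j < k) → (z ⟨j, by omega⟩ : ℕ) < k := by
    intro j
    induction j with
    | zero => intro _; exact hfirst
    | succ j ih =>
      intro hj
      have h₁ := ih (by omega)
      have h₂ := hdesc ⟨j, by omega⟩ ⟨j + 1, by omega⟩ rfl (by simp only; omega)
      rw [Fin.lt_def] at h₂
      omega
  exact fun p hp => hall p hp

theorem P_firstChain (F : KLFamily (k + m)) (hx : ∀ i, (x i : ℕ) = xkmVal k m i) (hk : 2 ≤ k)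
    (i : ℕ) (him : i ≤ m) {v : Equiv.Perm (Fin (k + m))}
    (hv : ∀ p, (v p : ℕ) = firstVal k m i p) :
    invLen v = invLen x + i ∧ ∀ y, PreservesBlocks k m y → F.P y v = 1 := by
  induction i using Nat.strong_induction_on generalizing v with
  | _ i ih =>
    rcases i with _ | i
    · have : v = x := by
        ext p
        rw [hv, hx, firstVal, xkmVal]
        split_ifs <;> omega
      subst this
      exact ⟨rfl, fun y hy => P_xkm_eq_one F hx hy⟩
    · obtain ⟨a, ha⟩ : ∃ a : Fin (k + m), (a : ℕ) = k - 1 + i := ⟨⟨k - 1 + i, by omega⟩, rfl⟩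
      obtain ⟨b, hb⟩ : ∃ b : Fin (k + m), (b : ℕ) = a + 1 := ⟨⟨a + 1, by omega⟩, rfl⟩
      obtain ⟨u, rfl⟩ : ∃ u, v = u * Equiv.swap a b :=
        ⟨v * Equiv.swap a b, (mul_swap_mul_swap v a b).symm⟩
      have hu := firstVal_mul_swap hk ha hb hv
      rw [mul_swap_mul_swap] at hu
      have hasc : u a < u b := by
        rw [Fin.lt_def, hu, hu, firstVal, firstVal]
        split_ifs <;> omega
      have hlen := invLen_mul_swap_of_lt hb hasc
      obtain ⟨hlu, hPu⟩ := ih i (by omega) (by omega) hu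
      refine ⟨by omega, fun y hy => ?_⟩
      rcases Nat.eq_zero_or_pos i with rfl | hi
      · rw [F.P_mul_swap_of_support hb hasc ∅ (by simp)
          (fun z hz h => absurd (klmu_support_first_zero F hu ha hb hz hk) h), hPu y hy]
        have hya := hy a
        have hyb := hy b
        have hyab : ¬ y b < y a := by
          rw [Fin.lt_def]
          omega
        have hzero : F.P (y * Equiv.swap a b) u = 0 := by
          apply F.eq_zero
          intro hle
          have := val_lt_of_bruhatLE hle (t := k) (k := k) (fun q hq => by
            rw [hu, firstVal]
            split_ifs <;> omega) a (by omega)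
          rw [val_mul_swap, if_pos rfl] at this
          omega
        simp [hyab, hzero]
      · obtain ⟨c, hc⟩ : ∃ c : Fin (k + m), (a : ℕ) = c + 1 :=
          ⟨⟨a - 1, by omega⟩, by simp only; omega⟩
        have hdc : u a < u c := by
          rw [Fin.lt_def, hu, hu, firstVal, firstVal]
          split_ifs <;> omega
        obtain ⟨i, rfl⟩ : ∃ j, i = j + 1 := ⟨i - 1, by omega⟩
        have ht := firstVal_mul_swap (i := i) hk (by omega) hc hu
        have htl := invLen_mul_swap_of_gt hc hdc
        obtain ⟨-, hPt⟩ := ih i (by omega) (by omega) ht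
        rw [F.P_mul_swap_of_support_of_eq hb hasc {u * Equiv.swap c a} ?_
          (fun z hz h => Finset.mem_singleton.2
            (klmu_support_first F hk hi (by omega) hu ha hb hc hz h)) y (hPu y hy)
            (hPu _ (hy.mul_swap (by omega))),
          Finset.sum_singleton, F.klmu_mul_swap hc hdc, hPt y hy,
          show (invLen u + 1 - invLen (u * Equiv.swap c a)) / 2 = 1 by omega]
        · simp
        · intro z hz
          rw [Finset.mem_singleton.1 hz, Fin.lt_def, ht, ht, firstVal, firstVal]
          split_ifs <;> omega

/-- The coefficient `μ` attached to a truncated geometric series. -/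
theorem klmu_geom_sum (F : KLFamily (k + m)) {z v : Equiv.Perm (Fin (k + m))} {i : ℕ}
    (hm : 1 ≤ m) (hlen : invLen v = invLen z + m + i)
    (hP : F.P z v = ∑ j ∈ Finset.range (min i (m - 1) + 1), X ^ j) :
    klmu F.P z v = if i + 1 = m then 1 else 0 := by
  rw [klmu, hP]
  simp only [finsetSum_coeff, coeff_X_pow, Finset.sum_ite_eq, Finset.mem_range]
  split_ifs <;> omega

theorem P_secondChain (F : KLFamily (k + m)) (hx : ∀ i, (x i : ℕ) = xkmVal k m i) (hk : 2 ≤ k)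
    (hm : 2 ≤ m) (i : ℕ) (hik : i < k) {v : Equiv.Perm (Fin (k + m))}
    (hv : ∀ p, (v p : ℕ) = secondVal k m i p) :
    invLen v = invLen x + m + i ∧ ∀ y, PreservesBlocks k m y →
      F.P y v = ∑ j ∈ Finset.range (min i (m - 1) + 1), X ^ j := by
  induction i using Nat.strong_induction_on generalizing v with
  | _ i ih =>
    rcases i with _ | i
    · have := P_firstChain F hx hk m le_rfl (v := v) (fun p => by
        rw [hv, secondVal, firstVal]
        split_ifs <;> omega)
      simpa using this
    · obtain ⟨a, ha⟩ : ∃ a : Fin (k + m), (a : ℕ) + i + 2 = k :=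
        ⟨⟨k - i - 2, by omega⟩, by simp only; omega⟩
      obtain ⟨b, hb⟩ : ∃ b : Fin (k + m), (b : ℕ) = a + 1 := ⟨⟨a + 1, by omega⟩, rfl⟩
      obtain ⟨c, hc⟩ : ∃ c : Fin (k + m), (c : ℕ) = b + 1 := ⟨⟨b + 1, by omega⟩, rfl⟩
      obtain ⟨u, rfl⟩ : ∃ u, v = u * Equiv.swap a b :=
        ⟨v * Equiv.swap a b, (mul_swap_mul_swap v a b).symm⟩
      have hu := secondVal_mul_swap hik ha hb hv
      rw [mul_swap_mul_swap] at hu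
      have hasc : u a < u b := by
        rw [Fin.lt_def, hu, hu, secondVal, secondVal]
        split_ifs <;> omega
      have hlen := invLen_mul_swap_of_lt hb hasc
      obtain ⟨hlu, hPu⟩ := ih i (by omega) (by omega) hu
      have hxdesc := descent_of_xkmVal hx hb (by omega)
      have hmu := klmu_geom_sum F (by omega) hlu (hPu x (preservesBlocks_of_xkmVal hx))
      refine ⟨by omega, fun y hy => ?_⟩
      have hys := hPu _ (hy.mul_swap (a := a) (b := b) (by omega))
      rcases Nat.eq_zero_or_pos i with rfl | hi
      · rw [F.P_mul_swap_of_support_of_eq hb hasc {x} (by simpa using hxdesc)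
          (fun z hz h => Finset.mem_singleton.2
            ((klmu_support_second F hx hm (by omega) hu ha hb hc hz h).resolve_right (by simp)))
          y (hPu y hy) hys, Finset.sum_singleton, hmu, if_neg (by omega)]
        rw [show min (0 + 1) (m - 1) = 1 by omega]
        simp [Finset.sum_range_succ]
      · have hdc : u c < u b := by
          rw [Fin.lt_def, hu, hu, secondVal, secondVal]
          split_ifs <;> omega
        obtain ⟨i, rfl⟩ : ∃ j, i = j + 1 := ⟨i - 1, by omega⟩
        have ht := secondVal_mul_swap (by omega) (by omega) hc hu
        have htl := invLen_mul_swap_of_gt hc hdc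
        obtain ⟨htx, hPt⟩ := ih i (by omega) (by omega) ht
        rw [F.P_mul_swap_of_support_of_eq hb hasc {x, u * Equiv.swap b c} ?_
          (fun z hz h => by
            have := klmu_support_second F hx hm (by omega) hu ha hb hc hz h
            simp only [Finset.mem_insert, Finset.mem_singleton]
            tauto) y (hPu y hy) hys,
          Finset.sum_pair (by intro h; rw [← h] at htx; omega), hmu, F.klmu_mul_swap hc hdc,
          hPt y hy, P_xkm_eq_one F hx hy,
          show (invLen u + 1 - invLen (u * Equiv.swap b c)) / 2 = 1 by omega]
        · rcases lt_trichotomy (i + 1 + 1) m with h | h | h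
          · rw [if_neg (by omega), show min (i + 1 + 1) (m - 1) = i + 2 by omega,
              show min (i + 1) (m - 1) = i + 1 by omega,
              show min i (m - 1) = i by omega]
            simp only [Finset.sum_range_succ, map_zero, map_one]
            ring
          · rw [if_pos h, show min (i + 1 + 1) (m - 1) = i + 1 by omega,
              show min (i + 1) (m - 1) = i + 1 by omega,
              show min i (m - 1) = i by omega,
              show (invLen u + 1 - invLen x) / 2 = i + 2 by omega]
            simp only [Finset.sum_range_succ, map_one]
            ring
          · rw [if_neg (by omega), show min (i + 1 + 1) (m - 1) = m - 1 by omega,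
              show min (i + 1) (m - 1) = m - 1 by omega, show min i (m - 1) = m - 1 by omega]
            simp only [map_zero, map_one]
            ring
        · intro z hz
          rcases Finset.mem_insert.1 hz with rfl | hz
          · exact hxdesc
          · rw [Finset.mem_singleton.1 hz, Fin.lt_def, ht, ht, secondVal, secondVal]
            split_ifs <;> omega

end Blocks

/-- For `k, m ≥ 2` and any Kazhdan–Lusztig family `P` for `S_{k+m}`,
`P_{x_{k,m}, w_{k,m}} = 1 + q + ⋯ + q^{min(k−1,m−1)}`. -/
theorem kl_4231 (k m : ℕ) (hk : 2 ≤ k) (hm : 2 ≤ m) (F : KLFamily (k + m))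
    (x w : Equiv.Perm (Fin (k + m)))
    (hx : ∀ i : Fin (k + m), (x i : ℕ) = xkmVal k m (i : ℕ))
    (hw : ∀ i : Fin (k + m), (w i : ℕ) = wkmVal k m (i : ℕ)) :
    F.P x w = ∑ j ∈ Finset.range (min (k - 1) (m - 1) + 1), Polynomial.X ^ j := by
  refine (P_secondChain F hx hk hm (k - 1) (by omega) (fun i => ?_)).2 x
    (preservesBlocks_of_xkmVal hx)
  rw [hw, wkmVal, secondVal]
  split_ifs <;> omega

end BSW
end
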